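/- Fix a real constant C > 0, an integer d ≥ 1, and an even positive integer n. There are only finitely many subfields K of ℝ that are totally real number fields of degree d satisfying U_K(n+4) < U_K(n) + C. -/

import Mathlib

open scoped TensorProduct

noncomputable section

open NumberField

structure OKLattice (K : Type) [Field K] : Type 1 where
  carrier : Type
  [addCommGroup : AddCommGroup carrier]
  [module : Module (𝓞 K) carrier]
  [finite : Module.Finite (𝓞 K) carrier]
  [torsionFree : NoZeroSMulDivisors (𝓞 K) carrier]
  form : carrier →ₗ[𝓞 K] carrier →ₗ[𝓞 K] 𝓞 K
  symm : ∀ x y, form x y = form y x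
  posDef : ∀ v : carrier, v ≠ 0 → ∀ σ : K →+* ℝ, 0 < σ (algebraMap (𝓞 K) K (form v v))

attribute [instance] OKLattice.addCommGroup OKLattice.module OKLattice.finite
  OKLattice.torsionFree

namespace OKLattice

variable {K : Type} [Field K]

/-- The rank of an `O_K`-lattice: the `K`-dimension of `L ⊗ K`. -/
def rank (L : OKLattice K) : ℕ :=
  Module.finrank K (K ⊗[𝓞 K] L.carrier)

/-- `L.Represents L'` : `L'` is represented by `L`. -/
def Represents (L L' : OKLattice K) : Prop :=
  ∃ σ : L'.carrier →ₗ[𝓞 K] L.carrier, ∀ x, L.form (σ x) (σ x) = L'.form x x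

/-- `L` is `n`-universal. -/
def IsUniversal (L : OKLattice K) (n : ℕ) : Prop :=
  ∀ L' : OKLattice K, L'.rank = n → L.Represents L'

end OKLattice

/-- `U_K(n)`: the minimal rank of an `n`-universal `O_K`-lattice. -/
def minUnivRank (K : Type) [Field K] (n : ℕ) : ℕ :=
  sInf {m | ∃ L : OKLattice K, L.IsUniversal n ∧ L.rank = m}

/-- `K` is totally real: every embedding into `ℂ` has image contained in `ℝ`. -/
def TotallyReal (K : Type) [Field K] : Prop :=
  ∀ φ : K →+* ℂ, ∀ x : K, (φ x).im = 0

section Embeddings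

variable {K : Type} [Field K]

/-- A real embedding of a totally real field obtained from a complex one. -/
def TotallyReal.toReal (hK : TotallyReal K) (φ : K →+* ℂ) : K →+* ℝ where
  toFun x := (φ x).re
  map_one' := by simp
  map_mul' x y := by simp [hK φ]
  map_zero' := by simp
  map_add' x y := by simp

lemma TotallyReal.ofReal_toReal (hK : TotallyReal K) (φ : K →+* ℂ) (x : K) :
    ((hK.toReal φ x : ℝ) : ℂ) = φ x := by
  apply Complex.ext <;> simp [TotallyReal.toReal, hK φ x]

/-- Real and complex embeddings of a totally real field correspond. -/
def TotallyReal.embEquiv (hK : TotallyReal K) : (K →+* ℝ) ≃ (K →+* ℂ) where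
  toFun σ := Complex.ofRealHom.comp σ
  invFun := hK.toReal
  left_inv σ := by ext x; simp [TotallyReal.toReal]
  right_inv φ := by ext x; simp [TotallyReal.ofReal_toReal]

variable [NumberField K]

instance : Fintype (K →+* ℝ) :=
  Fintype.ofInjective (fun σ : K →+* ℝ => Complex.ofRealHom.comp σ) (fun σ τ h => by
    ext x
    have := RingHom.congr_fun h x
    simpa using this)

lemma TotallyReal.card_emb (hK : TotallyReal K) :
    Fintype.card (K →+* ℝ) = Module.finrank ℚ K := by
  rw [Fintype.card_congr hK.embEquiv, Embeddings.card K ℂ]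

lemma TotallyReal.nonempty_emb (hK : TotallyReal K) : Nonempty (K →+* ℝ) :=
  ⟨hK.embEquiv.symm (Classical.arbitrary _)⟩

lemma TotallyReal.trace_eq (hK : TotallyReal K) (x : K) :
    ((Algebra.trace ℚ K x : ℚ) : ℝ) = ∑ σ : K →+* ℝ, σ x := by
  have h := trace_eq_sum_embeddings (K := ℚ) (L := K) ℂ (x := x)
  have h2 : ((∑ σ : K →+* ℝ, σ x : ℝ) : ℂ) = ∑ σ : K →ₐ[ℚ] ℂ, σ x := by
    push_cast
    refine Fintype.sum_equiv (hK.embEquiv.trans (RingHom.equivRatAlgHom (R := K) (S := ℂ))) _ _ ?_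
    intro σ
    rfl
  rw [← h2] at h
  have h3 : (((Algebra.trace ℚ K x : ℚ) : ℝ) : ℂ) = ((∑ σ : K →+* ℝ, σ x : ℝ) : ℂ) := by
    rw [← h]; simp
  exact_mod_cast h3

lemma TotallyReal.norm_eq (hK : TotallyReal K) (x : K) :
    ((Algebra.norm ℚ x : ℚ) : ℝ) = ∏ σ : K →+* ℝ, σ x := by
  have h := Algebra.norm_eq_prod_embeddings ℚ ℂ x
  have h2 : ((∏ σ : K →+* ℝ, σ x : ℝ) : ℂ) = ∏ σ : K →ₐ[ℚ] ℂ, σ x := by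
    push_cast
    refine Fintype.prod_equiv (hK.embEquiv.trans (RingHom.equivRatAlgHom (R := K) (S := ℂ))) _ _ ?_
    intro σ
    rfl
  rw [← h2] at h
  have h3 : (((Algebra.norm ℚ x : ℚ) : ℝ) : ℂ) = ((∏ σ : K →+* ℝ, σ x : ℝ) : ℂ) := by
    rw [← h]; simp
  exact_mod_cast h3

lemma one_le_abs_prod_emb (hK : TotallyReal K) {x : 𝓞 K} (hx : x ≠ 0) :
    1 ≤ ∏ σ : K →+* ℝ, |σ (x : K)| := by
  have h1 : (Algebra.norm ℚ (x : K)) = ((Algebra.norm ℤ x : ℤ) : ℚ) :=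
    (Algebra.coe_norm_int x).symm
  have h2 : Algebra.norm ℤ x ≠ 0 := by rwa [Ne, Algebra.norm_eq_zero_iff]
  rw [← Finset.abs_prod, ← hK.norm_eq, h1]
  have h3 : (1 : ℤ) ≤ |Algebra.norm ℤ x| := Int.one_le_abs h2
  exact_mod_cast h3

lemma eq_zero_of_abs_lt_one (hK : TotallyReal K) {x : 𝓞 K}
    (h : ∀ σ : K →+* ℝ, |σ (x : K)| < 1) : x = 0 := by
  by_contra hx
  have h1 := one_le_abs_prod_emb hK hx
  obtain ⟨σ0⟩ := hK.nonempty_emb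
  have h2 : ∏ σ : K →+* ℝ, |σ (x : K)| < ∏ σ : K →+* ℝ, (1 : ℝ) := by
    have hx' : (x : K) ≠ 0 := by simpa using hx
    apply Finset.prod_lt_prod
    · intro σ _; exact abs_pos.mpr (by simpa using hx)
    · intro σ _; exact (h σ).le
    · exact ⟨σ0, Finset.mem_univ _, h σ0⟩
  simp at h2
  linarith

/-- An algebraic integer all of whose conjugates lie strictly between `0` and `2` is `1`. -/
lemma eq_one_of_pos_of_lt_two (hK : TotallyReal K) {x : 𝓞 K}
    (h0 : ∀ σ : K →+* ℝ, 0 < σ (x : K)) (h : ∀ σ : K →+* ℝ, σ (x : K) < 2) : x = 1 := by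
  have : x - 1 = 0 := eq_zero_of_abs_lt_one hK fun σ => by
    have h1 := h0 σ
    have h2 := h σ
    simp only [map_sub, map_one, abs_lt]
    constructor <;> linarith
  exact sub_eq_zero.mp this

/-- An algebraic integer all of whose conjugates lie between `0` and `1` is `0` or `1`. -/
lemma eq_zero_or_one (hK : TotallyReal K) {x : 𝓞 K}
    (h0 : ∀ σ : K →+* ℝ, 0 ≤ σ (x : K)) (h : ∀ σ : K →+* ℝ, σ (x : K) ≤ 1) : x = 0 ∨ x = 1 := by
  by_cases hx : x = 0
  · exact Or.inl hx
  · refine Or.inr (eq_one_of_pos_of_lt_two hK (fun σ => ?_) fun σ => by linarith [h σ])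
    refine lt_of_le_of_ne (h0 σ) (Ne.symm ?_)
    simpa using hx

lemma finite_house_le (hK : TotallyReal K) (Y : ℝ) :
    {x : 𝓞 K | ∀ σ : K →+* ℝ, |σ (x : K)| ≤ Y}.Finite := by
  have h := Embeddings.finite_of_norm_le K ℂ Y
  refine Set.Finite.of_finite_image (f := fun x : 𝓞 K => (x : K)) (h.subset ?_) ?_
  · rintro _ ⟨x, hx, rfl⟩
    refine ⟨x.isIntegral_coe, fun φ => ?_⟩
    rw [← hK.ofReal_toReal φ]
    simpa using hx (hK.toReal φ)
  · exact RingOfIntegers.coe_injective.injOn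

lemma trace_int_eq (hK : TotallyReal K) (x : 𝓞 K) :
    ((Algebra.trace ℤ (𝓞 K) x : ℤ) : ℝ) = ∑ σ : K →+* ℝ, σ (x : K) := by
  rw [← hK.trace_eq, ← Algebra.coe_trace_int]; simp

lemma isIntegral_iff_exists {x : K} : IsIntegral ℤ x ↔ ∃ y : 𝓞 K, (y : K) = x :=
  ⟨fun h => ⟨⟨x, h⟩, rfl⟩, by rintro ⟨y, rfl⟩; exact y.isIntegral_coe⟩

end Embeddings

section ReducedBasis

lemma Int.exists_two_mul_abs_add_mul_le (a t : ℤ) (ht : 0 < t) : ∃ k : ℤ, 2 * |a + k * t| ≤ t := by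
  refine ⟨-((2 * a + t) / (2 * t)), ?_⟩
  have h1 := Int.emod_add_mul_ediv (2 * a + t) (2 * t)
  have h2 := Int.emod_nonneg (2 * a + t) (by positivity : (2 * t) ≠ 0)
  have h3 := Int.emod_lt_of_pos (2 * a + t) (by positivity : 0 < 2 * t)
  set q := (2 * a + t) / (2 * t)
  rw [← abs_two, ← abs_mul, abs_le]
  constructor <;> nlinarith

variable {M : Type} [AddCommGroup M]

/-- A nonzero vector on which a positive definite integral form is minimal. -/
lemma exists_minimal_vector [Nontrivial M] (T : M →ₗ[ℤ] M →ₗ[ℤ] ℤ) (pos : ∀ x, x ≠ 0 → 0 < T x x) :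
    ∃ b : M, b ≠ 0 ∧ ∀ x, x ≠ 0 → T b b ≤ T x x := by
  obtain ⟨y, hy⟩ := exists_ne (0 : M)
  obtain ⟨b, hb, hmin⟩ := WellFounded.has_min (measure fun x : M => (T x x).toNat).wf
    {x | x ≠ 0} ⟨y, hy⟩
  refine ⟨b, hb, fun x hx => ?_⟩
  have h1 : ¬ (T x x).toNat < (T b b).toNat := hmin x hx
  have := pos x hx
  have := pos b hb
  omega

/-- A minimal vector of a positive definite form is primitive. -/
lemma exists_dual_minimal_vector [Module.Free ℤ M] (T : M →ₗ[ℤ] M →ₗ[ℤ] ℤ)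
    (pos : ∀ x, x ≠ 0 → 0 < T x x) {b : M} (hb : b ≠ 0) (hmin : ∀ x, x ≠ 0 → T b b ≤ T x x) :
    ∃ f : M →ₗ[ℤ] ℤ, f b = 1 := by
  let I : Ideal ℤ := LinearMap.range (LinearMap.applyₗ (R := ℤ) (M := M) (M₂ := ℤ) b)
  obtain ⟨g, hg⟩ := (IsPrincipalIdealRing.principal I).principal
  have hgI : g ∈ I := by rw [hg]; exact Submodule.mem_span_singleton_self g
  obtain ⟨f, hf⟩ := hgI
  have hdiv : ∀ f' : M →ₗ[ℤ] ℤ, g ∣ f' b := by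
    intro f'
    have : f' b ∈ I := ⟨f', rfl⟩
    rw [hg] at this
    exact Ideal.mem_span_singleton.mp this
  let e := Module.Free.chooseBasis ℤ M
  choose c hc using fun i => hdiv (e.coord i)
  let b' : M := e.repr.symm (Finsupp.onFinset (e.repr b).support
    (fun i => if i ∈ (e.repr b).support then c i else 0) (by intro i; simp +contextual))
  have hbb : b = g • b' := by
    apply e.repr.injective
    ext i
    have := hc i
    simp only [Module.Basis.coord_apply] at this
    simp only [map_smul, LinearEquiv.apply_symm_apply, Finsupp.smul_apply, Finsupp.onFinset_apply,
      Finsupp.mem_support_iff, b', smul_eq_mul]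
    split_ifs with h
    · exact this
    · simpa using h
  have hb' : b' ≠ 0 := by
    intro h
    apply hb
    rw [hbb, h, smul_zero]
  have h1 := hmin b' hb'
  have h2 := pos b' hb'
  have h3 : T b b = g ^ 2 * T b' b' := by
    rw [hbb]
    simp only [map_smul, LinearMap.smul_apply, smul_eq_mul]
    ring
  have h0 := pos b hb
  have hg1 : g ^ 2 = 1 := by
    have : g ^ 2 ≤ 1 := by nlinarith
    have h5 : 0 < g ^ 2 := by
      by_contra h
      nlinarith
    omega
  refine ⟨g • f, ?_⟩
  have : f b = g := hf
  simp only [LinearMap.smul_apply, this, smul_eq_mul]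
  nlinarith

/-- The form `T(b,b) T(x,y) - T(x,b) T(y,b)`. -/
def projForm (T : M →ₗ[ℤ] M →ₗ[ℤ] ℤ) (b : M) : M →ₗ[ℤ] M →ₗ[ℤ] ℤ :=
  T b b • T - LinearMap.mk₂ ℤ (fun x y => T x b * T y b)
    (fun x x' y => by simp [add_mul]) (fun c x y => by simp [mul_assoc])
    (fun x y y' => by simp [mul_add]) (fun c x y => by simp; ring)

lemma projForm_apply (T : M →ₗ[ℤ] M →ₗ[ℤ] ℤ) (b x y : M) :
    projForm T b x y = T b b * T x y - T x b * T y b := by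
  simp [projForm]

lemma projForm_add_smul (T : M →ₗ[ℤ] M →ₗ[ℤ] ℤ) (symm : ∀ x y, T x y = T y x) (b x : M) (k : ℤ) :
    projForm T b (x + k • b) (x + k • b) = projForm T b x x := by
  simp only [projForm_apply, map_add, map_smul, LinearMap.add_apply, LinearMap.smul_apply,
    smul_eq_mul]
  rw [symm b x]
  ring

lemma projForm_pos (T : M →ₗ[ℤ] M →ₗ[ℤ] ℤ) (symm : ∀ x y, T x y = T y x)
    (pos : ∀ x, x ≠ 0 → 0 < T x x) {b : M} {f : M →ₗ[ℤ] ℤ} (hf : f b = 1)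
    [Module.Free ℤ M] {x : M} (hx : x ≠ 0) (hfx : f x = 0) : 0 < projForm T b x x := by
  have hb : b ≠ 0 := by rintro rfl; simp at hf
  have h0 := pos b hb
  by_cases h : T b b • x - T x b • b = 0
  · exfalso
    have h1 := congrArg f h
    simp only [map_sub, map_smul, hfx, hf, smul_eq_mul, map_zero] at h1
    have h2 : T x b = 0 := by linarith
    rw [h2, zero_smul, sub_zero] at h
    rcases smul_eq_zero.mp h with h | h
    · omega
    · exact hx h
  · have h1 := pos _ h
    have h2 : T (T b b • x - T x b • b) (T b b • x - T x b • b) = T b b * projForm T b x x := by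
      simp only [projForm_apply, map_sub, map_smul, LinearMap.sub_apply, LinearMap.smul_apply,
        smul_eq_mul]
      rw [symm b x]
      ring
    rw [h2] at h1
    exact (mul_pos_iff_of_pos_left h0).mp h1

lemma finrank_range_add_finrank_ker_int [Module.Free ℤ M] [Module.Finite ℤ M] (f : M →ₗ[ℤ] ℤ) :
    Module.finrank ℤ (LinearMap.range f) + Module.finrank ℤ (LinearMap.ker f) =
      Module.finrank ℤ M := by
  rw [← Submodule.finrank_quotient_add_finrank (LinearMap.ker f),
    LinearEquiv.finrank_eq f.quotKerEquivRange]

/-- Every positive definite integral form has a basis in which it is comparable, up to a constant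
depending only on the rank, with a diagonal form. -/
theorem exists_reduced_basis (r : ℕ) : ∃ C : ℕ, ∀ (M : Type) [AddCommGroup M] [Module.Free ℤ M]
    [Module.Finite ℤ M], Module.finrank ℤ M = r → ∀ T : M →ₗ[ℤ] M →ₗ[ℤ] ℤ,
    (∀ x y, T x y = T y x) → (∀ x, x ≠ 0 → 0 < T x x) →
    ∃ b : Fin r → M, (∀ v, ∃ x : Fin r → ℤ, ∑ i, x i • b i = v) ∧ (∀ i, b i ≠ 0) ∧
      ∀ (x : Fin r → ℤ) (i : Fin r), x i ^ 2 * T (b i) (b i) ≤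
        C * T (∑ i, x i • b i) (∑ i, x i • b i) := by
  induction r with
  | zero =>
    refine ⟨0, fun M _ _ _ hr T symm pos => ⟨Fin.elim0, fun v => ⟨0, ?_⟩, fun i => i.elim0,
      fun x i => i.elim0⟩⟩
    have := Module.finrank_zero_iff.mp hr
    exact Subsingleton.elim _ _
  | succ r ih =>
    obtain ⟨C, hC⟩ := ih
    refine ⟨2 * C + (r + 1) * (1 + r * C), fun M _ _ _ hr T symm pos => ?_⟩
    have : Nontrivial M := Module.nontrivial_of_finrank_pos (R := ℤ) (by omega)
    obtain ⟨b0, hb0, hmin⟩ := exists_minimal_vector T pos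
    obtain ⟨f, hf⟩ := exists_dual_minimal_vector T pos hb0 hmin
    set τ := T b0 b0 with hτ
    have hτ0 : 0 < τ := pos b0 hb0
    let N := LinearMap.ker f
    have hN : Module.finrank ℤ N = r := by
      change Module.finrank ℤ (LinearMap.ker f) = r
      have h1 := finrank_range_add_finrank_ker_int f
      have h2 : LinearMap.range f = ⊤ := by
        rw [LinearMap.range_eq_top]
        intro k
        exact ⟨k • b0, by simp [hf]⟩
      rw [h2, finrank_top, Module.finrank_self, hr] at h1
      omega
    let T' : N →ₗ[ℤ] N →ₗ[ℤ] ℤ := (projForm T b0).domRestrict₁₂ N N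
    have hT' : ∀ x y : N, T' x y = projForm T b0 x y := fun x y => rfl
    obtain ⟨b', hspan, hne, hred⟩ := hC N hN T'
      (fun x y => by rw [hT', hT', projForm_apply, projForm_apply, symm x.1 y.1]; ring)
      (fun x hx => by
        rw [hT']
        exact projForm_pos T symm pos hf (by simpa using hx) x.2)
    choose k hk using fun i => Int.exists_two_mul_abs_add_mul_le (T (b' i) b0) τ hτ0
    let c : Fin r → M := fun i => (b' i : M) + k i • b0
    have hcf : ∀ i, f (c i) = k i := by
      intro i
      have : f (b' i) = 0 := (b' i).2
      simp [c, this, hf]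
    have hcne : ∀ i, c i ≠ 0 := by
      intro i h
      have h1 := hcf i
      rw [h, map_zero] at h1
      apply hne i
      have h2 : c i = b' i := by simp [c, ← h1]
      rw [h] at h2
      exact Subtype.ext h2.symm
    have hcb : ∀ i, 2 * |T (c i) b0| ≤ τ := by
      intro i
      have := hk i
      simpa [c, ← hτ] using this
    refine ⟨Fin.cons b0 c, fun v => ?_, fun i => ?_, fun x => ?_⟩
    · obtain ⟨x, hx⟩ := hspan ⟨v - f v • b0, by simp [N, hf]⟩
      refine ⟨Fin.cons (f v - ∑ i, x i * k i) x, ?_⟩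
      have hx' : ∑ i, x i • (b' i : M) = v - f v • b0 := by
        have := congrArg (Submodule.subtype N) hx
        simpa using this
      rw [Fin.sum_univ_succ]
      simp only [Fin.cons_zero, Fin.cons_succ, c, smul_add, Finset.sum_add_distrib, hx',
        sub_smul, Finset.sum_smul, mul_smul]
      abel
    · refine Fin.cases ?_ (fun j => ?_) i
      · simpa using hb0
      · simpa using hcne j
    · set v : M := ∑ i, x i • (Fin.cons b0 c : Fin (r + 1) → M) i with hv
      have hv1 : v = x 0 • b0 + ∑ i : Fin r, x i.succ • c i := by
        rw [hv, Fin.sum_univ_succ]; simp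
      have hv2 : v = ((∑ i : Fin r, x i.succ • b' i : N) : M) +
          (x 0 + ∑ i : Fin r, x i.succ * k i) • b0 := by
        rw [hv1]
        simp only [c, smul_add, Finset.sum_add_distrib, add_smul, Finset.sum_smul, mul_smul,
          Submodule.coe_sum, Submodule.coe_smul_of_tower]
        abel
      have hTv0 : 0 ≤ T v v := by
        by_cases h : v = 0
        · simp [h]
        · exact (pos v h).le
      have hPv : projForm T b0 v v = T' (∑ i : Fin r, x i.succ • b' i)
          (∑ i : Fin r, x i.succ • b' i) := by
        rw [hT', hv2, projForm_add_smul T symm]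
      have hPv2 : projForm T b0 v v ≤ τ * T v v := by
        rw [projForm_apply]; nlinarith [mul_self_nonneg (T v b0)]
      have hi : ∀ i : Fin r, x i.succ ^ 2 * T (c i) (c i) ≤ 2 * C * T v v := by
        intro i
        have h1 := hred (fun i => x i.succ) i

        rw [← hPv, hT', ← projForm_add_smul T symm b0 _ (k i)] at h1
        change x i.succ ^ 2 * projForm T b0 (c i) (c i) ≤ _ at h1
        have h2 := hmin _ (hcne i)
        have h3 : 4 * (T (c i) b0 * T (c i) b0) ≤ τ * τ := by
          have := hcb i
          rw [← abs_mul_abs_self (T (c i) b0)]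
          nlinarith [abs_nonneg (T (c i) b0)]
        rw [projForm_apply, ← hτ] at h1
        have h4 : τ * T (c i) (c i) ≤ 2 * (τ * T (c i) (c i) - T (c i) b0 * T (c i) b0) := by
          nlinarith
        have h5 : x i.succ ^ 2 * (τ * T (c i) (c i)) ≤ 2 * (C * (τ * T v v)) := by
          have h6 := mul_le_mul_of_nonneg_left h4 (sq_nonneg (x i.succ))
          have h7 := mul_le_mul_of_nonneg_left hPv2 (Int.natCast_nonneg C)
          linarith
        have h8 : τ * (x i.succ ^ 2 * T (c i) (c i)) ≤ τ * (2 * C * T v v) := by linarith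
        exact le_of_mul_le_mul_left h8 hτ0
      have h0 : x 0 ^ 2 * τ ≤ (r + 1) * (1 + r * C) * T v v := by
        have e1 : x 0 * τ = T v b0 - ∑ i : Fin r, x i.succ * T (c i) b0 := by
          rw [hv1]
          simp [← hτ]
        have e2 : (x 0 * τ) ^ 2 ≤
            (r + 1) * (T v b0 ^ 2 + ∑ i : Fin r, (x i.succ * T (c i) b0) ^ 2) := by
          have h := sq_sum_le_card_mul_sum_sq (α := ℤ) (s := (Finset.univ : Finset (Fin (r + 1))))
            (f := Fin.cons (T v b0) (fun i => -(x i.succ * T (c i) b0)))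
          simp only [Fin.sum_univ_succ, Fin.cons_zero, Fin.cons_succ, Finset.card_univ,
            Fintype.card_fin, Finset.sum_neg_distrib, neg_sq] at h
          rw [e1, sub_eq_add_neg]
          exact_mod_cast h
        have e3 : T v b0 ^ 2 ≤ τ * T v v := by
          by_cases h : τ • v - T v b0 • b0 = 0
          · have h2 := congrArg (fun z => T v z) h
            simp only [map_sub, map_smul, smul_eq_mul, map_zero] at h2
            nlinarith
          · have h1 := pos _ h
            have h2 : T (τ • v - T v b0 • b0) (τ • v - T v b0 • b0) =
                τ * (τ * T v v - T v b0 ^ 2) := by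
              simp only [map_sub, map_smul, LinearMap.sub_apply, LinearMap.smul_apply,
                smul_eq_mul]
              rw [symm b0 v, ← hτ]
              ring
            rw [h2] at h1
            have := (mul_pos_iff_of_pos_left hτ0).mp h1
            linarith
        have e4 : ∀ i : Fin r, (x i.succ * T (c i) b0) ^ 2 ≤ τ * (C * T v v) := by
          intro i
          have h1 := hi i
          have h2 := hmin _ (hcne i)
          have h3 : 4 * (T (c i) b0 ^ 2) ≤ τ * τ := by
            have := hcb i
            rw [← sq_abs (T (c i) b0)]
            nlinarith [abs_nonneg (T (c i) b0)]
          have h4 : x i.succ ^ 2 * τ ≤ x i.succ ^ 2 * T (c i) (c i) :=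
            mul_le_mul_of_nonneg_left h2 (sq_nonneg _)
          have h5 := mul_le_mul_of_nonneg_left h3 (sq_nonneg (x i.succ))
          have h6 : τ * (x i.succ ^ 2 * τ) ≤ τ * (2 * C * T v v) :=
            mul_le_mul_of_nonneg_left (h4.trans h1) hτ0.le
          have h7 : 0 ≤ τ * (C * T v v) := by positivity
          rw [mul_pow]
          nlinarith
        have e5 : ∑ i : Fin r, (x i.succ * T (c i) b0) ^ 2 ≤ r * (τ * (C * T v v)) := by
          have := Finset.sum_le_card_nsmul Finset.univ _ _ (fun i _ => e4 i)
          simpa using this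
        have e6 : τ * (x 0 ^ 2 * τ) ≤ τ * ((r + 1) * (1 + r * C) * T v v) := by
          have h : ((r : ℤ) + 1) * (T v b0 ^ 2 + ∑ i : Fin r, (x i.succ * T (c i) b0) ^ 2) ≤
              (r + 1) * (τ * T v v + r * (τ * (C * T v v))) := by
            apply mul_le_mul_of_nonneg_left (add_le_add e3 e5) (by positivity)
          have := e2.trans h
          linarith
        exact le_of_mul_le_mul_left e6 hτ0
      intro i
      push_cast
      have hA : 0 ≤ 2 * C * T v v := by positivity
      have hB : 0 ≤ ((r : ℤ) + 1) * (1 + r * C) * T v v := by positivity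
      refine Fin.cases ?_ (fun j => ?_) i
      · simp only [Fin.cons_zero]
        rw [← hτ]; linarith
      · simp only [Fin.cons_succ]
        linarith [hi j]

/-- `exists_reduced_basis` stated with a bundled basis. -/
theorem exists_reduced_basis' (r : ℕ) : ∃ C : ℕ, ∀ (M : Type) [AddCommGroup M] [Module.Free ℤ M]
    [Module.Finite ℤ M], Module.finrank ℤ M = r → ∀ T : M →ₗ[ℤ] M →ₗ[ℤ] ℤ,
    (∀ x y, T x y = T y x) → (∀ x, x ≠ 0 → 0 < T x x) →
    ∃ b : Module.Basis (Fin r) ℤ M, ∀ v i, b.repr v i ^ 2 * T (b i) (b i) ≤ C * T v v := by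
  obtain ⟨C, hC⟩ := exists_reduced_basis r
  refine ⟨C, fun M _ _ _ hr T symm pos => ?_⟩
  obtain ⟨b, hspan, hne, hred⟩ := hC M hr T symm pos
  have hli : LinearIndependent ℤ b := by
    rw [Fintype.linearIndependent_iff]
    intro x hx i
    have h := hred x i
    rw [hx] at h
    simp only [map_zero, mul_zero] at h
    have h1 := pos _ (hne i)
    have h2 : x i ^ 2 ≤ 0 := by
      by_contra h3
      nlinarith
    exact pow_eq_zero_iff (two_ne_zero) |>.mp (le_antisymm h2 (sq_nonneg _))
  refine ⟨Module.Basis.mk hli ?_, fun v i => ?_⟩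
  · intro v _
    obtain ⟨x, rfl⟩ := hspan v
    exact Submodule.sum_mem _ fun i _ =>
      Submodule.smul_mem _ _ (Submodule.subset_span ⟨i, rfl⟩)
  · set B := Module.Basis.mk hli _
    have h := hred (fun i => B.repr v i) i
    have h2 : ∑ i, B.repr v i • b i = v := by
      have := B.sum_repr v
      simpa [B] using this
    rw [h2] at h
    simpa [B] using h

end ReducedBasis

section UniversalIntegerForms

open Matrix
open scoped Kronecker

lemma posSemidef_map_of_int {ι : Type} [Fintype ι] (A : Matrix ι ι ℤ) (symm : Aᵀ = A)
    (pos : ∀ x : ι → ℤ, 0 ≤ x ⬝ᵥ A *ᵥ x) : (A.map (Int.cast : ℤ → ℝ)).PosSemidef := by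
  have hrat : ∀ x : ι → ℚ, 0 ≤ (fun i => (x i : ℝ)) ⬝ᵥ (A.map (Int.cast : ℤ → ℝ)) *ᵥ
      (fun i => (x i : ℝ)) := by
    intro x
    let D : ℕ := ∏ i, (x i).den
    have hD : 0 < D := Finset.prod_pos fun i _ => (x i).pos
    have hz : ∀ i, ∃ z : ℤ, (z : ℝ) = D * x i := by
      intro i
      obtain ⟨c, hc⟩ : (x i).den ∣ D := Finset.dvd_prod_of_mem _ (Finset.mem_univ i)
      refine ⟨c * (x i).num, ?_⟩
      have h := Rat.den_mul_eq_num (x i)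
      have h' : ((x i).den : ℝ) * (x i : ℝ) = (x i).num := by exact_mod_cast h
      rw [hc]
      push_cast
      rw [← h']
      ring
    choose z hz using hz
    have h1 := pos z
    have h2 : (0 : ℝ) ≤ ((z ⬝ᵥ A *ᵥ z : ℤ) : ℝ) := by exact_mod_cast h1
    have h3 : ((z ⬝ᵥ A *ᵥ z : ℤ) : ℝ) = D ^ 2 * ((fun i => (x i : ℝ)) ⬝ᵥ
        (A.map (Int.cast : ℤ → ℝ)) *ᵥ (fun i => (x i : ℝ))) := by
      simp only [dotProduct, mulVec, Matrix.map_apply, Finset.mul_sum]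
      push_cast
      simp only [hz]
      refine Finset.sum_congr rfl fun i _ => Finset.sum_congr rfl fun j _ => ?_
      ring
    rw [h3] at h2
    have hD' : (0 : ℝ) < (D : ℝ) ^ 2 := by positivity
    exact nonneg_of_mul_nonneg_right h2 hD'
  refine PosSemidef.of_dotProduct_mulVec_nonneg ?_ fun x => ?_
  · ext i j
    have := congrFun (congrFun symm i) j
    simp only [transpose_apply] at this
    simp [this]
  · have hd : DenseRange (Pi.map (fun (_ : ι) (q : ℚ) => (q : ℝ))) :=
      DenseRange.piMap fun _ => Rat.denseRange_cast
    refine hd.induction_on (p := fun x => 0 ≤ star x ⬝ᵥ (A.map (Int.cast : ℤ → ℝ)) *ᵥ x) x ?_ ?_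
    · apply isClosed_le continuous_const
      simp only [star_trivial, dotProduct, mulVec]
      fun_prop
    · intro y
      exact hrat y

/-- A positive definite integer matrix is positive definite over the reals. -/
lemma posDef_map_of_int {ι : Type} [Fintype ι] [DecidableEq ι] (A : Matrix ι ι ℤ) (symm : Aᵀ = A)
    (pos : ∀ x : ι → ℤ, x ≠ 0 → 0 < x ⬝ᵥ A *ᵥ x) : (A.map (Int.cast : ℤ → ℝ)).PosDef := by
  have h := posSemidef_map_of_int A symm fun x => by
    by_cases hx : x = 0
    · simp [hx]
    · exact (pos x hx).le
  rw [h.posDef_iff_det_ne_zero]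
  have h1 : (A.map (Int.cast : ℤ → ℝ)).det = (A.det : ℝ) :=
    (RingHom.map_det (Int.castRingHom ℝ) A).symm
  rw [h1]
  intro h0
  obtain ⟨v, hv, hv0⟩ := Matrix.exists_mulVec_eq_zero_iff.mpr (Int.cast_eq_zero.mp h0)
  have := pos v hv
  rw [hv0] at this
  simp at this

/-- The matrix of left multiplication by an integral quaternion. -/
def quatMatrix (a b c d : ℤ) : Matrix (Fin 4) (Fin 4) ℤ :=
  !![a, -b, -c, -d; b, a, -d, c; c, d, a, -b; d, -c, b, a]

lemma quatMatrix_mul_transpose (a b c d : ℤ) :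
    quatMatrix a b c d * (quatMatrix a b c d)ᵀ = (a ^ 2 + b ^ 2 + c ^ 2 + d ^ 2) • 1 := by
  ext i j
  fin_cases i <;> fin_cases j <;>
    simp [quatMatrix, Matrix.mul_apply, Fin.sum_univ_four] <;> ring

lemma quatMatrix_transpose_mul (a b c d : ℤ) :
    (quatMatrix a b c d)ᵀ * quatMatrix a b c d = (a ^ 2 + b ^ 2 + c ^ 2 + d ^ 2) • 1 := by
  ext i j
  fin_cases i <;> fin_cases j <;>
    simp [quatMatrix, Matrix.mul_apply, Fin.sum_univ_four] <;> ring

/-- Every positive definite integral form embeds in a unimodular one of eight times the rank. -/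
lemma exists_unimodular_of_posDef {ι : Type} [Fintype ι] [DecidableEq ι] (A : Matrix ι ι ℤ)
    (symm : Aᵀ = A) (pos : ∀ x : ι → ℤ, x ≠ 0 → 0 < x ⬝ᵥ A *ᵥ x) :
    ∃ G G' : Matrix ((ι × Fin 4) ⊕ (ι × Fin 4)) ((ι × Fin 4) ⊕ (ι × Fin 4)) ℤ,
      Gᵀ = G ∧ G * G' = 1 ∧ (∀ x, x ≠ 0 → 0 < x ⬝ᵥ G *ᵥ x) ∧
        G.submatrix (fun i => Sum.inr (i, 0)) (fun i => Sum.inr (i, 0)) = A := by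
  have hA := posDef_map_of_int A symm pos
  set A' := A.map (Int.cast : ℤ → ℝ) with hA'
  have hdet : A'.det = (A.det : ℝ) := (RingHom.map_det (Int.castRingHom ℝ) A).symm
  have hdet0 : 0 < A.det := by
    have := hA.det_pos
    rw [hdet] at this
    exact_mod_cast this
  obtain ⟨a, b, c, d, habcd⟩ := Nat.sum_four_squares (A.det - 1).toNat
  set J := quatMatrix a b c d with hJ
  have hsum : ((a : ℤ) ^ 2 + (b : ℤ) ^ 2 + (c : ℤ) ^ 2 + (d : ℤ) ^ 2) = A.det - 1 := by
    have : ((a ^ 2 + b ^ 2 + c ^ 2 + d ^ 2 : ℕ) : ℤ) = A.det - 1 := by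
      rw [habcd]; omega
    exact_mod_cast this
  have hJ1 : J * Jᵀ = (A.det - 1) • 1 := by rw [hJ, quatMatrix_mul_transpose, hsum]
  have hJ2 : Jᵀ * J = (A.det - 1) • 1 := by rw [hJ, quatMatrix_transpose_mul, hsum]
  let G : Matrix ((ι × Fin 4) ⊕ (ι × Fin 4)) ((ι × Fin 4) ⊕ (ι × Fin 4)) ℤ :=
    fromBlocks (A.adjugate ⊗ₖ 1) (1 ⊗ₖ Jᵀ) (1 ⊗ₖ J) (A ⊗ₖ 1)
  let G' : Matrix ((ι × Fin 4) ⊕ (ι × Fin 4)) ((ι × Fin 4) ⊕ (ι × Fin 4)) ℤ :=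
    fromBlocks (A ⊗ₖ 1) (-(1 ⊗ₖ Jᵀ)) (-(1 ⊗ₖ J)) (A.adjugate ⊗ₖ 1)
  have hsymm : Gᵀ = G := by
    simp only [G]
    rw [fromBlocks_transpose, ← kroneckerMap_transpose, ← kroneckerMap_transpose,
      ← kroneckerMap_transpose, ← kroneckerMap_transpose, transpose_transpose, transpose_one,
      transpose_one, adjugate_transpose, symm]
  have hGG' : G * G' = 1 := by
    simp only [G, G', fromBlocks_multiply, mul_neg, ← mul_kronecker_mul, one_mul, mul_one,
      adjugate_mul, mul_adjugate, hJ1, hJ2]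
    rw [← fromBlocks_one]
    congr 1
    · rw [smul_kronecker, kronecker_smul, one_kronecker_one, sub_smul, one_smul]; abel
    · abel
    · abel
    · rw [smul_kronecker, kronecker_smul, one_kronecker_one, sub_smul, one_smul]; abel
  have hmap : G.map (Int.cast : ℤ → ℝ) = fromBlocks ((A.adjugate.map (Int.cast : ℤ → ℝ)) ⊗ₖ 1)
      (1 ⊗ₖ (J.map (Int.cast : ℤ → ℝ))ᵀ) (1 ⊗ₖ (J.map (Int.cast : ℤ → ℝ))ᵀ)ᴴ (A' ⊗ₖ 1) := by
    ext i j
    rcases i with ⟨i1, i2⟩ | ⟨i1, i2⟩ <;> rcases j with ⟨j1, j2⟩ | ⟨j1, j2⟩ <;>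
      simp [G, kroneckerMap_apply, Matrix.one_apply, A', apply_ite, eq_comm]
    all_goals aesop
  have hPSD : (G.map (Int.cast : ℤ → ℝ)).PosSemidef := by
    have hD : (A' ⊗ₖ (1 : Matrix (Fin 4) (Fin 4) ℝ)).PosDef := hA.kronecker PosDef.one
    have hunit : IsUnit A'.det := isUnit_iff_ne_zero.mpr hA.det_pos.ne'
    have : Invertible A' := invertibleOfIsUnitDet A' hunit
    have : Invertible (A' ⊗ₖ (1 : Matrix (Fin 4) (Fin 4) ℝ)) := hD.isUnit.invertible
    rw [hmap, PosDef.fromBlocks₂₂ _ _ hD]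
    have hadj : A.adjugate.map (Int.cast : ℤ → ℝ) = (A.det : ℝ) • A'⁻¹ := by
      have h1 : A.adjugate.map (Int.cast : ℤ → ℝ) = A'.adjugate :=
        RingHom.map_adjugate (Int.castRingHom ℝ) A
      rw [h1, inv_def, smul_smul, ← hdet, Ring.mul_inverse_cancel _ hunit, one_smul]
    have hJ3 : (J.map (Int.cast : ℤ → ℝ))ᵀ * J.map (Int.cast : ℤ → ℝ) =
        ((A.det : ℝ) - 1) • (1 : Matrix (Fin 4) (Fin 4) ℝ) := by
      have := congrArg (fun M : Matrix (Fin 4) (Fin 4) ℤ => M.map (Int.castRingHom ℝ)) hJ2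
      simp only [Matrix.map_mul] at this
      refine this.trans ?_
      ext i j
      by_cases h : i = j <;>
        simp only [Matrix.map_apply, Matrix.smul_apply, Matrix.one_apply, h, if_true, if_false,
          smul_eq_mul, map_mul, map_sub, map_one, map_zero, eq_intCast]
    have hinv : (A' ⊗ₖ (1 : Matrix (Fin 4) (Fin 4) ℝ))⁻¹ = A'⁻¹ ⊗ₖ 1 := by
      rw [inv_kronecker, inv_one]
    have key : (A.adjugate.map (Int.cast : ℤ → ℝ)) ⊗ₖ (1 : Matrix (Fin 4) (Fin 4) ℝ) -
        (1 ⊗ₖ (J.map (Int.cast : ℤ → ℝ))ᵀ) * (A' ⊗ₖ (1 : Matrix (Fin 4) (Fin 4) ℝ))⁻¹ *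
        (1 ⊗ₖ (J.map (Int.cast : ℤ → ℝ))ᵀ)ᴴ = A'⁻¹ ⊗ₖ 1 := by
      rw [hinv, conjTranspose_kronecker, conjTranspose_one, conjTranspose_eq_transpose_of_trivial,
        transpose_transpose, ← mul_kronecker_mul, ← mul_kronecker_mul, one_mul, mul_one, mul_one,
        hJ3, hadj, smul_kronecker, kronecker_smul, sub_smul, one_smul]
      abel
    rw [key]
    exact hA.posSemidef.inv.kronecker PosSemidef.one
  refine ⟨G, G', hsymm, hGG', ?_, ?_⟩
  · have hdetG : (G.map (Int.cast : ℤ → ℝ)).det ≠ 0 := by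
      have h1 : (G.map (Int.cast : ℤ → ℝ)).det = (G.det : ℝ) :=
        (RingHom.map_det (Int.castRingHom ℝ) G).symm
      rw [h1]
      have h2 := congrArg Matrix.det hGG'
      rw [det_mul, det_one] at h2
      have : G.det ≠ 0 := by
        intro h
        simp [h] at h2
      exact_mod_cast this
    have hPD := hPSD.posDef_iff_det_ne_zero.mpr hdetG
    intro x hx
    have h1 := hPD.dotProduct_mulVec_pos (x := fun i => (x i : ℝ)) (by
      intro h
      apply hx
      ext i
      have := congrFun h i
      simpa using this)
    have h2 : star (fun i => (x i : ℝ)) ⬝ᵥ (G.map (Int.cast : ℤ → ℝ)) *ᵥ (fun i => (x i : ℝ)) =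
        ((x ⬝ᵥ G *ᵥ x : ℤ) : ℝ) := by
      simp [dotProduct, mulVec]
    rw [h2] at h1
    exact_mod_cast h1
  · ext i j
    simp [G]

end UniversalIntegerForms

section UniversalIntegerForms

open Matrix

lemma form_eq_gram {ι M : Type} [Fintype ι] [AddCommGroup M] (T : M →ₗ[ℤ] M →ₗ[ℤ] ℤ)
    (b : Module.Basis ι ℤ M) (v w : M) :
    T v w = (fun i => b.repr v i) ⬝ᵥ (Matrix.of fun i j => T (b i) (b j)) *ᵥ
      (fun i => b.repr w i) := by
  conv_lhs => rw [← b.sum_repr v, ← b.sum_repr w]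
  simp only [map_sum, map_smul, LinearMap.sum_apply, LinearMap.smul_apply, smul_eq_mul, dotProduct,
    mulVec, of_apply, Finset.mul_sum]
  rw [Finset.sum_comm]
  refine Finset.sum_congr rfl fun i _ => Finset.sum_congr rfl fun j _ => ?_
  ring

lemma abs_form_le {M : Type} [AddCommGroup M] (T : M →ₗ[ℤ] M →ₗ[ℤ] ℤ)
    (symm : ∀ x y, T x y = T y x) (nonneg : ∀ x, 0 ≤ T x x) (C : ℤ) (x y : M)
    (hx : T x x ≤ C) (hy : T y y ≤ C) : |T x y| ≤ C := by
  have h1 := nonneg (x + y)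
  have h2 := nonneg (x - y)
  simp only [map_add, map_sub, LinearMap.add_apply, LinearMap.sub_apply] at h1 h2
  rw [symm y x] at h1 h2
  rw [abs_le]
  constructor <;> linarith

/-- A unimodular positive definite integral form has a basis of vectors bounded in terms of the
rank. -/
lemma exists_bounded_basis_of_unimodular (r : ℕ) : ∃ C : ℕ, ∀ (M : Type) [AddCommGroup M]
    [Module.Free ℤ M] [Module.Finite ℤ M], Module.finrank ℤ M = r → ∀ T : M →ₗ[ℤ] M →ₗ[ℤ] ℤ,
    (∀ x y, T x y = T y x) → (∀ x, x ≠ 0 → 0 < T x x) →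
    (∀ f : M →ₗ[ℤ] ℤ, ∃ y, ∀ v, T y v = f v) →
    ∃ b : Module.Basis (Fin r) ℤ M, ∀ i j, |T (b i) (b j)| ≤ C := by
  obtain ⟨C, hC⟩ := exists_reduced_basis' r
  refine ⟨C, fun M _ _ _ hr T symm pos uni => ?_⟩
  obtain ⟨b, hb⟩ := hC M hr T symm pos
  have nonneg : ∀ x, 0 ≤ T x x := fun x => by
    by_cases h : x = 0
    · simp [h]
    · exact (pos x h).le
  have hle : ∀ i, T (b i) (b i) ≤ C := by
    intro i
    obtain ⟨y, hy⟩ := uni (b.coord i)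
    have h1 : b.repr y i = T y y := (hy y).symm
    have hy0 : y ≠ 0 := by
      rintro rfl
      have := hy (b i)
      simp at this
    have h2 := hb y i
    rw [h1] at h2
    have h3 := pos y hy0
    have h4 : T y y * (T y y * T (b i) (b i)) ≤ T y y * C := by linarith
    have h5 := le_of_mul_le_mul_left h4 h3
    have h6 := nonneg (b i)
    nlinarith
  exact ⟨b, fun i j => abs_form_le T symm nonneg C _ _ (hle i) (hle j)⟩

/-- There are finitely many positive definite integer matrices such that every positive definite
integral form of rank at most `m` is represented by one of them. -/
theorem exists_universal_int_forms (m : ℕ) : ∃ S : Finset (Σ r : ℕ, Matrix (Fin r) (Fin r) ℤ),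
    (∀ s ∈ S, s.2ᵀ = s.2 ∧ ∀ x, x ≠ 0 → 0 < x ⬝ᵥ s.2 *ᵥ x) ∧
    ∀ (M : Type) [AddCommGroup M] [Module.Free ℤ M] [Module.Finite ℤ M],
      Module.finrank ℤ M ≤ m → ∀ T : M →ₗ[ℤ] M →ₗ[ℤ] ℤ,
      (∀ x y, T x y = T y x) → (∀ x, x ≠ 0 → 0 < T x x) →
      ∃ s ∈ S, ∃ ρ : M →ₗ[ℤ] (Fin s.1 → ℤ), ∀ x, T x x = ρ x ⬝ᵥ s.2 *ᵥ ρ x := by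
  classical
  choose C hC using exists_bounded_basis_of_unimodular
  let P : ∀ r, Set (Matrix (Fin (8 * r)) (Fin (8 * r)) ℤ) := fun r =>
    {A | (∀ i j, |A i j| ≤ C (8 * r)) ∧ Aᵀ = A ∧ ∀ x, x ≠ 0 → 0 < x ⬝ᵥ A *ᵥ x}
  have hfin : ∀ r, (P r).Finite := by
    intro r
    have h : (Set.pi Set.univ fun _ : Fin (8 * r) => Set.pi Set.univ fun _ : Fin (8 * r) =>
        Set.Icc (-(C (8 * r) : ℤ)) (C (8 * r))).Finite :=
      Set.Finite.pi fun _ => Set.Finite.pi fun _ => Set.finite_Icc _ _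
    refine h.subset ?_
    intro A hA i _ j _
    exact abs_le.mp (hA.1 i j)
  refine ⟨(Finset.range (m + 1)).biUnion fun r => (hfin r).toFinset.image fun A => ⟨8 * r, A⟩,
    ?_, ?_⟩
  · intro s hs
    simp only [Finset.mem_biUnion, Finset.mem_image, Set.Finite.mem_toFinset] at hs
    obtain ⟨r, _, A, hA, rfl⟩ := hs
    exact hA.2
  · intro M _ _ _ hM T symm pos
    obtain ⟨r, hr⟩ : ∃ r, Module.finrank ℤ M = r := ⟨_, rfl⟩
    let e : Module.Basis (Fin r) ℤ M := Module.finBasisOfFinrankEq ℤ M hr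
    let A : Matrix (Fin r) (Fin r) ℤ := Matrix.of fun i j => T (e i) (e j)
    have hTA : ∀ v w, T v w = (fun i => e.repr v i) ⬝ᵥ A *ᵥ (fun i => e.repr w i) :=
      form_eq_gram T e
    obtain ⟨G, G', hG, hGG', hGpos, hGA⟩ := exists_unimodular_of_posDef A
      (by ext i j; simp [A, symm (e i)])
      (fun x hx => by
        have h := hTA (e.equivFun.symm x) (e.equivFun.symm x)
        have h2 : (fun i => e.repr (e.equivFun.symm x) i) = x := by
          have := e.equivFun.apply_symm_apply x
          exact this
        rw [h2] at h
        rw [← h]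
        exact pos _ (e.equivFun.symm.map_ne_zero_iff.mpr hx))
    let N := (Fin r × Fin 4) ⊕ (Fin r × Fin 4)
    let TG : (N → ℤ) →ₗ[ℤ] (N → ℤ) →ₗ[ℤ] ℤ := Matrix.toLinearMap₂' ℤ G
    have hTG : ∀ v w, TG v w = v ⬝ᵥ G *ᵥ w := Matrix.toLinearMap₂'_apply' G
    have hTGs : ∀ v w, TG v w = TG w v := by
      intro v w
      rw [hTG, hTG, dotProduct_mulVec, ← mulVec_transpose, hG, dotProduct_comm]
    have hN : Module.finrank ℤ (N → ℤ) = 8 * r := by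
      simp [N]; ring
    obtain ⟨b, hb⟩ := hC (8 * r) (N → ℤ) hN TG hTGs
      (fun x hx => by rw [hTG]; exact hGpos x hx) (fun f => by
        refine ⟨G'ᵀ *ᵥ (fun i => f (Pi.single i 1)), fun v => ?_⟩
        rw [hTG, mulVec_transpose, ← dotProduct_mulVec, mulVec_mulVec,
          mul_eq_one_comm.mp hGG', one_mulVec]
        rw [LinearMap.pi_apply_eq_sum_univ f v, dotProduct]
        refine Finset.sum_congr rfl fun i _ => ?_
        rw [smul_eq_mul, mul_comm]
        congr 2
        ext j
        simp [Pi.single_apply, eq_comm])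
    let B : Matrix (Fin (8 * r)) (Fin (8 * r)) ℤ := Matrix.of fun i j => TG (b i) (b j)
    have hTB : ∀ v w, TG v w = (fun i => b.repr v i) ⬝ᵥ B *ᵥ (fun i => b.repr w i) :=
      form_eq_gram TG b
    have hBP : B ∈ P r := by
      refine ⟨hb, by ext i j; simp [B, hTGs (b i)], fun x hx => ?_⟩
      have h := hTB (b.equivFun.symm x) (b.equivFun.symm x)
      have h2 : (fun i => b.repr (b.equivFun.symm x) i) = x := b.equivFun.apply_symm_apply x
      rw [h2] at h
      rw [← h, hTG]
      exact hGpos _ (b.equivFun.symm.map_ne_zero_iff.mpr hx)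
    let emb : M →ₗ[ℤ] (N → ℤ) := e.constr ℤ fun i => Pi.single (Sum.inr (i, 0)) 1
    have hemb : ∀ x, TG (emb x) (emb x) = T x x := by
      intro x
      have h1 : emb x = ∑ i, e.repr x i • (Pi.single (Sum.inr (i, 0)) 1 : N → ℤ) := by
        simp [emb, Module.Basis.constr_apply_fintype]
      rw [hTA, h1]
      simp only [map_sum, map_smul, LinearMap.sum_apply, LinearMap.smul_apply, smul_eq_mul,
        dotProduct, mulVec, Finset.mul_sum]
      rw [Finset.sum_comm]
      refine Finset.sum_congr rfl fun i _ => Finset.sum_congr rfl fun j _ => ?_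
      have h2 : TG (Pi.single (Sum.inr (i, 0)) 1) (Pi.single (Sum.inr (j, 0)) 1) = A i j := by
        rw [← hGA, hTG]
        simp
      rw [h2]
      ring
    refine ⟨⟨8 * r, B⟩, ?_, b.equivFun.toLinearMap ∘ₗ emb, fun x => ?_⟩
    · simp only [Finset.mem_biUnion, Finset.mem_image, Set.Finite.mem_toFinset, Finset.mem_range]
      exact ⟨r, by omega, B, hBP, rfl⟩
    · rw [← hemb, hTB]
      rfl

end UniversalIntegerForms

section CauchySchwarz

variable {A M : Type} [CommRing A] [AddCommGroup M] [Module A M]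

/-- The Cauchy-Schwarz inequality for a form that is positive semidefinite with respect to a real
place. -/
lemma sq_form_le (B : M →ₗ[A] M →ₗ[A] A) (symm : ∀ x y, B x y = B y x) (σ : A →+* ℝ)
    (nonneg : ∀ x, 0 ≤ σ (B x x)) (x y : M) : σ (B x y) ^ 2 ≤ σ (B x x) * σ (B y y) := by
  have key : ∀ x y, 0 < σ (B y y) → σ (B x y) ^ 2 ≤ σ (B x x) * σ (B y y) := by
    intro x y hy
    have h := nonneg (B y y • x - B x y • y)
    simp only [map_sub, map_smul, LinearMap.sub_apply, LinearMap.smul_apply, smul_eq_mul, map_mul,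
      symm y x] at h
    have h2 : 0 ≤ σ (B y y) * (σ (B x x) * σ (B y y) - σ (B x y) ^ 2) := by linarith
    have := nonneg_of_mul_nonneg_right h2 hy
    linarith
  rcases (nonneg y).lt_or_eq with hy | hy
  · exact key x y hy
  rcases (nonneg x).lt_or_eq with hx | hx
  · rw [symm x y, mul_comm]
    exact key y x hx
  have h1 := nonneg (x + y)
  have h2 := nonneg (x - y)
  simp only [map_add, map_sub, LinearMap.add_apply, LinearMap.sub_apply, symm y x] at h1 h2
  have h3 : σ (B x y) = 0 := by linarith
  rw [h3, ← hx]
  simp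

end CauchySchwarz

lemma finrank_range_add_finrank_ker_of_isDomain {A M N : Type} [CommRing A] [IsDomain A]
    [AddCommGroup M] [Module A M] [Module.Finite A M] [AddCommGroup N] [Module A N]
    (f : M →ₗ[A] N) :
    Module.finrank A (LinearMap.range f) + Module.finrank A (LinearMap.ker f) =
      Module.finrank A M := by
  rw [← f.quotKerEquivRange.finrank_eq]
  exact Submodule.finrank_quotient_add_finrank _

lemma finrank_prod_of_isDomain {A M N : Type} [CommRing A] [IsDomain A]
    [AddCommGroup M] [Module A M] [Module.Finite A M] [AddCommGroup N] [Module A N]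
    [Module.Finite A N] :
    Module.finrank A (M × N) = Module.finrank A M + Module.finrank A N := by
  rw [← finrank_range_add_finrank_ker_of_isDomain (LinearMap.snd A M N), Submodule.range_snd,
    finrank_top, LinearMap.ker_snd, LinearMap.finrank_range_of_inj LinearMap.inl_injective,
    add_comm]

namespace OKLattice

variable {K : Type} [Field K]

lemma form_self_nonneg (L : OKLattice K) (x : L.carrier) (σ : K →+* ℝ) :
    0 ≤ σ (L.form x x : K) := by
  by_cases h : x = 0
  · simp [h]
  · exact (L.posDef x h σ).le

lemma sq_form_le (L : OKLattice K) (x y : L.carrier) (σ : K →+* ℝ) :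
    σ (L.form x y : K) ^ 2 ≤ σ (L.form x x : K) * σ (L.form y y : K) :=
  _root_.sq_form_le L.form L.symm (σ.comp (algebraMap (𝓞 K) K))
    (fun x => L.form_self_nonneg x σ) x y

lemma eq_zero_of_form_self (L : OKLattice K) (σ : K →+* ℝ) {x : L.carrier}
    (h : L.form x x = 0) : x = 0 := by
  by_contra hx
  have := L.posDef x hx σ
  rw [h] at this
  simp at this

/-- A linear map preserving the norm form preserves the bilinear form. -/
lemma form_map_of_form_self [CharZero K] {L L' : OKLattice K} {σ : L'.carrier →ₗ[𝓞 K] L.carrier}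
    (h : ∀ x, L.form (σ x) (σ x) = L'.form x x) (x y : L'.carrier) :
    L.form (σ x) (σ y) = L'.form x y := by
  have h1 := h (x + y)
  simp only [map_add, LinearMap.add_apply, h, L.symm (σ y), L'.symm y] at h1
  have h2 : 2 * L.form (σ x) (σ y) = 2 * L'.form x y := by linear_combination h1
  exact mul_left_cancel₀ two_ne_zero h2

lemma Represents.trans {L₁ L₂ L₃ : OKLattice K} (h : L₁.Represents L₂) (h' : L₂.Represents L₃) :
    L₁.Represents L₃ := by
  obtain ⟨s, hs⟩ := h
  obtain ⟨t, ht⟩ := h'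
  exact ⟨s ∘ₗ t, fun x => by simp [hs, ht]⟩

/-- The orthogonal sum of two lattices. -/
def prod (L L' : OKLattice K) : OKLattice K where
  carrier := L.carrier × L'.carrier
  torsionFree := ⟨fun {c x} h => by
    rcases smul_eq_zero.mp (congrArg Prod.fst h : c • x.1 = 0) with h1 | h1
    · exact Or.inl h1
    rcases smul_eq_zero.mp (congrArg Prod.snd h : c • x.2 = 0) with h2 | h2
    · exact Or.inl h2
    exact Or.inr (Prod.ext h1 h2)⟩
  form := LinearMap.mk₂ (𝓞 K) (fun x y => L.form x.1 y.1 + L'.form x.2 y.2)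
    (by intros; simp; ring) (by intros; simp; ring) (by intros; simp; ring) (by intros; simp; ring)
  symm x y := by simp [L.symm x.1, L'.symm x.2]
  posDef v hv σ := by
    simp only [LinearMap.mk₂_apply, map_add]
    by_cases h : v.1 = 0
    · have h2 : v.2 ≠ 0 := fun h2 => hv (Prod.ext h h2)
      exact add_pos_of_nonneg_of_pos (L.form_self_nonneg _ σ) (L'.posDef _ h2 σ)
    · exact add_pos_of_pos_of_nonneg (L.posDef _ h σ) (L'.form_self_nonneg _ σ)

lemma prod_form (L L' : OKLattice K) (x y : L.carrier × L'.carrier) :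
    (L.prod L').form x y = L.form x.1 y.1 + L'.form x.2 y.2 := rfl

lemma prod_represents_left (L L' : OKLattice K) : (L.prod L').Represents L :=
  ⟨LinearMap.inl (𝓞 K) L.carrier L'.carrier, fun x => by
    refine (prod_form L L' (x, 0) (x, 0)).trans ?_
    simp⟩

lemma prod_represents_right (L L' : OKLattice K) : (L.prod L').Represents L' :=
  ⟨LinearMap.inr (𝓞 K) L.carrier L'.carrier, fun x => by
    refine (prod_form L L' (0, x) (0, x)).trans ?_
    simp⟩

variable [NumberField K]

lemma rank_eq_finrank (L : OKLattice K) : L.rank = Module.finrank (𝓞 K) L.carrier := by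
  unfold rank
  rw [IsFractionRing.finrank_right_eq (𝓞 K) K]
  exact IsLocalizedModule.finrank_eq (nonZeroDivisors (𝓞 K))
    (TensorProduct.mk (𝓞 K) K L.carrier 1) le_rfl

lemma rank_prod (L L' : OKLattice K) : (L.prod L').rank = L.rank + L'.rank := by
  rw [rank_eq_finrank, rank_eq_finrank, rank_eq_finrank]
  exact finrank_prod_of_isDomain

/-- The lattice `O_K ^ ι` with the form given by a positive definite integer matrix. -/
def ofIntMatrix {ι : Type} [Fintype ι] [DecidableEq ι] (A : Matrix ι ι ℤ)
    (hA : A.transpose = A)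
    (pos : ∀ x, x ≠ 0 → 0 < dotProduct x (A.mulVec x)) : OKLattice K where
  carrier := ι → 𝓞 K
  form := Matrix.toLinearMap₂' (𝓞 K) (A.map (Int.cast : ℤ → 𝓞 K))
  symm x y := by
    rw [Matrix.toLinearMap₂'_apply', Matrix.toLinearMap₂'_apply', Matrix.dotProduct_mulVec,
      ← Matrix.mulVec_transpose, ← Matrix.transpose_map, hA, dotProduct_comm]
  posDef v hv σ := by
    have h := (posDef_map_of_int A hA pos).dotProduct_mulVec_pos
      (x := fun i => σ (v i : K)) (fun h => hv (by
        ext i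
        have := congrFun h i
        simpa using this))
    rw [Matrix.toLinearMap₂'_apply']
    simpa [dotProduct, Matrix.mulVec] using h

lemma ofIntMatrix_form {ι : Type} [Fintype ι] [DecidableEq ι] (A : Matrix ι ι ℤ)
    (hA : A.transpose = A)
    (pos : ∀ x, x ≠ 0 → 0 < dotProduct x (A.mulVec x)) (x y : ι → 𝓞 K) :
    (ofIntMatrix A hA pos : OKLattice K).form x y =
      dotProduct x ((A.map (Int.cast : ℤ → 𝓞 K)).mulVec y) := by
  exact Matrix.toLinearMap₂'_apply' _ x y

lemma rank_ofIntMatrix {ι : Type} [Fintype ι] [DecidableEq ι] (A : Matrix ι ι ℤ)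
    (hA : A.transpose = A)
    (pos : ∀ x, x ≠ 0 → 0 < dotProduct x (A.mulVec x)) :
    (ofIntMatrix A hA pos : OKLattice K).rank = Fintype.card ι := by
  rw [rank_eq_finrank]
  exact Module.finrank_fintype_fun_eq_card _

lemma IsUniversal.represents_of_rank_le {L : OKLattice K} {n : ℕ} (hL : L.IsUniversal n)
    (L' : OKLattice K) (h : L'.rank ≤ n) : L.Represents L' := by
  let I : OKLattice K := ofIntMatrix (1 : Matrix (Fin (n - L'.rank)) (Fin (n - L'.rank)) ℤ)
    Matrix.transpose_one (fun x hx => by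
      rw [Matrix.one_mulVec]
      exact lt_of_le_of_ne (Finset.sum_nonneg fun i _ => mul_self_nonneg _)
        (fun h => hx (dotProduct_self_eq_zero.mp h.symm)))
  refine (hL (L'.prod I) ?_).trans (L'.prod_represents_left I)
  rw [rank_prod, rank_ofIntMatrix, Fintype.card_fin]
  omega

/-- Orthogonal sums of finite families of lattices. -/
lemma exists_sum {ι : Type} (s : Finset ι) (L : ι → OKLattice K) :
    ∃ L' : OKLattice K, L'.rank = ∑ i ∈ s, (L i).rank ∧ ∀ i ∈ s, L'.Represents (L i) := by
  classical
  induction s using Finset.induction_on with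
  | empty =>
    refine ⟨ofIntMatrix (0 : Matrix (Fin 0) (Fin 0) ℤ) Matrix.transpose_zero
      (fun x hx => (hx (Subsingleton.elim _ _)).elim), ?_, by simp⟩
    rw [rank_ofIntMatrix]
    simp
  | insert a s ha ih =>
    obtain ⟨L', h1, h2⟩ := ih
    refine ⟨(L a).prod L', ?_, ?_⟩
    · rw [rank_prod, h1, Finset.sum_insert ha]
    · intro i hi
      rcases Finset.mem_insert.mp hi with rfl | hi
      · exact prod_represents_left _ _
      · exact (prod_represents_right _ _).trans (h2 i hi)

end OKLattice

section SumsOfSquares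

lemma sum_comm_four {ι κ R : Type} [Fintype ι] [Fintype κ] [AddCommMonoid R]
    (F : ι → ι → κ → κ → R) :
    ∑ a, ∑ c, ∑ j, ∑ k, F a c j k = ∑ j, ∑ k, ∑ a, ∑ c, F a c j k := by
  calc ∑ a, ∑ c, ∑ j, ∑ k, F a c j k = ∑ a, ∑ j, ∑ k, ∑ c, F a c j k :=
        Finset.sum_congr rfl fun a _ => by
          rw [Finset.sum_comm]
          exact Finset.sum_congr rfl fun j _ => Finset.sum_comm
    _ = _ := by
          rw [Finset.sum_comm]
          exact Finset.sum_congr rfl fun j _ => Finset.sum_comm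

/-- A finite module over a domain has a finite family spanning it up to torsion whose cardinality is
the rank. -/
lemma exists_family_smul_mem_span (A M : Type) [CommRing A] [IsDomain A] [AddCommGroup M]
    [Module A M] [Module.Finite A M] : ∃ v : Fin (Module.finrank A M) → M,
    ∀ x, ∃ c : A, c ≠ 0 ∧ c • x ∈ Submodule.span A (Set.range v) := by
  obtain ⟨v, hv⟩ := exists_linearIndependent_of_le_finrank (R := A) (M := M) le_rfl
  refine ⟨v, fun x => ?_⟩
  have h1 := Submodule.finrank_quotient_add_finrank (Submodule.span A (Set.range v))
  rw [finrank_span_eq_card hv, Fintype.card_fin] at h1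
  have h2 : Module.finrank A (M ⧸ Submodule.span A (Set.range v)) = 0 := by omega
  rw [Module.finrank_eq_zero_iff] at h2
  obtain ⟨a, ha, h⟩ := h2 (Submodule.Quotient.mk x)
  exact ⟨a, ha, by rwa [← Submodule.Quotient.mk_smul, Submodule.Quotient.mk_eq_zero] at h⟩

variable {K : Type} [Field K] [NumberField K]

lemma finrank_int_submodule_dual_le {M : Type} [AddCommGroup M] [Module (𝓞 K) M]
    [Module.Finite (𝓞 K) M] (W : Submodule ℤ (M →ₗ[𝓞 K] 𝓞 K)) :
    Module.finrank ℤ W ≤ Module.finrank (𝓞 K) M * Module.finrank ℚ K := by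
  obtain ⟨v, hv⟩ := exists_family_smul_mem_span (𝓞 K) M
  let ev : W →ₗ[ℤ] (Fin (Module.finrank (𝓞 K) M) → 𝓞 K) :=
    { toFun := fun f i => f.1 (v i)
      map_add' := fun f g => rfl
      map_smul' := fun c f => by ext i; simp }
  have hinj : Function.Injective ev := by
    rw [injective_iff_map_eq_zero]
    intro f hf
    ext x
    obtain ⟨c, hc, hx⟩ := hv x
    have h1 : Submodule.span (𝓞 K) (Set.range v) ≤ LinearMap.ker f.1 := by
      rw [Submodule.span_le]
      rintro _ ⟨i, rfl⟩
      exact congrFun hf i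
    have h2 := h1 hx
    rw [LinearMap.mem_ker, map_smul, smul_eq_mul] at h2
    simpa [hc] using h2
  refine (LinearMap.finrank_le_finrank_of_injective hinj).trans ?_
  rw [Module.finrank_pi_fintype]
  simp [RingOfIntegers.rank]

/-- Over all totally real fields of degree `d` there are lattices `H` of bounded rank which
represent all sums of squares of linear functionals on lattices of rank at most `n`. -/
theorem exists_lattice_representing_sum_sq (n d : ℕ) : ∃ g : ℕ, ∀ (K : Type) [Field K]
    [NumberField K], Module.finrank ℚ K = d → ∃ H : OKLattice K, H.rank = g ∧
    ∀ (M : Type) [AddCommGroup M] [Module (𝓞 K) M] [Module.Finite (𝓞 K) M],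
      Module.finrank (𝓞 K) M ≤ n → ∀ (h : ℕ) (l : Fin h → M →ₗ[𝓞 K] 𝓞 K),
      ∃ τ : M →ₗ[𝓞 K] H.carrier, ∀ x, H.form (τ x) (τ x) = ∑ i, l i x ^ 2 := by
  classical
  obtain ⟨S, hS, hrep⟩ := exists_universal_int_forms (n * d)
  refine ⟨∑ s ∈ S, s.1, fun K _ _ hK => ?_⟩
  let Hs : (Σ r : ℕ, Matrix (Fin r) (Fin r) ℤ) → OKLattice K := fun s =>
    if h : s ∈ S then OKLattice.ofIntMatrix s.2 (hS s h).1 (hS s h).2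
    else OKLattice.ofIntMatrix (0 : Matrix (Fin 0) (Fin 0) ℤ) Matrix.transpose_zero
      (fun x hx => (hx (Subsingleton.elim _ _)).elim)
  obtain ⟨H, hH, hHs⟩ := OKLattice.exists_sum S Hs
  refine ⟨H, ?_, ?_⟩
  · rw [hH]
    refine Finset.sum_congr rfl fun s hs => ?_
    simp only [Hs, hs, dif_pos]
    rw [OKLattice.rank_ofIntMatrix, Fintype.card_fin]
  intro M _ _ _ hM h l
  let W : Submodule ℤ (M →ₗ[𝓞 K] 𝓞 K) := Submodule.span ℤ (Set.range l)
  have hl : ∀ i, l i ∈ W := fun i => Submodule.subset_span ⟨i, rfl⟩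
  have : Module.Finite ℤ W := Module.Finite.span_of_finite ℤ (Set.finite_range l)
  have : Module.IsTorsionFree ℤ W := inferInstance
  have : Module.Free ℤ W := inferInstance
  have hW : Module.finrank ℤ (Module.Dual ℤ W) ≤ n * d := by
    rw [Module.finrank_linearMap_self]
    refine (finrank_int_submodule_dual_le W).trans ?_
    rw [hK]
    exact Nat.mul_le_mul_right d hM
  let T : Module.Dual ℤ W →ₗ[ℤ] Module.Dual ℤ W →ₗ[ℤ] ℤ :=
    LinearMap.mk₂ ℤ (fun f g => ∑ i, f ⟨l i, hl i⟩ * g ⟨l i, hl i⟩)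
      (by intros; simp [add_mul, Finset.sum_add_distrib])
      (by intros; simp [mul_assoc, Finset.mul_sum])
      (by intros; simp [mul_add, Finset.sum_add_distrib])
      (by intros; simp [mul_left_comm, Finset.mul_sum])
  have hT : ∀ f g, T f g = ∑ i, f ⟨l i, hl i⟩ * g ⟨l i, hl i⟩ := fun f g => rfl
  have symm : ∀ f g, T f g = T g f := fun f g => by simp only [hT, mul_comm]
  obtain ⟨s, hs, ρ, hρ⟩ := hrep (Module.Dual ℤ W) hW T symm (fun f hf => by
    rw [hT]
    refine lt_of_le_of_ne (Finset.sum_nonneg fun i _ => mul_self_nonneg _) fun h0 => hf ?_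
    have h1 : ∀ i, f ⟨l i, hl i⟩ = 0 := fun i => by
      have := (Finset.sum_eq_zero_iff_of_nonneg fun i _ => mul_self_nonneg _).mp h0.symm i
        (Finset.mem_univ i)
      simpa using this
    ext ⟨w, hw⟩
    induction hw using Submodule.span_induction with
    | mem x hx => obtain ⟨i, rfl⟩ := hx; exact h1 i
    | zero => exact f.map_zero
    | add x y hx hy h1 h2 =>
      have := f.map_add ⟨x, hx⟩ ⟨y, hy⟩
      rw [h1, h2] at this
      exact this
    | smul a x hx h1 =>
      have := f.map_smul a ⟨x, hx⟩
      rw [h1] at this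
      simpa using this)
  let P : (Fin s.1 → ℤ) →ₗ[ℤ] (Fin s.1 → ℤ) →ₗ[ℤ] ℤ := Matrix.toLinearMap₂' ℤ s.2
  have hP : ∀ v w, P v w = v ⬝ᵥ s.2.mulVec w := Matrix.toLinearMap₂'_apply' s.2
  have hPs : ∀ v w, P v w = P w v := by
    intro v w
    rw [hP, hP, Matrix.dotProduct_mulVec, ← Matrix.mulVec_transpose, (hS s hs).1, dotProduct_comm]
  have hρ2 : ∀ f g, T f g = P (ρ f) (ρ g) := by
    intro f g
    have h := hρ (f + g)
    have hf := hρ f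
    have hg := hρ g
    rw [← hP] at h hf hg
    simp only [map_add, LinearMap.add_apply] at h
    rw [symm g f, hPs (ρ g)] at h
    linarith
  let b := Module.finBasis ℤ W
  let D := fun a => ρ (b.coord a)
  let G : OKLattice K := OKLattice.ofIntMatrix s.2 (hS s hs).1 (hS s hs).2
  let τ : M →ₗ[𝓞 K] (Fin s.1 → 𝓞 K) :=
    LinearMap.pi fun j => ∑ a, (D a j : 𝓞 K) • (b a).1
  have hτ : ∀ x, G.form (τ x) (τ x) = ∑ i, l i x ^ 2 := by
    intro x
    let evx : W →ₗ[ℤ] 𝓞 K :=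
      { toFun := fun w => w.1 x
        map_add' := fun _ _ => rfl
        map_smul' := fun c f => by simp }
    have h1 : ∀ i, l i x = ∑ a, (b.coord a ⟨l i, hl i⟩ : 𝓞 K) * (b a).1 x := by
      intro i
      have h2 := congrArg evx (b.sum_repr ⟨l i, hl i⟩)
      rw [map_sum] at h2
      refine h2.symm.trans (Finset.sum_congr rfl fun a _ => ?_)
      rw [map_smul, zsmul_eq_mul]
      rfl
    have h3 : ∀ a c, ∑ i, b.coord a ⟨l i, hl i⟩ * b.coord c ⟨l i, hl i⟩ =
        ∑ j, ∑ k, D a j * (s.2 j k * D c k) := by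
      intro a c
      rw [← hT, hρ2, hP]
      simp [dotProduct, Matrix.mulVec, Finset.mul_sum, D]
    have h4 : ∑ i, l i x ^ 2 = ∑ a, ∑ c, ((∑ i, b.coord a ⟨l i, hl i⟩ * b.coord c ⟨l i, hl i⟩ : ℤ)
        : 𝓞 K) * ((b a).1 x * (b c).1 x) := by
      simp only [h1, pow_two, Finset.sum_mul_sum]
      simp only [Int.cast_sum, Finset.sum_mul, Int.cast_mul]
      rw [Finset.sum_comm]
      refine Finset.sum_congr rfl fun a _ => ?_
      rw [Finset.sum_comm]
      refine Finset.sum_congr rfl fun c _ => Finset.sum_congr rfl fun i _ => ?_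
      ring
    refine (OKLattice.ofIntMatrix_form s.2 (hS s hs).1 (hS s hs).2 (τ x) (τ x)).trans ?_
    rw [h4]
    simp only [h3]
    simp only [τ, dotProduct, Matrix.mulVec, LinearMap.pi_apply, LinearMap.sum_apply,
      LinearMap.smul_apply, smul_eq_mul, Matrix.map_apply, Finset.mul_sum, Finset.sum_mul,
      Int.cast_sum, Int.cast_mul]
    rw [sum_comm_four, Finset.sum_comm]
    refine Finset.sum_congr rfl fun j _ => Finset.sum_congr rfl fun k _ => ?_
    refine Finset.sum_congr rfl fun a _ => Finset.sum_congr rfl fun c _ => ?_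
    ring
  have hG : H.Represents G := by
    have := hHs s hs
    simp only [Hs, hs, dif_pos] at this
    exact this
  obtain ⟨e, he⟩ := hG
  exact ⟨e ∘ₗ τ, fun x => by rw [← hτ x]; exact he (τ x)⟩

end SumsOfSquares

/-- A finitely generated `O_K`-submodule of a `K`-vector space with a totally positive definite
form which is integral on it. -/
structure KLattice (K V : Type) [Field K] [AddCommGroup V] [Module K V] [Module (𝓞 K) V] where
  form : V →ₗ[K] V →ₗ[K] K
  symm : ∀ x y, form x y = form y x
  posDef : ∀ v, v ≠ 0 → ∀ σ : K →+* ℝ, 0 < σ (form v v)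
  carrier : Submodule (𝓞 K) V
  fg : carrier.FG
  isIntegral : ∀ x ∈ carrier, ∀ y ∈ carrier, IsIntegral ℤ (form x y)

namespace KLattice

section Basic

variable {K V : Type} [Field K] [AddCommGroup V] [Module K V] [Module (𝓞 K) V]

lemma form_self_nonneg (Q : KLattice K V) (v : V) (σ : K →+* ℝ) : 0 ≤ σ (Q.form v v) := by
  by_cases h : v = 0
  · simp [h]
  · exact (Q.posDef v h σ).le

lemma sq_form_le (Q : KLattice K V) (x y : V) (σ : K →+* ℝ) :
    σ (Q.form x y) ^ 2 ≤ σ (Q.form x x) * σ (Q.form y y) :=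
  _root_.sq_form_le Q.form Q.symm σ (fun v => Q.form_self_nonneg v σ) x y

lemma eq_zero_of_form_self (Q : KLattice K V) (σ : K →+* ℝ) {x : V} (h : Q.form x x = 0) :
    x = 0 := by
  by_contra hx
  have := Q.posDef x hx σ
  rw [h] at this
  simp at this

variable [IsScalarTower (𝓞 K) K V]

lemma smul_eq (c : 𝓞 K) (v : V) : c • v = (c : K) • v := by
  rw [← algebraMap_smul K c v]

lemma form_smul_left (Q : KLattice K V) (c : 𝓞 K) (x y : V) :
    Q.form (c • x) y = (c : K) * Q.form x y := by
  rw [smul_eq, map_smul, LinearMap.smul_apply, smul_eq_mul]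

lemma form_smul_right (Q : KLattice K V) (c : 𝓞 K) (x y : V) :
    Q.form x (c • y) = (c : K) * Q.form x y := by
  rw [smul_eq, map_smul, smul_eq_mul]

/-- The dual lattice. -/
def dual (Q : KLattice K V) : Submodule (𝓞 K) V where
  carrier := {v | ∀ x ∈ Q.carrier, IsIntegral ℤ (Q.form v x)}
  zero_mem' := fun x _ => by simpa using isIntegral_zero
  add_mem' := fun {v w} hv hw x hx => by
    rw [map_add, LinearMap.add_apply]
    exact (hv x hx).add (hw x hx)
  smul_mem' := fun c v hv x hx => by
    rw [form_smul_left]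
    exact c.isIntegral_coe.mul (hv x hx)

lemma carrier_le_dual (Q : KLattice K V) : Q.carrier ≤ Q.dual := fun x hx y hy =>
  Q.isIntegral x hx y hy

/-- The lattice spans the ambient space. -/
def IsFull (Q : KLattice K V) : Prop := ∀ v, ∃ c : 𝓞 K, c ≠ 0 ∧ c • v ∈ Q.carrier

/-- The lattice is a maximal integral lattice. -/
def IsMax (Q : KLattice K V) : Prop := ∀ v ∈ Q.dual, IsIntegral ℤ (Q.form v v) → v ∈ Q.carrier

/-- No nonzero vector of the dual lattice has norm at most one at all places. -/
def IsTight (Q : KLattice K V) : Prop :=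
  ∀ v ∈ Q.dual, (∀ σ : K →+* ℝ, σ (Q.form v v) ≤ 1) → v = 0

instance (Q : KLattice K V) : Module.Finite (𝓞 K) Q.carrier := Module.Finite.iff_fg.mpr Q.fg

lemma noZeroSMulDivisors (Q : KLattice K V) : NoZeroSMulDivisors (𝓞 K) Q.carrier :=
  ⟨fun {c x} h => by
    have h2 : (c : K) • x.1 = 0 := by
      rw [← smul_eq]
      exact congrArg Subtype.val h
    rcases smul_eq_zero.mp h2 with h3 | h3
    · exact Or.inl (RingOfIntegers.coe_eq_zero_iff.mp h3)
    · exact Or.inr (Subtype.ext h3)⟩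

/-- The abstract lattice underlying a lattice in a vector space. -/
def toOKLattice (Q : KLattice K V) : OKLattice K where
  carrier := Q.carrier
  torsionFree := Q.noZeroSMulDivisors
  form := LinearMap.mk₂ (𝓞 K) (fun x y => ⟨Q.form x y, Q.isIntegral x x.2 y y.2⟩)
    (fun x y z => RingOfIntegers.ext
      (show Q.form (x.1 + y.1) z = Q.form x z + Q.form y z by simp))
    (fun c x y => RingOfIntegers.ext
      (show Q.form (c • x.1) y = c * Q.form x y from form_smul_left Q c x y))
    (fun x y z => RingOfIntegers.ext
      (show Q.form x (y.1 + z.1) = Q.form x y + Q.form x z by simp))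
    (fun c x y => RingOfIntegers.ext
      (show Q.form x (c • y.1) = c * Q.form x y from form_smul_right Q c x y))
  symm x y := RingOfIntegers.ext (Q.symm x.1 y.1)
  posDef v hv σ := Q.posDef v.1 (fun h => hv (Subtype.ext h)) σ

lemma rank_toOKLattice_le [NumberField K] [Module.Finite K V] (Q : KLattice K V) :
    Q.toOKLattice.rank ≤ Module.finrank K V := by
  rw [OKLattice.rank_eq_finrank, IsFractionRing.finrank_right_eq (𝓞 K) K]
  refine Cardinal.toNat_le_toNat (Submodule.rank_le Q.carrier) ?_
  rw [← IsFractionRing.rank_right_eq (𝓞 K) K]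
  exact Module.rank_lt_aleph0 K V

end Basic

section Maximal

variable {K V : Type} [Field K] [NumberField K] [AddCommGroup V] [Module K V] [Module (𝓞 K) V]
  [IsScalarTower (𝓞 K) K V]

lemma IsFull.eq_zero {Q : KLattice K V} (hQ : Q.IsFull) (σ : K →+* ℝ) {v : V}
    (h : ∀ x ∈ Q.carrier, Q.form v x = 0) : v = 0 := by
  obtain ⟨c, hc, hcv⟩ := hQ v
  have h1 := h _ hcv
  rw [form_smul_right] at h1
  refine Q.eq_zero_of_form_self σ ?_
  simpa [hc] using h1

lemma IsFull.isNoetherian_dual {Q : KLattice K V} (hQ : Q.IsFull) (σ : K →+* ℝ) :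
    IsNoetherian (𝓞 K) Q.dual := by
  obtain ⟨s, hs⟩ := Q.fg
  have hmem : ∀ g : s, g.1 ∈ Q.carrier := fun g => hs ▸ Submodule.subset_span g.2
  let f : Q.dual →ₗ[𝓞 K] (s → 𝓞 K) :=
    { toFun := fun v g => ⟨Q.form v g.1, v.2 _ (hmem g)⟩
      map_add' := fun v w => funext fun g => RingOfIntegers.ext
        (show Q.form (v.1 + w.1) g = Q.form v g + Q.form w g by simp)
      map_smul' := fun c v => funext fun g => RingOfIntegers.ext
        (show Q.form (c • v.1) g = c * Q.form v g from form_smul_left Q c v g) }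
  refine isNoetherian_of_injective f ?_
  rw [injective_iff_map_eq_zero]
  intro v hv
  refine Subtype.ext (hQ.eq_zero σ fun x hx => ?_)
  rw [← hs] at hx
  induction hx using Submodule.span_induction with
  | mem g hg => exact congrArg (fun z : 𝓞 K => (z : K)) (congrFun hv ⟨g, hg⟩)
  | zero => simp
  | add x y _ _ h1 h2 => simp [h1, h2]
  | smul c x _ h => simp [h]

/-- Every full lattice is contained in a maximal lattice. -/
theorem IsFull.exists_isMax {Q : KLattice K V} (hQ : Q.IsFull) (σ : K →+* ℝ) :
    ∃ Q' : KLattice K V, Q'.form = Q.form ∧ Q.carrier ≤ Q'.carrier ∧ Q'.IsMax := by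
  have := hQ.isNoetherian_dual σ
  let S : Set (Submodule (𝓞 K) Q.dual) := {N | Q.carrier ≤ N.map Q.dual.subtype ∧
    ∀ x ∈ N, ∀ y ∈ N, IsIntegral ℤ (Q.form x.1 y.1)}
  have hS : S.Nonempty := by
    refine ⟨Q.carrier.comap Q.dual.subtype, ?_, fun x hx y hy => Q.isIntegral _ hx _ hy⟩
    intro x hx
    exact ⟨⟨x, Q.carrier_le_dual hx⟩, hx, rfl⟩
  obtain ⟨N, hN, hmax⟩ := WellFounded.has_min
    (r := fun a b : Submodule (𝓞 K) Q.dual => a > b) wellFounded_gt S hS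
  let Q' : KLattice K V :=
    { form := Q.form
      symm := Q.symm
      posDef := Q.posDef
      carrier := N.map Q.dual.subtype
      fg := (IsNoetherian.noetherian N).map _
      isIntegral := by
        rintro _ ⟨x, hx, rfl⟩ _ ⟨y, hy, rfl⟩
        exact hN.2 x hx y hy }
  refine ⟨Q', rfl, hN.1, ?_⟩
  intro v hv hvi
  have hvd : v ∈ Q.dual := fun x hx => hv x (hN.1 hx)
  let w : Q.dual := ⟨v, hvd⟩
  let N' := N ⊔ Submodule.span (𝓞 K) {w}
  have hN' : N' ∈ S := by
    refine ⟨hN.1.trans (Submodule.map_mono le_sup_left), ?_⟩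
    intro x hx y hy
    obtain ⟨a, ha, c, hc, rfl⟩ := Submodule.mem_sup.mp hx
    obtain ⟨a', ha', c', hc', rfl⟩ := Submodule.mem_sup.mp hy
    obtain ⟨c, rfl⟩ := Submodule.mem_span_singleton.mp hc
    obtain ⟨c', rfl⟩ := Submodule.mem_span_singleton.mp hc'
    have h1 : IsIntegral ℤ (Q.form v a'.1) := hv _ ⟨a', ha', rfl⟩
    have h2 : IsIntegral ℤ (Q.form a.1 v) := by rw [Q.symm]; exact hv _ ⟨a, ha, rfl⟩
    have h3 : Q.form (a + c • w).1 (a' + c' • w).1 = Q.form a.1 a'.1 + c * Q.form v a'.1 +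
        c' * Q.form a.1 v + c * (c' * Q.form v v) := by
      simp only [Submodule.coe_add, Submodule.coe_smul, map_add, LinearMap.add_apply,
        form_smul_left, form_smul_right, w]
      ring
    rw [h3]
    exact (((hN.2 a ha a' ha').add (c.isIntegral_coe.mul h1)).add (c'.isIntegral_coe.mul h2)).add
      (c.isIntegral_coe.mul (c'.isIntegral_coe.mul hvi))
  have h4 : ¬ N < N' := hmax N' hN'
  have h5 : N = N' := by
    by_contra h
    exact h4 (lt_of_le_of_ne le_sup_left h)
  refine ⟨w, ?_, rfl⟩
  rw [h5]
  exact Submodule.mem_sup_right (Submodule.mem_span_singleton_self w)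

end Maximal

end KLattice

section Reduction

variable {K : Type} [Field K] [NumberField K]

lemma one_le_sum_sq (hK : TotallyReal K) {x : 𝓞 K} (hx : x ≠ 0) :
    1 ≤ ∑ σ : K →+* ℝ, σ (x : K) ^ 2 := by
  have h := trace_int_eq hK (x ^ 2)
  simp only [map_pow] at h
  rw [← h]
  have h2 : (0 : ℝ) < (Algebra.trace ℤ (𝓞 K) (x ^ 2) : ℤ) := by
    rw [h]
    have := TotallyReal.nonempty_emb hK
    refine Finset.sum_pos (fun σ _ => ?_) Finset.univ_nonempty
    have : σ (x : K) ≠ 0 := by simpa using hx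
    positivity
  exact_mod_cast h2

/-- Splitting off squares of functionals from a totally positive definite form as long as
possible. -/
lemma exists_maximal_sum_sq (hK : TotallyReal K) (L : OKLattice K) :
    ∃ (h : ℕ) (l : Fin h → L.carrier →ₗ[𝓞 K] 𝓞 K),
      (∀ x, ∀ σ : K →+* ℝ, ∑ i, σ (l i x : K) ^ 2 ≤ σ (L.form x x : K)) ∧
      ∀ f : L.carrier →ₗ[𝓞 K] 𝓞 K, (∀ x, ∀ σ : K →+* ℝ,
        σ (f x : K) ^ 2 + ∑ i, σ (l i x : K) ^ 2 ≤ σ (L.form x x : K)) → f = 0 := by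
  classical
  let P : ℕ → Prop := fun h => ∃ l : Fin h → L.carrier →ₗ[𝓞 K] 𝓞 K, (∀ i, l i ≠ 0) ∧
    ∀ x, ∀ σ : K →+* ℝ, ∑ i, σ (l i x : K) ^ 2 ≤ σ (L.form x x : K)
  obtain ⟨s, hs⟩ := Module.Finite.fg_top (R := 𝓞 K) (M := L.carrier)
  obtain ⟨C, hC⟩ := exists_nat_ge (∑ g ∈ s, ∑ σ : K →+* ℝ, σ (L.form g g : K))
  have hb : ∀ h, P h → h ≤ C := by
    rintro h ⟨l, hl, hle⟩
    have h1 : ∀ i, (1 : ℝ) ≤ ∑ g ∈ s, ∑ σ : K →+* ℝ, σ (l i g : K) ^ 2 := by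
      intro i
      obtain ⟨g, hg, hg0⟩ : ∃ g ∈ s, l i g ≠ 0 := by
        by_contra! hcon
        refine hl i (LinearMap.ext_on hs fun g hg => ?_)
        simpa using hcon g hg
      exact (one_le_sum_sq hK hg0).trans (Finset.single_le_sum
        (f := fun g => ∑ σ : K →+* ℝ, σ (l i g : K) ^ 2)
        (fun g _ => Finset.sum_nonneg fun σ _ => sq_nonneg _) hg)
    have h2 : (h : ℝ) ≤ C := by
      calc (h : ℝ) = ∑ _i : Fin h, (1 : ℝ) := by simp
        _ ≤ ∑ i : Fin h, ∑ g ∈ s, ∑ σ : K →+* ℝ, σ (l i g : K) ^ 2 :=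
          Finset.sum_le_sum fun i _ => h1 i
        _ = ∑ g ∈ s, ∑ σ : K →+* ℝ, ∑ i, σ (l i g : K) ^ 2 := by
          rw [Finset.sum_comm]
          exact Finset.sum_congr rfl fun g _ => Finset.sum_comm
        _ ≤ ∑ g ∈ s, ∑ σ : K →+* ℝ, σ (L.form g g : K) :=
          Finset.sum_le_sum fun g _ => Finset.sum_le_sum fun σ _ => hle g σ
        _ ≤ C := hC
    exact_mod_cast h2
  have hP0 : P 0 := ⟨Fin.elim0, fun i => i.elim0, fun x σ => by
    simpa using L.form_self_nonneg x σ⟩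
  have hPm : P (Nat.findGreatest P C) := Nat.findGreatest_spec (Nat.zero_le C) hP0
  obtain ⟨l, hl, hle⟩ := hPm
  refine ⟨_, l, hle, fun f hf => ?_⟩
  by_contra hf0
  have hP1 : P (Nat.findGreatest P C + 1) := by
    refine ⟨Fin.cons f l, fun i => ?_, fun x σ => ?_⟩
    · refine Fin.cases ?_ (fun i => ?_) i
      · exact hf0
      · exact hl i
    · rw [Fin.sum_univ_succ]
      exact hf x σ
  have := Nat.le_findGreatest (hb _ hP1) hP1
  omega

end Reduction

section TightReduction

variable {K : Type} [Field K] [NumberField K]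

/-- The quotient of a positive semidefinite form by its radical. -/
lemma exists_posDef_quotient {V : Type} [AddCommGroup V] [Module K V] [Module.Finite K V]
    (P : V →ₗ[K] V →ₗ[K] K) (symm : ∀ x y, P x y = P y x)
    (nonneg : ∀ (σ : K →+* ℝ) x, 0 ≤ σ (P x x)) :
    ∃ k ≤ Module.finrank K V, ∃ B : (Fin k → K) →ₗ[K] (Fin k → K) →ₗ[K] K,
      (∀ x y, B x y = B y x) ∧ (∀ v, v ≠ 0 → ∀ σ : K →+* ℝ, 0 < σ (B v v)) ∧
      ∃ p : V →ₗ[K] (Fin k → K), Function.Surjective p ∧ ∀ x y, B (p x) (p y) = P x y := by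
  let W := LinearMap.ker P
  let e : (V ⧸ W) ≃ₗ[K] (Fin (Module.finrank K (V ⧸ W)) → K) := (Module.finBasis K (V ⧸ W)).equivFun
  let p : V →ₗ[K] (Fin (Module.finrank K (V ⧸ W)) → K) := e.toLinearMap ∘ₗ W.mkQ
  have hp : Function.Surjective p := e.surjective.comp W.mkQ_surjective
  obtain ⟨s, hs⟩ := p.exists_rightInverse_of_surjective (LinearMap.range_eq_top.mpr hp)
  have hps : ∀ x, p (s x) = x := fun x => LinearMap.congr_fun hs x
  have hker : ∀ x, p x = 0 ↔ P x = 0 := by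
    intro x
    change e (W.mkQ x) = 0 ↔ _
    rw [LinearEquiv.map_eq_zero_iff, Submodule.mkQ_apply, Submodule.Quotient.mk_eq_zero]
    exact LinearMap.mem_ker
  have hsp : ∀ x, P (s (p x)) = P x := by
    intro x
    rw [← sub_eq_zero, ← map_sub, ← hker, map_sub, hps, sub_self]
  refine ⟨_, Submodule.finrank_quotient_le W, P.compl₁₂ s s, fun x y => symm _ _, ?_, p, hp, ?_⟩
  · intro v hv σ
    change 0 < σ (P (s v) (s v))
    refine lt_of_le_of_ne (nonneg σ _) fun h0 => hv ?_
    rw [← hps v, hker]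
    ext w
    have h := sq_form_le P symm σ (nonneg σ) (s v) w
    rw [← h0, zero_mul] at h
    have : σ (P (s v) w) = 0 := by nlinarith [sq_nonneg (σ (P (s v) w))]
    simpa using this
  · intro x y
    change P (s (p x)) (s (p y)) = P x y
    rw [hsp, symm, hsp, symm]

lemma exists_smul_eq_one_tmul {M : Type} [AddCommGroup M] [Module (𝓞 K) M] (v : K ⊗[𝓞 K] M) :
    ∃ c : 𝓞 K, c ≠ 0 ∧ ∃ x : M, (c : K) • v = (1 : K) ⊗ₜ[𝓞 K] x := by
  obtain ⟨⟨x, c⟩, h⟩ := IsLocalizedModule.surj (nonZeroDivisors (𝓞 K))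
    (TensorProduct.mk (𝓞 K) K M 1) v
  exact ⟨c, nonZeroDivisors.ne_zero c.2, x, (algebraMap_smul K c.1 v).trans h⟩

/-- Every lattice is, up to sums of squares of functionals, represented by a tight maximal lattice
of at most the same rank. -/
theorem exists_tight_reduction (hK : TotallyReal K) (L : OKLattice K) :
    ∃ k ≤ L.rank, ∃ Q : KLattice K (Fin k → K), Q.IsFull ∧ Q.IsMax ∧ Q.IsTight ∧
      ∃ φ : L.carrier →ₗ[𝓞 K] (Fin k → K), (∀ x, φ x ∈ Q.carrier) ∧
        ∃ (h : ℕ) (l : Fin h → L.carrier →ₗ[𝓞 K] 𝓞 K), ∀ x,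
          (L.form x x : K) = Q.form (φ x) (φ x) + ∑ i, (l i x : K) ^ 2 := by
  obtain ⟨σ₀⟩ := TotallyReal.nonempty_emb hK
  obtain ⟨h, l, hl, hmax⟩ := exists_maximal_sum_sq hK L
  let B' : L.carrier →ₗ[𝓞 K] L.carrier →ₗ[𝓞 K] 𝓞 K :=
    L.form - ∑ i, (LinearMap.mul (𝓞 K) (𝓞 K)).compl₁₂ (l i) (l i)
  have hB' : ∀ x y, B' x y = L.form x y - ∑ i, l i x * l i y := by
    intro x y
    simp [B', LinearMap.sub_apply, LinearMap.sum_apply]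
  have hB'' : ∀ x, (B' x x : K) = L.form x x - ∑ i, (l i x : K) ^ 2 := by
    intro x
    rw [hB']
    simp only [map_sub, map_sum, map_mul, pow_two]
  have hB's : ∀ x y, B' x y = B' y x := by
    intro x y
    rw [hB', hB', L.symm]
    simp only [mul_comm]
  let P : K ⊗[𝓞 K] L.carrier →ₗ[K] K ⊗[𝓞 K] L.carrier →ₗ[K] K :=
    LinearMap.BilinForm.baseChange K B'
  have hP : ∀ a b x y, P (a ⊗ₜ x) (b ⊗ₜ y) = (B' x y : K) * (a * b) := by
    intro a b x y
    exact (LinearMap.BilinForm.baseChange_tmul B' a x b y).trans (Algebra.smul_def _ _)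
  have hPs : ∀ x y, P x y = P y x := by
    intro x y
    obtain ⟨c, hc, x', hx⟩ := exists_smul_eq_one_tmul x
    obtain ⟨c', hc', y', hy⟩ := exists_smul_eq_one_tmul y
    have h1 : P ((c : K) • x) ((c' : K) • y) = P ((c' : K) • y) ((c : K) • x) := by
      rw [hx, hy, hP, hP, hB's]
    simp only [map_smul, LinearMap.smul_apply, smul_eq_mul] at h1
    have h2 : (c : K) ≠ 0 := RingOfIntegers.coe_ne_zero_iff.mpr hc
    have h3 : (c' : K) ≠ 0 := RingOfIntegers.coe_ne_zero_iff.mpr hc'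
    have h4 : ((c : K) * c') * P x y = (c * c') * P y x := by linear_combination h1
    exact mul_left_cancel₀ (mul_ne_zero h2 h3) h4
  have hB'n : ∀ (σ : K →+* ℝ) x, 0 ≤ σ (B' x x : K) := by
    intro σ x
    rw [hB'']
    have := hl x σ
    simp only [map_sub, map_sum, map_pow]
    linarith
  have hPn : ∀ (σ : K →+* ℝ) x, 0 ≤ σ (P x x) := by
    intro σ x
    obtain ⟨c, hc, x', hx⟩ := exists_smul_eq_one_tmul x
    have h1 : 0 ≤ σ (P ((c : K) • x) ((c : K) • x)) := by
      rw [hx, hP, mul_one, mul_one]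
      exact hB'n σ x'
    simp only [map_smul, LinearMap.smul_apply, smul_eq_mul, map_mul] at h1
    have h2 : 0 < σ (c : K) ^ 2 := by
      have : σ (c : K) ≠ 0 := by simpa using hc
      positivity
    have h3 : 0 ≤ σ (c : K) ^ 2 * σ (P x x) := by linarith
    exact nonneg_of_mul_nonneg_right h3 h2
  obtain ⟨k, hk, B, hBs, hBp, p, hp, hBP⟩ := exists_posDef_quotient P hPs hPn
  let φ : L.carrier →ₗ[𝓞 K] (Fin k → K) :=
    (p.restrictScalars (𝓞 K)) ∘ₗ TensorProduct.mk (𝓞 K) K L.carrier 1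
  have hφ : ∀ x y, B (φ x) (φ y) = (B' x y : K) := by
    intro x y
    change B (p (1 ⊗ₜ x)) (p (1 ⊗ₜ y)) = _
    rw [hBP, hP]
    simp
  let Q₀ : KLattice K (Fin k → K) :=
    { form := B
      symm := hBs
      posDef := hBp
      carrier := LinearMap.range φ
      fg := Module.Finite.iff_fg.mp inferInstance
      isIntegral := by
        rintro _ ⟨x, rfl⟩ _ ⟨y, rfl⟩
        rw [hφ]
        exact RingOfIntegers.isIntegral_coe _ }
  have hQ₀ : Q₀.IsFull := by
    intro v
    obtain ⟨w, rfl⟩ := hp v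
    obtain ⟨c, hc, x, hx⟩ := exists_smul_eq_one_tmul w
    refine ⟨c, hc, x, ?_⟩
    change p (1 ⊗ₜ x) = _
    rw [← hx, KLattice.smul_eq, map_smul]
  obtain ⟨Q, hform, hle, hQmax⟩ := hQ₀.exists_isMax σ₀
  refine ⟨k, hk, Q, ?_, hQmax, ?_, φ, fun x => hle ⟨x, rfl⟩, h, l, ?_⟩
  · intro v
    obtain ⟨c, hc, h⟩ := hQ₀ v
    exact ⟨c, hc, hle h⟩
  · intro v hv hv1
    rw [hform] at hv1
    have hv' : ∀ x, IsIntegral ℤ (B v (φ x)) := by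
      intro x
      have := hv (φ x) (hle ⟨x, rfl⟩)
      rwa [hform] at this
    let f : L.carrier →ₗ[𝓞 K] 𝓞 K :=
      { toFun := fun x => ⟨B v (φ x), hv' x⟩
        map_add' := fun x y => RingOfIntegers.ext
          (show B v (φ (x + y)) = B v (φ x) + B v (φ y) by simp)
        map_smul' := fun c x => RingOfIntegers.ext
          (show B v (φ (c • x)) = c * B v (φ x) by
            rw [map_smul]; exact KLattice.form_smul_right Q₀ c v (φ x)) }
    have hf : f = 0 := by
      refine hmax f fun x σ => ?_
      have h1 := Q₀.sq_form_le v (φ x) σ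
      have h2 : σ (Q₀.form (φ x) (φ x)) = σ (L.form x x : K) - ∑ i, σ (l i x : K) ^ 2 := by
        change σ (B (φ x) (φ x)) = _
        rw [hφ, hB'']
        simp only [map_sub, map_sum, map_pow]
      have h3 := Q₀.form_self_nonneg (φ x) σ
      have h4 := hv1 σ
      have h5 : σ (f x : K) ^ 2 = σ (Q₀.form v (φ x)) ^ 2 := rfl
      have h6 : σ (Q₀.form v v) * σ (Q₀.form (φ x) (φ x)) ≤ 1 * σ (Q₀.form (φ x) (φ x)) :=
        mul_le_mul_of_nonneg_right h4 h3
      linarith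
    refine hQ₀.eq_zero σ₀ ?_
    rintro _ ⟨x, rfl⟩
    exact congrArg (fun z : 𝓞 K => (z : K)) (LinearMap.congr_fun hf x)
  · intro x
    rw [hform]
    change _ = B (φ x) (φ x) + _
    rw [hφ, hB'']
    ring

end TightReduction

section Codifferent

open scoped nonZeroDivisors

variable {K : Type} [Field K] [NumberField K]

variable (K) in
/-- The codifferent (inverse different) of a number field. -/
def codifferent : Submodule (𝓞 K) K where
  carrier := {z | ∀ c : 𝓞 K, ∃ m : ℤ, Algebra.trace ℚ K (z * c) = m}
  zero_mem' := fun c => ⟨0, by simp⟩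
  add_mem' := fun {z w} hz hw c => by
    obtain ⟨a, ha⟩ := hz c
    obtain ⟨b, hb⟩ := hw c
    exact ⟨a + b, by rw [add_mul, map_add, ha, hb]; simp⟩
  smul_mem' := fun a z hz c => by
    obtain ⟨m, hm⟩ := hz (a * c)
    refine ⟨m, ?_⟩
    rw [← hm, Algebra.smul_def, mul_comm _ z, mul_assoc]
    congr 2

lemma mem_codifferent {z : K} :
    z ∈ codifferent K ↔ ∀ c : 𝓞 K, ∃ m : ℤ, Algebra.trace ℚ K (z * c) = m := Iff.rfl

lemma mem_codifferent_iff_dual {z : K} :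
    z ∈ codifferent K ↔ z ∈ FractionalIdeal.dual ℤ ℚ (1 : FractionalIdeal (𝓞 K)⁰ K) := by
  rw [FractionalIdeal.mem_dual (one_ne_zero' (FractionalIdeal (𝓞 K)⁰ K)), mem_codifferent]
  constructor
  · intro h a ha
    obtain ⟨c, rfl⟩ := FractionalIdeal.mem_one_iff _ |>.mp ha
    obtain ⟨m, hm⟩ := h c
    exact ⟨m, by rw [Algebra.traceForm_apply]; exact hm.symm⟩
  · intro h c
    obtain ⟨m, hm⟩ := h c ((FractionalIdeal.mem_one_iff _).mpr ⟨c, rfl⟩)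
    exact ⟨m, by rw [Algebra.traceForm_apply] at hm; exact hm.symm⟩

lemma mem_one_iff_isIntegral {x : K} :
    x ∈ (1 : FractionalIdeal (𝓞 K)⁰ K) ↔ IsIntegral ℤ x := by
  rw [FractionalIdeal.mem_one_iff, isIntegral_iff_exists]

lemma dual_eq_inv_differentIdeal : FractionalIdeal.dual ℤ ℚ (1 : FractionalIdeal (𝓞 K)⁰ K) =
    ((differentIdeal ℤ (𝓞 K) : Ideal (𝓞 K)) : FractionalIdeal (𝓞 K)⁰ K)⁻¹ := by
  rw [coeIdeal_differentIdeal ℤ ℚ K (𝓞 K), inv_inv]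

lemma mem_codifferent_iff {z : K} :
    z ∈ codifferent K ↔ ∀ g ∈ differentIdeal ℤ (𝓞 K), IsIntegral ℤ (z * (g : K)) := by
  have h0 : ((differentIdeal ℤ (𝓞 K) : Ideal (𝓞 K)) : FractionalIdeal (𝓞 K)⁰ K) ≠ 0 := by
    rw [coeIdeal_differentIdeal ℤ ℚ K (𝓞 K)]
    simp
  rw [mem_codifferent_iff_dual, dual_eq_inv_differentIdeal, FractionalIdeal.mem_inv_iff h0]
  constructor
  · intro h g hg
    exact mem_one_iff_isIntegral.mp (h g ((FractionalIdeal.mem_coeIdeal _).mpr ⟨g, hg, rfl⟩))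
  · intro h y hy
    obtain ⟨g, hg, rfl⟩ := (FractionalIdeal.mem_coeIdeal _).mp hy
    exact mem_one_iff_isIntegral.mpr (h g hg)

/-- The trace pairing with the codifferent detects integrality. -/
lemma isIntegral_of_trace_codifferent {z : K}
    (h : ∀ y ∈ codifferent K, ∃ m : ℤ, Algebra.trace ℚ K (y * z) = m) : IsIntegral ℤ z := by
  rw [← mem_one_iff_isIntegral, ← FractionalIdeal.dual_dual ℤ ℚ (1 : FractionalIdeal (𝓞 K)⁰ K),
    FractionalIdeal.mem_dual (by simp)]
  intro a ha
  obtain ⟨m, hm⟩ := h a (mem_codifferent_iff_dual.mpr ha)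
  exact ⟨m, by rw [Algebra.traceForm_apply, mul_comm]; exact hm.symm⟩

lemma exists_ne_zero_mul_codifferent :
    ∃ a : 𝓞 K, a ≠ 0 ∧ ∀ z ∈ codifferent K, IsIntegral ℤ ((a : K) * z) := by
  obtain ⟨a, ha, h⟩ := Submodule.exists_mem_ne_zero_of_ne_bot
    (differentIdeal_ne_bot (A := ℤ) (B := 𝓞 K))
  exact ⟨a, h, fun z hz => by rw [mul_comm]; exact mem_codifferent_iff.mp hz a ha⟩

end Codifferent

section IntDual

/-- A functional on a positive definite integral lattice is rationally represented by a vector. -/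
lemma exists_smul_eq_form {M : Type} [AddCommGroup M] [Module.Free ℤ M] [Module.Finite ℤ M]
    (T : M →ₗ[ℤ] M →ₗ[ℤ] ℤ) (pos : ∀ x, x ≠ 0 → 0 < T x x) (f : M →ₗ[ℤ] ℤ) :
    ∃ N : ℤ, N ≠ 0 ∧ ∃ x, ∀ v, T x v = N * f v := by
  classical
  let b := Module.finBasis ℤ M
  let G : Matrix _ _ ℤ := Matrix.of fun i j => T (b i) (b j)
  refine ⟨G.det, fun h0 => ?_, ∑ i, Matrix.vecMul (fun j => f (b j)) G.adjugate i • b i, ?_⟩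
  · obtain ⟨v, hv, h⟩ := Matrix.exists_mulVec_eq_zero_iff.mpr h0
    have h1 : ∑ i, v i • b i ≠ 0 := fun h2 => hv (funext fun i =>
      Fintype.linearIndependent_iff.mp b.linearIndependent v h2 i)
    have h2 := pos _ h1
    have h3 : T (∑ i, v i • b i) (∑ i, v i • b i) = v ⬝ᵥ G.mulVec v := by
      simp only [dotProduct, Matrix.mulVec, Finset.mul_sum, G, map_sum, map_smul,
        LinearMap.sum_apply, LinearMap.smul_apply, smul_eq_mul, Matrix.of_apply]
      rw [Finset.sum_comm]
      exact Finset.sum_congr rfl fun i _ => Finset.sum_congr rfl fun j _ => by ring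
    rw [h3, h, dotProduct_zero] at h2
    exact lt_irrefl _ h2
  · intro v
    have h : T (∑ i, Matrix.vecMul (fun j => f (b j)) G.adjugate i • b i) = G.det • f := by
      refine b.ext fun j => ?_
      have h1 : T (∑ i, Matrix.vecMul (fun j => f (b j)) G.adjugate i • b i) (b j) =
          Matrix.vecMul (Matrix.vecMul (fun j => f (b j)) G.adjugate) G j := by
        simp [Matrix.vecMul, dotProduct, G]
      rw [h1, Matrix.vecMul_vecMul, Matrix.adjugate_mul]
      simp [mul_comm]
    rw [h]
    simp

end IntDual

section Criterion

variable {K : Type} [Field K] [NumberField K]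

/-- To be universal it suffices to represent tight maximal lattices, after adding a lattice that
represents sums of squares of functionals. -/
lemma OKLattice.isUniversal_prod_of_tight (hK : TotallyReal K) {n : ℕ} {H L₀ : OKLattice K}
    (hH : ∀ (M : Type) [AddCommGroup M] [Module (𝓞 K) M] [Module.Finite (𝓞 K) M],
      Module.finrank (𝓞 K) M ≤ n → ∀ (h : ℕ) (l : Fin h → M →ₗ[𝓞 K] 𝓞 K),
      ∃ τ : M →ₗ[𝓞 K] H.carrier, ∀ x, H.form (τ x) (τ x) = ∑ i, l i x ^ 2)
    (hL₀ : ∀ k ≤ n, ∀ Q : KLattice K (Fin k → K), Q.IsFull → Q.IsMax → Q.IsTight →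
      L₀.Represents Q.toOKLattice) : (H.prod L₀).IsUniversal n := by
  intro L hL
  obtain ⟨k, hk, Q, hf, hm, ht, φ, hφ, h, l, hl⟩ := exists_tight_reduction hK L
  rw [hL] at hk
  obtain ⟨ρ, hρ⟩ := hL₀ k hk Q hf hm ht
  obtain ⟨τ, hτ⟩ := hH L.carrier (by rw [← L.rank_eq_finrank, hL]) h l
  refine ⟨τ.prod (ρ ∘ₗ φ.codRestrict Q.carrier hφ), fun x => ?_⟩
  refine (OKLattice.prod_form H L₀ _ _).trans ?_
  refine RingOfIntegers.ext ?_
  rw [hl x]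
  refine (congrArg₂ (fun a b : 𝓞 K => ((a + b : 𝓞 K) : K)) (hτ x) (hρ ⟨φ x, hφ x⟩)).trans ?_
  rw [add_comm]
  simp only [map_add, map_sum, map_pow]
  rfl

end Criterion

namespace KLattice

section Trace

variable {K V : Type} [Field K] [NumberField K] [AddCommGroup V] [Module K V] [Module (𝓞 K) V]
  [IsScalarTower (𝓞 K) K V]

/-- The trace form of a lattice. -/
def traceForm (Q : KLattice K V) : Q.carrier →ₗ[ℤ] Q.carrier →ₗ[ℤ] ℤ :=
  LinearMap.mk₂ ℤ (fun x y => Algebra.trace ℤ (𝓞 K) (Q.toOKLattice.form x y))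
    (fun x y z => (congrArg _ (LinearMap.map_add₂ Q.toOKLattice.form x y z)).trans (map_add _ _ _))
    (fun c x y => by
      rw [← map_smul (Algebra.trace ℤ (𝓞 K))]
      refine congrArg _ ?_
      exact LinearMap.congr_fun (map_zsmul Q.toOKLattice.form c x) y)
    (fun x y z => (congrArg _ (map_add (Q.toOKLattice.form x) y z)).trans (map_add _ _ _))
    (fun c x y => by
      rw [← map_smul (Algebra.trace ℤ (𝓞 K))]
      exact congrArg _ (map_zsmul (Q.toOKLattice.form x) c y))

lemma traceForm_cast (Q : KLattice K V) (x y : Q.carrier) :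
    ((Q.traceForm x y : ℤ) : ℚ) = Algebra.trace ℚ K (Q.form x y) :=
  Algebra.coe_trace_int (K := K) (Q.toOKLattice.form x y)

lemma traceForm_real (hK : TotallyReal K) (Q : KLattice K V) (x y : Q.carrier) :
    ((Q.traceForm x y : ℤ) : ℝ) = ∑ σ : K →+* ℝ, σ (Q.form x y) :=
  trace_int_eq hK (Q.toOKLattice.form x y)

lemma traceForm_symm (Q : KLattice K V) (x y : Q.carrier) :
    Q.traceForm x y = Q.traceForm y x := by
  have h : ((Q.traceForm x y : ℤ) : ℚ) = (Q.traceForm y x : ℤ) := by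
    rw [traceForm_cast, traceForm_cast, Q.symm]
  exact_mod_cast h

lemma traceForm_pos (hK : TotallyReal K) (Q : KLattice K V) (x : Q.carrier) (hx : x ≠ 0) :
    0 < Q.traceForm x x := by
  have h : (0 : ℝ) < (Q.traceForm x x : ℤ) := by
    rw [traceForm_real hK]
    have := hK.nonempty_emb
    exact Finset.sum_pos (fun σ _ => Q.posDef x.1 (fun h => hx (Subtype.ext h)) σ)
      Finset.univ_nonempty
  exact_mod_cast h

instance finite_int (Q : KLattice K V) : Module.Finite ℤ Q.carrier :=
  Module.Finite.trans (𝓞 K) Q.carrier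

instance free_int (Q : KLattice K V) : Module.Free ℤ Q.carrier := by
  have : IsAddTorsionFree Q.carrier := ⟨fun n hn x y h => Subtype.ext (by
    have h1 : n • x.1 = n • y.1 := congrArg Subtype.val h
    rw [← Nat.cast_smul_eq_nsmul K, ← Nat.cast_smul_eq_nsmul K] at h1
    exact smul_right_injective V (Nat.cast_ne_zero.mpr hn) h1)⟩
  infer_instance

/-- Every integral functional on a lattice is a trace pairing with a vector of the space. -/
lemma exists_dual_vector (hK : TotallyReal K) (Q : KLattice K V) (f : Q.carrier →ₗ[ℤ] ℤ) :
    ∃ y : V, (∃ N : ℤ, N ≠ 0 ∧ N • y ∈ Q.carrier) ∧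
      ∀ v : Q.carrier, Algebra.trace ℚ K (Q.form y v) = f v := by
  obtain ⟨N, hN, x, hx⟩ := exists_smul_eq_form Q.traceForm (Q.traceForm_pos hK) f
  have hN' : (N : K) ≠ 0 := by exact_mod_cast hN
  refine ⟨(N : K)⁻¹ • x.1, ⟨N, hN, ?_⟩, fun v => ?_⟩
  · rw [← Int.cast_smul_eq_zsmul K, smul_smul, mul_inv_cancel₀ hN', one_smul]
    exact x.2
  · have h1 := congrArg (fun m : ℤ => (m : ℚ)) (hx v)
    simp only [traceForm_cast, Int.cast_mul] at h1
    have h2 : (N : K)⁻¹ • Q.form x.1 v = (N : ℚ)⁻¹ • Q.form x.1 v := by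
      rw [Algebra.smul_def (A := K), Algebra.smul_def]
      simp
    rw [map_smul, LinearMap.smul_apply, h2, map_smul, h1, smul_eq_mul, inv_mul_cancel_left₀]
    exact_mod_cast hN

lemma form_mem_codifferent (Q : KLattice K V) {y : V}
    (h : ∀ v : Q.carrier, ∃ m : ℤ, Algebra.trace ℚ K (Q.form y v) = m) (v : Q.carrier) :
    Q.form y v ∈ codifferent K := by
  intro c
  obtain ⟨m, hm⟩ := h (c • v)
  refine ⟨m, ?_⟩
  rw [← hm, mul_comm]
  exact congrArg _ (Q.form_smul_right c y v.1).symm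

lemma finrank_int_le [Module.Finite K V] (Q : KLattice K V) :
    Module.finrank ℤ Q.carrier ≤ Module.finrank ℚ K * Module.finrank K V := by
  let _ : Module ℚ V := Module.compHom V (algebraMap ℚ K)
  have : IsScalarTower ℚ K V := ⟨fun a b c => by
    rw [Algebra.smul_def, mul_smul]; rfl⟩
  rw [Module.finrank_mul_finrank, IsFractionRing.finrank_right_eq ℤ ℚ V]
  refine Cardinal.toNat_le_toNat (Submodule.rank_le (Q.carrier.restrictScalars ℤ)) ?_
  rw [← IsFractionRing.rank_right_eq ℤ ℚ V]
  have := Module.Finite.trans (R := ℚ) K V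
  exact Module.rank_lt_aleph0 ℚ V

end Trace

end KLattice

namespace KLattice

section Existence

variable {K : Type} [Field K] [NumberField K]

/-- The vector dual to a member of a reduced basis is small. -/
lemma exists_dual_vector_le (hK : TotallyReal K) {V : Type} [AddCommGroup V] [Module K V]
    [Module (𝓞 K) V] [IsScalarTower (𝓞 K) K V] (Q : KLattice K V) {ι : Type}
    (b : Module.Basis ι ℤ Q.carrier) (i : ι) {C : ℕ}
    (hb : ∀ v, b.repr v i ^ 2 * Q.traceForm (b i) (b i) ≤ C * Q.traceForm v v) :
    ∃ y : V, y ≠ 0 ∧ (∀ v : Q.carrier, Algebra.trace ℚ K (Q.form y v) = b.repr v i) ∧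
      (∑ σ : K →+* ℝ, σ (Q.form y y)) * (Q.traceForm (b i) (b i) : ℤ) ≤ C := by
  obtain ⟨y, ⟨N, hN, hNy⟩, hy⟩ := Q.exists_dual_vector hK (b.coord i)
  have hy0 : y ≠ 0 := by
    rintro rfl
    have := hy (b i)
    simp at this
  have hTrpos : 0 < ∑ σ : K →+* ℝ, σ (Q.form y y) := by
    have := hK.nonempty_emb
    exact Finset.sum_pos (fun σ _ => Q.posDef y hy0 σ) Finset.univ_nonempty
  refine ⟨y, hy0, fun v => hy v, ?_⟩
  have h1 := hb ⟨N • y, hNy⟩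
  have h2 : ((b.repr ⟨N • y, hNy⟩ i : ℤ) : ℝ) = N * ∑ σ : K →+* ℝ, σ (Q.form y y) := by
    have h3 := hy ⟨N • y, hNy⟩
    rw [map_zsmul, map_zsmul, zsmul_eq_mul] at h3
    have h4 := congrArg (fun q : ℚ => (q : ℝ)) h3
    simp only [Rat.cast_mul, Rat.cast_intCast, hK.trace_eq] at h4
    exact h4.symm
  have h5 : ((Q.traceForm ⟨N • y, hNy⟩ ⟨N • y, hNy⟩ : ℤ) : ℝ) =
      N * (N * ∑ σ : K →+* ℝ, σ (Q.form y y)) := by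
    rw [traceForm_real hK, Finset.mul_sum, Finset.mul_sum]
    refine Finset.sum_congr rfl fun σ _ => ?_
    change σ (Q.form (N • y) (N • y)) = _
    rw [map_zsmul, map_zsmul, map_zsmul, LinearMap.smul_apply, map_zsmul]
    simp
  have h6 : ((b.repr ⟨N • y, hNy⟩ i : ℤ) : ℝ) ^ 2 * (Q.traceForm (b i) (b i) : ℤ) ≤
      C * (Q.traceForm ⟨N • y, hNy⟩ ⟨N • y, hNy⟩ : ℤ) := by exact_mod_cast h1
  rw [h2, h5] at h6
  set t := ∑ σ : K →+* ℝ, σ (Q.form y y)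
  have hN2 : (0 : ℝ) < (N : ℝ) ^ 2 * t := by
    have : (N : ℝ) ≠ 0 := by exact_mod_cast hN
    positivity
  refine le_of_mul_le_mul_left ?_ hN2
  calc _ = (N * t) ^ 2 * (Q.traceForm (b i) (b i) : ℤ) := by ring
    _ ≤ C * (N * (N * t)) := h6
    _ = _ := by ring

/-- Tight lattices of bounded rank have bases of bounded size. -/
lemma exists_basis_le_of_isTight (hK : TotallyReal K) (r : ℕ) :
    ∃ X : ℝ, 0 ≤ X ∧ ∀ (k : ℕ) (Q : KLattice K (Fin k → K)), Q.IsTight →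
      Module.finrank ℤ Q.carrier = r → ∃ b : Module.Basis (Fin r) ℤ Q.carrier,
        ∀ i, ∀ σ : K →+* ℝ, σ (Q.form (b i) (b i)) ≤ X := by
  obtain ⟨C, hC⟩ := exists_reduced_basis' r
  obtain ⟨a, ha, hCd⟩ := exists_ne_zero_mul_codifferent (K := K)
  let S : ℝ := ∑ σ : K →+* ℝ, σ (a : K) ^ 2
  have hS : ∀ σ : K →+* ℝ, σ (a : K) ^ 2 ≤ S := fun σ =>
    Finset.single_le_sum (f := fun σ : K →+* ℝ => σ (a : K) ^ 2) (fun σ _ => sq_nonneg _)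
      (Finset.mem_univ σ)
  have hS0 : 0 ≤ S := Finset.sum_nonneg fun σ _ => sq_nonneg _
  refine ⟨C * S, by positivity, fun k Q hQ hr => ?_⟩
  obtain ⟨b, hb⟩ := hC Q.carrier hr Q.traceForm Q.traceForm_symm (Q.traceForm_pos hK)
  refine ⟨b, fun i => ?_⟩
  have hTi := Q.traceForm_real hK (b i) (b i)
  suffices h : ((Q.traceForm (b i) (b i) : ℤ) : ℝ) ≤ C * S by
    intro σ
    refine le_trans ?_ (hTi ▸ h)
    exact Finset.single_le_sum (f := fun σ : K →+* ℝ => σ (Q.form (b i) (b i)))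
      (fun σ _ => Q.form_self_nonneg _ σ) (Finset.mem_univ σ)
  by_contra! hlt
  obtain ⟨y, hy0, hy, key⟩ := Q.exists_dual_vector_le hK b i (fun v => hb v i)
  have hTrpos : 0 < ∑ σ : K →+* ℝ, σ (Q.form y y) := by
    have := hK.nonempty_emb
    exact Finset.sum_pos (fun σ _ => Q.posDef y hy0 σ) Finset.univ_nonempty
  have hTb : (0 : ℝ) < (Q.traceForm (b i) (b i) : ℤ) := by
    exact_mod_cast Q.traceForm_pos hK _ (b.ne_zero i)
  have hC0 : (0 : ℝ) ≤ C := Nat.cast_nonneg C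
  have hsmall : (∑ σ : K →+* ℝ, σ (Q.form y y)) * S < 1 := by
    set t := ∑ σ : K →+* ℝ, σ (Q.form y y)
    set T : ℝ := ((Q.traceForm (b i) (b i) : ℤ) : ℝ)
    by_contra! h
    have h1 : 0 < C := by
      by_contra! h0
      have : (C : ℝ) ≤ 0 := by exact_mod_cast h0
      nlinarith [mul_pos hTrpos hTb]
    have h2 : (0 : ℝ) < C := by exact_mod_cast h1
    nlinarith [mul_lt_mul_of_pos_left hlt hTrpos, mul_le_mul_of_nonneg_left h hC0]
  have hay : a • y = 0 := by
    refine hQ _ (fun x hx => ?_) fun σ => ?_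
    · rw [form_smul_left]
      exact hCd _ (Q.form_mem_codifferent (fun v => ⟨_, hy v⟩) ⟨x, hx⟩)
    · rw [form_smul_left, form_smul_right, map_mul, map_mul]
      have h1 : σ (Q.form y y) ≤ ∑ σ : K →+* ℝ, σ (Q.form y y) :=
        Finset.single_le_sum (f := fun σ : K →+* ℝ => σ (Q.form y y))
          (fun σ _ => Q.form_self_nonneg _ σ) (Finset.mem_univ σ)
      have h2 := Q.form_self_nonneg y σ
      calc σ (a : K) * (σ (a : K) * σ (Q.form y y)) = σ (Q.form y y) * σ (a : K) ^ 2 := by ring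
        _ ≤ (∑ σ : K →+* ℝ, σ (Q.form y y)) * S :=
          mul_le_mul h1 (hS σ) (sq_nonneg _) hTrpos.le
        _ ≤ 1 := hsmall.le
  rw [smul_eq] at hay
  rcases smul_eq_zero.mp hay with h | h
  · exact ha (RingOfIntegers.coe_eq_zero_iff.mp h)
  · exact hy0 h

/-- Lattices with the same Gram matrix with respect to integral bases represent each other. -/
lemma represents_of_gram_eq (σ₀ : K →+* ℝ) {V V' : Type} [AddCommGroup V] [Module K V]
    [Module (𝓞 K) V] [IsScalarTower (𝓞 K) K V] [AddCommGroup V'] [Module K V'] [Module (𝓞 K) V']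
    [IsScalarTower (𝓞 K) K V'] (Q : KLattice K V) (Q' : KLattice K V') {ι : Type} [Fintype ι]
    (b : Module.Basis ι ℤ Q.carrier) (b' : Module.Basis ι ℤ Q'.carrier)
    (h : ∀ i j, Q.toOKLattice.form (b i) (b j) = Q'.toOKLattice.form (b' i) (b' j)) :
    Q'.toOKLattice.Represents Q.toOKLattice := by
  let e : Q.carrier ≃ₗ[ℤ] Q'.carrier := b.equiv b' (Equiv.refl ι)
  have he : ∀ x y : Q.carrier, Q'.form (e x) (e y) = Q.form x y := by
    intro x y
    have hb : ∀ x : Q.carrier, x.1 = ∑ i, b.repr x i • (b i).1 := by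
      intro x
      have h1 := congrArg Q.carrier.subtype (b.sum_repr x)
      rw [map_sum] at h1
      exact h1.symm.trans (Finset.sum_congr rfl fun i _ => map_zsmul _ _ _)
    have hb' : ∀ x : Q.carrier, (e x).1 = ∑ i, b.repr x i • (b' i).1 := by
      intro x
      have h1 := congrArg (fun v => Q'.carrier.subtype (e v)) (b.sum_repr x)
      simp only [map_sum, map_zsmul] at h1
      refine h1.symm.trans (Finset.sum_congr rfl fun i _ => ?_)
      rw [show e (b i) = b' i by simp [e]]
      rfl
    have h' : ∀ i j, Q.form (b i) (b j) = Q'.form (b' i) (b' j) := fun i j =>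
      congrArg (fun z : 𝓞 K => (z : K)) (h i j)
    rw [hb' x, hb' y, hb x, hb y]
    simp only [map_sum, map_zsmul, LinearMap.sum_apply, LinearMap.smul_apply, h']
  have hlin : ∀ (c : 𝓞 K) (x : Q.carrier), e (c • x) = c • e x := by
    intro c x
    refine Subtype.ext (sub_eq_zero.mp ?_)
    have hz : ∀ y : Q.carrier, Q'.form ((e (c • x)).1 - c • (e x).1) (e y) = 0 := by
      intro y
      rw [map_sub, LinearMap.sub_apply, he, form_smul_left, he]
      exact sub_eq_zero.mpr (Q.form_smul_left c x.1 y.1)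
    obtain ⟨y, hy⟩ := e.surjective (e (c • x) - c • e x)
    have h1 := hz y
    rw [hy] at h1
    exact Q'.eq_zero_of_form_self σ₀ h1
  let φ : Q.carrier →ₗ[𝓞 K] Q'.carrier :=
    { toFun := e, map_add' := e.map_add, map_smul' := hlin }
  exact ⟨φ, fun x => RingOfIntegers.ext (he x x)⟩

/-- Universal lattices exist. -/
theorem _root_.exists_isUniversal (hK : TotallyReal K) (n : ℕ) :
    ∃ L : OKLattice K, L.IsUniversal n := by
  classical
  obtain ⟨σ₀⟩ := hK.nonempty_emb
  obtain ⟨g, hg⟩ := exists_lattice_representing_sum_sq n (Module.finrank ℚ K)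
  obtain ⟨H, -, hH⟩ := hg K rfl
  choose X hX0 hX using exists_basis_le_of_isTight (K := K) hK
  let G : (r : ℕ) → Set (Matrix (Fin r) (Fin r) (𝓞 K)) := fun r =>
    {A | ∀ i, A i ∈ {v : Fin r → 𝓞 K | ∀ j, v j ∈ {x : 𝓞 K | ∀ σ : K →+* ℝ, |σ (x : K)| ≤ X r}}}
  have hG : ∀ r, (G r).Finite := fun r => Set.Finite.pi' fun i => Set.Finite.pi' fun j =>
    finite_house_le hK (X r)
  let I : Set ((r : ℕ) × Matrix (Fin r) (Fin r) (𝓞 K)) :=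
    ⋃ r ∈ Set.Iic (Module.finrank ℚ K * n), Sigma.mk r '' G r
  have hI : I.Finite := (Set.finite_Iic _).biUnion fun r _ => (hG r).image _
  let P : ((r : ℕ) × Matrix (Fin r) (Fin r) (𝓞 K)) → OKLattice K → Prop := fun A L =>
    ∃ (k : ℕ) (Q : KLattice K (Fin k → K)) (b : Module.Basis (Fin A.1) ℤ Q.carrier),
      L = Q.toOKLattice ∧ ∀ i j, Q.toOKLattice.form (b i) (b j) = A.2 i j
  let F : ((r : ℕ) × Matrix (Fin r) (Fin r) (𝓞 K)) → OKLattice K := fun A =>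
    if h : ∃ L, P A L then h.choose else H
  obtain ⟨L₀, -, hL₀⟩ := OKLattice.exists_sum hI.toFinset F
  refine ⟨H.prod L₀, OKLattice.isUniversal_prod_of_tight hK hH fun k hk Q _ _ hQ => ?_⟩
  obtain ⟨b, hb⟩ := hX _ k Q hQ rfl
  let A : (r : ℕ) × Matrix (Fin r) (Fin r) (𝓞 K) :=
    ⟨Module.finrank ℤ Q.carrier, fun i j => Q.toOKLattice.form (b i) (b j)⟩
  have hA : A ∈ I := by
    refine Set.mem_biUnion (x := Module.finrank ℤ Q.carrier) ?_ ⟨_, ?_, rfl⟩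
    · refine (Q.finrank_int_le).trans ?_
      simpa using Nat.mul_le_mul_left _ hk
    · intro i j σ
      change |σ (Q.form (b i) (b j))| ≤ _
      have h1 := Q.sq_form_le (b i).1 (b j).1 σ
      refine abs_le_of_sq_le_sq ?_ (hX0 _)
      calc _ ≤ _ := h1
        _ ≤ X (Module.finrank ℤ Q.carrier) * X (Module.finrank ℤ Q.carrier) :=
          mul_le_mul (hb i σ) (hb j σ) (Q.form_self_nonneg _ σ) (hX0 _)
        _ = _ := by ring
  have hex : ∃ L, P A L := ⟨_, k, Q, b, rfl, fun _ _ => rfl⟩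
  have hFA : F A = hex.choose := dif_pos hex
  obtain ⟨k', Q', b', hQ', hb'⟩ := hex.choose_spec
  refine (hL₀ A (hI.mem_toFinset.mpr hA)).trans ?_
  rw [hFA, hQ']
  exact represents_of_gram_eq σ₀ Q Q' b b' fun i j => (hb' i j).symm

lemma _root_.exists_isUniversal_rank_eq (hK : TotallyReal K) (n : ℕ) :
    ∃ L : OKLattice K, L.IsUniversal n ∧ L.rank = minUnivRank K n := by
  obtain ⟨L, hL⟩ := exists_isUniversal hK n
  exact Nat.sInf_mem (s := {m | ∃ L : OKLattice K, L.IsUniversal n ∧ L.rank = m}) ⟨_, L, hL, rfl⟩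

lemma _root_.minUnivRank_le {n : ℕ} {L : OKLattice K} (hL : L.IsUniversal n) :
    minUnivRank K n ≤ L.rank := Nat.sInf_le ⟨L, hL, rfl⟩

end Existence

end KLattice

section Different

variable {K : Type} [Field K] [NumberField K]

variable (K) in
/-- The different ideal with the form `(x, y) ↦ xy`. -/
def differentLattice : KLattice K K where
  form := LinearMap.mul K K
  symm x y := mul_comm x y
  posDef v hv σ := by
    have : σ v ≠ 0 := by simpa using hv
    rw [LinearMap.mul_apply', map_mul]
    exact mul_self_pos.mpr this
  carrier := Submodule.map (Algebra.linearMap (𝓞 K) K) (differentIdeal ℤ (𝓞 K))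
  fg := (IsNoetherian.noetherian _).map _
  isIntegral := by
    rintro _ ⟨x, hx, rfl⟩ _ ⟨y, hy, rfl⟩
    exact x.isIntegral_coe.mul y.isIntegral_coe

lemma mem_differentLattice {x : K} :
    x ∈ (differentLattice K).carrier ↔ ∃ g ∈ differentIdeal ℤ (𝓞 K), (g : K) = x := Iff.rfl

lemma differentLattice_isFull : (differentLattice K).IsFull := by
  intro v
  obtain ⟨g, hg, hg0⟩ := Submodule.exists_mem_ne_zero_of_ne_bot
    (differentIdeal_ne_bot (A := ℤ) (B := 𝓞 K))
  obtain ⟨⟨a, c⟩, h⟩ := IsLocalization.surj (nonZeroDivisors (𝓞 K)) v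
  refine ⟨g * c, mul_ne_zero hg0 (nonZeroDivisors.ne_zero c.2), ?_⟩
  refine mem_differentLattice.mpr ⟨g * a, Ideal.mul_mem_right _ _ hg, ?_⟩
  change algebraMap (𝓞 K) K (g * a) = _
  rw [Algebra.smul_def, map_mul, map_mul, mul_assoc, ← h, mul_comm v]

lemma abs_discr_le_abs_norm {g : 𝓞 K} (hg : g ∈ differentIdeal ℤ (𝓞 K)) (h0 : g ≠ 0) :
    |discr K| ≤ |Algebra.norm ℤ g| := by
  have h1 : Ideal.absNorm (differentIdeal ℤ (𝓞 K)) ∣ Ideal.absNorm (Ideal.span {g}) :=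
    Ideal.absNorm_dvd_absNorm_of_le ((Ideal.span_singleton_le_iff_mem _).mpr hg)
  rw [absNorm_differentIdeal K (𝓞 K), Ideal.absNorm_span_singleton] at h1
  have h2 := Nat.le_of_dvd (Int.natAbs_pos.mpr (Algebra.norm_ne_zero_iff.mpr h0)) h1
  rw [Int.abs_eq_natAbs, Int.abs_eq_natAbs]
  exact_mod_cast h2

lemma lt_sum_sq_of_lt_discr (hK : TotallyReal K) {Y : ℝ} (hY : 0 ≤ Y)
    (hd : Y ^ Module.finrank ℚ K < |discr K|) {g : 𝓞 K} (hg : g ∈ differentIdeal ℤ (𝓞 K))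
    (h0 : g ≠ 0) : Y ^ 2 < ∑ σ : K →+* ℝ, σ (g : K) ^ 2 := by
  by_contra! h
  have h1 : ∀ σ : K →+* ℝ, |σ (g : K)| ≤ Y := fun σ => by
    refine abs_le_of_sq_le_sq (le_trans ?_ h) hY
    exact Finset.single_le_sum (f := fun σ : K →+* ℝ => σ (g : K) ^ 2)
      (fun σ _ => sq_nonneg _) (Finset.mem_univ σ)
  have h2 : ((|Algebra.norm ℤ g| : ℤ) : ℝ) = ∏ σ : K →+* ℝ, |σ (g : K)| := by
    rw [← Finset.abs_prod, ← hK.norm_eq, ← Algebra.coe_norm_int g]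
    push_cast
    rfl
  have h3 : ∏ σ : K →+* ℝ, |σ (g : K)| ≤ Y ^ Module.finrank ℚ K := by
    rw [← hK.card_emb, ← Finset.card_univ, ← Finset.prod_const]
    exact Finset.prod_le_prod (fun σ _ => abs_nonneg _) fun σ _ => h1 σ
  have h4 : ((|discr K| : ℤ) : ℝ) ≤ (|Algebra.norm ℤ g| : ℤ) := by
    exact_mod_cast abs_discr_le_abs_norm hg h0
  linarith

/-- When the discriminant is large, the inverse square of the different is dense. -/
theorem exists_different_approx (d : ℕ) {ε : ℝ} (hε : 0 < ε) :
    ∃ Δ : ℝ, ∀ (K : Type) [Field K] [NumberField K], TotallyReal K → Module.finrank ℚ K = d →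
      Δ < |discr K| → ∀ x : K, ∃ z : K,
        (∀ g ∈ differentIdeal ℤ (𝓞 K), ∀ g' ∈ differentIdeal ℤ (𝓞 K),
          IsIntegral ℤ ((g : K) * g' * z)) ∧ ∀ σ : K →+* ℝ, |σ (x - z)| < ε := by
  choose C hC using exists_reduced_basis'
  let C' : ℕ := ∑ r ∈ Finset.range (d + 1), C r
  let Y : ℝ := (d * (C' + 1) + 1) / ε
  have hY0 : 0 < Y := by positivity
  refine ⟨Y ^ d, fun K _ _ hK hd hΔ x => ?_⟩
  obtain ⟨σ₀⟩ := hK.nonempty_emb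
  set r := Module.finrank ℤ (differentLattice K).carrier with hr
  have hrd : r ≤ d := by
    have := (differentLattice K).finrank_int_le
    simpa [hd] using this
  have hCr : C r ≤ C' := Finset.single_le_sum (f := C) (fun _ _ => Nat.zero_le _)
    (Finset.mem_range.mpr (by omega))
  obtain ⟨b, hb⟩ := hC r (differentLattice K).carrier rfl (differentLattice K).traceForm
    (differentLattice K).traceForm_symm ((differentLattice K).traceForm_pos hK)
  choose y hy0 hy hyle using fun i =>
    (differentLattice K).exists_dual_vector_le hK b i fun v => hb v i
  have hysmall : ∀ i, ∀ σ : K →+* ℝ, |σ (y i)| * Y ≤ C' + 1 := by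
    intro i σ
    obtain ⟨g, hg, hgi⟩ := mem_differentLattice.mp (b i).2
    have hg0 : g ≠ 0 := by
      rintro rfl
      refine b.ne_zero i (Subtype.ext ?_)
      rw [← hgi]
      simp
    have h1 := lt_sum_sq_of_lt_discr hK hY0.le (by rw [hd]; exact hΔ) hg hg0
    have h2 := hyle i
    have h3 : (((differentLattice K).traceForm (b i) (b i) : ℤ) : ℝ) =
        ∑ σ : K →+* ℝ, σ (g : K) ^ 2 := by
      rw [KLattice.traceForm_real hK, ← hgi]
      refine Finset.sum_congr rfl fun σ _ => ?_
      change σ ((g : K) * g) = _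
      rw [map_mul, pow_two]
    have h4 : σ (y i) ^ 2 ≤ ∑ σ : K →+* ℝ, σ ((differentLattice K).form (y i) (y i)) := by
      have h5 := Finset.single_le_sum
        (f := fun σ : K →+* ℝ => σ ((differentLattice K).form (y i) (y i)))
        (fun σ _ => (differentLattice K).form_self_nonneg _ σ) (Finset.mem_univ σ)
      refine le_trans (le_of_eq ?_) h5
      change _ = σ (y i * y i)
      rw [map_mul, pow_two]
    rw [h3] at h2
    have h6 : (C r : ℝ) ≤ C' := by exact_mod_cast hCr
    have h7 : σ (y i) ^ 2 * Y ^ 2 ≤ C' := by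
      calc _ ≤ (∑ σ : K →+* ℝ, σ ((differentLattice K).form (y i) (y i))) *
            ∑ σ : K →+* ℝ, σ (g : K) ^ 2 :=
          mul_le_mul h4 h1.le (sq_nonneg _) ((sq_nonneg _).trans h4)
        _ ≤ C' := h2.trans h6
    have h8 : (|σ (y i)| * Y) ^ 2 ≤ C' := by rw [mul_pow, sq_abs]; exact h7
    have h9 : (0 : ℝ) ≤ C' := Nat.cast_nonneg _
    nlinarith [sq_nonneg (|σ (y i)| * Y - 1)]
  let t : Fin r → ℚ := fun i => Algebra.trace ℚ K (x * (b i : K))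
  have hx : x = ∑ i, (t i : K) * y i := by
    have h1 : ∀ j, Algebra.trace ℚ K ((x - ∑ i, (t i : K) * y i) * (b j : K)) = 0 := by
      intro j
      have h2 : ∀ i, Algebra.trace ℚ K ((t i : K) * y i * (b j : K)) =
          t i * (if i = j then 1 else 0) := by
        intro i
        have h3 : Algebra.trace ℚ K (y i * (b j : K)) = b.repr (b j) i := hy i (b j)
        have h4 : (t i : K) * y i * (b j : K) = t i • (y i * (b j : K)) := by
          rw [Algebra.smul_def, mul_assoc]
          rfl
        rw [h4, map_smul, h3, b.repr_self, Finsupp.single_apply, smul_eq_mul]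
        simp [eq_comm]
      rw [sub_mul, map_sub, Finset.sum_mul, map_sum]
      simp [h2, t]
    have h2 : ∀ v : (differentLattice K).carrier,
        Algebra.trace ℚ K ((x - ∑ i, (t i : K) * y i) * (v : K)) = 0 := by
      intro v
      have h3 := congrArg (differentLattice K).carrier.subtype (b.sum_repr v)
      rw [map_sum] at h3
      rw [← show _ = (v : K) from h3, Finset.mul_sum, map_sum]
      refine Finset.sum_eq_zero fun j _ => ?_
      rw [map_zsmul, mul_smul_comm, map_zsmul]
      exact (congrArg _ (h1 j)).trans (smul_zero _)
    rw [← sub_eq_zero]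
    set w := x - ∑ i, (t i : K) * y i
    by_contra hw
    obtain ⟨c, hc, hcw⟩ := differentLattice_isFull (K := K) w
    have h3 := h2 ⟨c • c • w, Submodule.smul_mem _ c hcw⟩
    have h4 := congrArg (fun q : ℚ => (q : ℝ)) h3
    simp only [hK.trace_eq, Rat.cast_zero] at h4
    have := hK.nonempty_emb
    refine (Finset.sum_pos (fun σ _ => ?_) Finset.univ_nonempty).ne' h4
    have h5 : w * (c • c • w) = ((c : K) * w) * ((c : K) * w) := by
      rw [Algebra.smul_def, Algebra.smul_def]
      ring
    rw [h5, map_mul]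
    have h6 : σ ((c : K) * w) ≠ 0 := by simp [hc, hw]
    exact mul_self_pos.mpr h6
  refine ⟨∑ i, (round (t i) : K) * y i, fun g hg g' hg' => ?_, fun σ => ?_⟩
  · rw [Finset.mul_sum]
    refine IsIntegral.sum _ fun i _ => ?_
    have h1 := KLattice.form_mem_codifferent (differentLattice K)
      (fun v => ⟨_, hy i v⟩) ⟨(g : K), mem_differentLattice.mpr ⟨g, hg, rfl⟩⟩
    have h2 : y i * (g : K) ∈ codifferent K := h1
    have h3 := mem_codifferent_iff.mp h2 g' hg'
    have h4 : (g : K) * g' * ((round (t i) : ℤ) * y i) = (round (t i) : ℤ) * (y i * g * g') := by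
      ring
    rw [h4]
    exact (isIntegral_algebraMap (R := ℤ) (A := K) (x := round (t i))).mul h3
  · have h1 : x - ∑ i, (round (t i) : K) * y i = ∑ i, ((t i - round (t i) : ℚ) : K) * y i := by
      conv_lhs => rw [hx]
      rw [← Finset.sum_sub_distrib]
      refine Finset.sum_congr rfl fun i _ => ?_
      push_cast
      ring
    rw [h1, map_sum]
    have h2 : ∀ i, |σ (((t i - round (t i) : ℚ) : K) * y i)| ≤ (C' + 1) / Y := by
      intro i
      rw [map_mul, abs_mul, map_ratCast, le_div_iff₀ hY0]
      have h3 : |((t i - round (t i) : ℚ) : ℝ)| ≤ 1 := by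
        have := abs_sub_round (t i)
        have h4 : |t i - round (t i)| ≤ 1 := this.trans (by norm_num)
        exact_mod_cast h4
      have h5 := hysmall i σ
      have h6 : 0 ≤ |σ (y i)| * Y := by positivity
      nlinarith [abs_nonneg ((t i - round (t i) : ℚ) : ℝ)]
    calc _ ≤ ∑ i, |σ (((t i - round (t i) : ℚ) : K) * y i)| := Finset.abs_sum_le_sum_abs _ _
      _ ≤ ∑ _i : Fin r, (C' + 1) / Y := Finset.sum_le_sum fun i _ => h2 i
      _ = r * ((C' + 1) / Y) := by simp
      _ ≤ d * ((C' + 1) / Y) := by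
        refine mul_le_mul_of_nonneg_right (by exact_mod_cast hrd) (by positivity)
      _ < ε := by
        rw [← mul_div_assoc, div_lt_iff₀ hY0]
        simp only [Y]
        rw [mul_div_cancel₀ _ hε.ne']
        linarith

end Different

section OneDimensional

variable {K : Type} [Field K] [NumberField K] {F : IntermediateField ℚ K}

lemma isIntegral_coe_iff {z : F} : IsIntegral ℤ (z : K) ↔ IsIntegral ℤ z :=
  isIntegral_algebraMap_iff (B := K) (algebraMap F K).injective

lemma isIntegral_coe_coe (c : 𝓞 F) : IsIntegral ℤ ((c : F) : K) :=
  isIntegral_coe_iff.mpr c.isIntegral_coe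

lemma exists_coe_coe_eq {z : K} (hz : z ∈ F) (h : IsIntegral ℤ z) : ∃ c : 𝓞 F, ((c : F) : K) = z :=
  ⟨⟨⟨z, hz⟩, isIntegral_coe_iff.mp h⟩, rfl⟩

lemma exists_add_mul_eq_one (q : Ideal (𝓞 F)) [hq : q.IsMaximal] (hq0 : q ≠ ⊥) {z : K}
    (hzF : z ∈ F) (hz : ¬ IsIntegral ℤ z) (h : ∀ c ∈ q, IsIntegral ℤ (((c : F) : K) * z)) :
    ∃ a ∈ q, ∃ b ∈ q, (1 : K) = ((a : F) : K) + ((b : F) : K) * z := by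
  have h2 : ∀ c : q, ∃ e : 𝓞 F, ((e : F) : K) = ((c.1 : F) : K) * z := fun c =>
    exists_coe_coe_eq (F.mul_mem (c.1 : F).2 hzF) (h c c.2)
  choose e he using h2
  have hinj : Function.Injective fun c : 𝓞 F => ((c : F) : K) := fun a b hab =>
    RingOfIntegers.ext (Subtype.ext hab)
  let I : Ideal (𝓞 F) :=
    { carrier := {c | ∃ a ∈ q, ∃ b : q, c = a + e b}
      zero_mem' := ⟨0, q.zero_mem, 0, hinj (by simp [he])⟩
      add_mem' := by
        rintro _ _ ⟨a, ha, b, rfl⟩ ⟨a', ha', b', rfl⟩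
        refine ⟨a + a', q.add_mem ha ha', b + b', hinj ?_⟩
        simp only [map_add, IntermediateField.coe_add, he, Submodule.coe_add]
        ring
      smul_mem' := by
        rintro c _ ⟨a, ha, b, rfl⟩
        refine ⟨c * a, q.mul_mem_left c ha, c • b, hinj ?_⟩
        simp only [map_add, map_mul, smul_eq_mul, IntermediateField.coe_add,
          IntermediateField.coe_mul, he, Submodule.coe_smul]
        ring }
  have hqI : q ≤ I := fun a ha => ⟨a, ha, 0, hinj (by simp [he])⟩
  have hI : I = ⊤ := by
    by_contra hI
    have hIq : q = I := hq.eq_of_le hI hqI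
    refine hz ?_
    have h3 := isIntegral_of_smul_mem_submodule
      (Submodule.map (Algebra.linearMap (𝓞 F) F) q) ?_ ((IsNoetherian.noetherian q).map _)
      (⟨z, hzF⟩ : F) ?_
    · exact isIntegral_coe_iff (z := ⟨z, hzF⟩) |>.mpr (isIntegral_trans (R := ℤ) (A := 𝓞 F) _ h3)
    · intro hbot
      obtain ⟨g, hg, hg0⟩ := Submodule.exists_mem_ne_zero_of_ne_bot hq0
      have h4 : algebraMap (𝓞 F) F g ∈ Submodule.map (Algebra.linearMap (𝓞 F) F) q := ⟨g, hg, rfl⟩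
      rw [hbot, Submodule.mem_bot] at h4
      exact hg0 (RingOfIntegers.coe_eq_zero_iff.mp h4)
    · rintro _ ⟨c, hc, rfl⟩
      refine ⟨e ⟨c, hc⟩, ?_, Subtype.ext ?_⟩
      · have h5 : e ⟨c, hc⟩ ∈ I := ⟨0, q.zero_mem, ⟨c, hc⟩, by simp⟩
        exact hIq.ge h5
      · exact (he ⟨c, hc⟩).trans (mul_comm _ _)
  obtain ⟨a, ha, b, hab⟩ : (1 : 𝓞 F) ∈ I := hI ▸ Submodule.mem_top
  refine ⟨a, ha, b, b.2, ?_⟩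
  rw [← he, ← IntermediateField.coe_add, ← map_add, ← hab]
  simp

/-- The elements of `F` annihilated by a maximal ideal modulo integers form a line. -/
lemma exists_isIntegral_sub_mul (q : Ideal (𝓞 F)) [hq : q.IsMaximal] (hq0 : q ≠ ⊥) {z z' : K}
    (hzF : z ∈ F) (hzF' : z' ∈ F) (hz : ¬ IsIntegral ℤ z)
    (h : ∀ c ∈ q, IsIntegral ℤ (((c : F) : K) * z))
    (h' : ∀ c ∈ q, IsIntegral ℤ (((c : F) : K) * z')) :
    ∃ c : 𝓞 F, IsIntegral ℤ (z' - ((c : F) : K) * z) := by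
  obtain ⟨a, ha, b, hb, h3⟩ := exists_add_mul_eq_one q hq0 hzF hz h
  obtain ⟨c, hc⟩ := exists_coe_coe_eq (F.mul_mem (b : F).2 hzF') (h' b hb)
  refine ⟨c, ?_⟩
  have h4 : z' - ((c : F) : K) * z = ((a : F) : K) * z' := by
    rw [hc]
    linear_combination z' * h3
  rw [h4]
  exact h' a ha

lemma isIntegral_of_not_mem (q : Ideal (𝓞 F)) [hq : q.IsMaximal] {z : K} {c : 𝓞 F} (hc : c ∉ q)
    (h : ∀ c ∈ q, IsIntegral ℤ (((c : F) : K) * z)) (hcz : IsIntegral ℤ (((c : F) : K) * z)) :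
    IsIntegral ℤ z := by
  obtain ⟨r, a, ha, h1⟩ := hq.exists_inv hc
  have h2 : ((r : F) : K) * ((c : F) : K) + ((a : F) : K) = 1 := by
    rw [← IntermediateField.coe_mul, ← map_mul, ← IntermediateField.coe_add, ← map_add, h1]
    simp
  have h3 : z = ((r : F) : K) * (((c : F) : K) * z) + ((a : F) : K) * z := by
    linear_combination (-z) * h2
  rw [h3]
  exact ((isIntegral_coe_coe r).mul hcz).add (h a ha)

/-- A codifferent element whose trace pairing detects integrality of the elements of `F` annihilated
by a maximal ideal modulo integers. -/
lemma exists_mem_codifferent_detecting (q : Ideal (𝓞 F)) [hq : q.IsMaximal] (hq0 : q ≠ ⊥) :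
    ∃ γ ∈ codifferent K, ∀ z ∈ F, (∀ c ∈ q, IsIntegral ℤ (((c : F) : K) * z)) →
      (∀ c : 𝓞 F, ∃ m : ℤ, Algebra.trace ℚ K (((c : F) : K) * (γ * z)) = m) → IsIntegral ℤ z := by
  by_cases hex : ∃ z₀ ∈ F, (∀ c ∈ q, IsIntegral ℤ (((c : F) : K) * z₀)) ∧ ¬ IsIntegral ℤ z₀
  · obtain ⟨z₀, hz₀F, hz₀, hz₀i⟩ := hex
    have h1 : ∃ γ ∈ codifferent K, ¬ ∃ m : ℤ, Algebra.trace ℚ K (γ * z₀) = m := by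
      by_contra! h
      exact hz₀i (isIntegral_of_trace_codifferent h)
    obtain ⟨γ, hγ, hγz⟩ := h1
    refine ⟨γ, hγ, fun z hzF hz hTr => ?_⟩
    by_contra hzi
    obtain ⟨c, hc⟩ := exists_isIntegral_sub_mul q hq0 hzF hz₀F hzi hz hz₀
    obtain ⟨y, hy⟩ := isIntegral_iff_exists.mp hc
    obtain ⟨m, hm⟩ := hTr c
    obtain ⟨m', hm'⟩ := hγ y
    refine hγz ⟨m + m', ?_⟩
    rw [hy] at hm'
    rw [Int.cast_add, ← hm, ← hm', ← map_add]
    congr 1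
    ring
  · push Not at hex
    exact ⟨0, Submodule.zero_mem _, fun z hzF hz _ => hex z hzF hz⟩

/-- Ternary quadratic forms over finite fields are isotropic. -/
lemma exists_isotropic_ternary {k : Type} [Field k] [Finite k] (α β : k) :
    ∃ c : Fin 3 → k, c ≠ 0 ∧ c 0 ^ 2 + α * c 1 ^ 2 + β * c 2 ^ 2 = 0 := by
  have := Fintype.ofFinite k
  by_cases hα : α = 0
  · exact ⟨![0, 1, 0], fun h => by simpa using congrFun h 1, by simp [hα]⟩
  by_cases h2 : Fintype.card k % 2 = 1
  · obtain ⟨a, b, hab⟩ := FiniteField.exists_root_sum_quadratic (R := k)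
      (f := Polynomial.X ^ 2) (g := Polynomial.C α * Polynomial.X ^ 2 + Polynomial.C β)
      (by simp) (by compute_degree!) h2
    refine ⟨![a, b, 1], fun h => by simpa using congrFun h 2, ?_⟩
    simp at hab
    simp
    linear_combination hab
  · have hch : ringChar k = 2 := by
      by_contra hne
      exact h2 (FiniteField.odd_card_of_char_ne_two hne)
    obtain ⟨a, ha⟩ := FiniteField.isSquare_of_char_two hch α
    have : CharP k 2 := hch ▸ ringChar.charP k
    refine ⟨![a, 1, 0], fun h => by simpa using congrFun h 1, ?_⟩
    simp [ha, ← pow_two, CharTwo.add_self_eq_zero]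

end OneDimensional

namespace KLattice

section SmallTorsion

variable {K V : Type} [Field K] [NumberField K] [AddCommGroup V] [Module K V] [Module (𝓞 K) V]
  [IsScalarTower (𝓞 K) K V] {F : IntermediateField ℚ K}


lemma coe_smul_mem_carrier (Q : KLattice K V) {x : V} (hx : x ∈ Q.carrier) (c : 𝓞 F) :
    ((c : F) : K) • x ∈ Q.carrier := by
  obtain ⟨y, hy⟩ := isIntegral_iff_exists.mp (isIntegral_coe_coe (K := K) c)
  rw [← hy, ← smul_eq]
  exact Q.carrier.smul_mem y hx

lemma coe_smul_mem_dual (Q : KLattice K V) {x : V} (hx : x ∈ Q.dual) (c : 𝓞 F) :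
    ((c : F) : K) • x ∈ Q.dual := by
  obtain ⟨y, hy⟩ := isIntegral_iff_exists.mp (isIntegral_coe_coe (K := K) c)
  rw [← hy, ← smul_eq]
  exact Q.dual.smul_mem y hx

/-- The conditions on a set of dual vectors annihilated by `q` modulo the lattice. -/
structure IsTorsionSet (Q : KLattice K V) (q : Ideal (𝓞 F)) (X : Set V) : Prop where
  zero_mem : 0 ∈ X
  add_mem : ∀ x ∈ X, ∀ y ∈ X, x + y ∈ X
  smul_mem : ∀ c : 𝓞 F, ∀ x ∈ X, ((c : F) : K) • x ∈ X
  mem_dual : ∀ x ∈ X, x ∈ Q.dual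
  form_mem : ∀ x ∈ X, ∀ y ∈ X, Q.form x y ∈ F
  smul_mem_carrier : ∀ c ∈ q, ∀ x ∈ X, ((c : F) : K) • x ∈ Q.carrier

lemma IsTorsionSet.isIntegral_mul {Q : KLattice K V} {q : Ideal (𝓞 F)} {X : Set V}
    (hX : Q.IsTorsionSet q X) {x y : V} (hx : x ∈ X) (hy : y ∈ Q.dual) {c : 𝓞 F} (hc : c ∈ q) :
    IsIntegral ℤ (((c : F) : K) * Q.form x y) := by
  have h := hy _ (hX.smul_mem_carrier c hc x hx)
  rwa [map_smul, smul_eq_mul, Q.symm] at h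

lemma IsTorsionSet.false_of_three {Q : KLattice K V} (hQ : Q.IsMax) {q : Ideal (𝓞 F)}
    [hq : q.IsMaximal] (hq0 : q ≠ ⊥) {X : Set V} (hX : Q.IsTorsionSet q X) (u : Fin 3 → V)
    (hu : ∀ i, u i ∈ X) (huQ : ∀ i, u i ∉ Q.carrier)
    (h01 : IsIntegral ℤ (Q.form (u 1) (u 0))) (h02 : IsIntegral ℤ (Q.form (u 2) (u 0)))
    (h12 : IsIntegral ℤ (Q.form (u 2) (u 1))) : False := by
  have hz : ∀ i, ¬ IsIntegral ℤ (Q.form (u i) (u i)) := fun i h =>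
    huQ i (hQ _ (hX.mem_dual _ (hu i)) h)
  have hzF : ∀ i, Q.form (u i) (u i) ∈ F := fun i => hX.form_mem _ (hu i) _ (hu i)
  have hqz : ∀ i, ∀ c ∈ q, IsIntegral ℤ (((c : F) : K) * Q.form (u i) (u i)) := fun i c hc =>
    hX.isIntegral_mul (hu i) (hX.mem_dual _ (hu i)) hc
  obtain ⟨α, hα⟩ := exists_isIntegral_sub_mul q hq0 (hzF 0) (hzF 1) (hz 0) (hqz 0) (hqz 1)
  obtain ⟨β, hβ⟩ := exists_isIntegral_sub_mul q hq0 (hzF 0) (hzF 2) (hz 0) (hqz 0) (hqz 2)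
  let _ := Ideal.Quotient.field q
  have : Finite (𝓞 F ⧸ q) := Ideal.finiteQuotientOfFreeOfNeBot q hq0
  obtain ⟨cb, hcb0, hcb⟩ := exists_isotropic_ternary (Ideal.Quotient.mk q α) (Ideal.Quotient.mk q β)
  choose c hc using fun i => Ideal.Quotient.mk_surjective (cb i)
  have hcq : c 0 ^ 2 + α * c 1 ^ 2 + β * c 2 ^ 2 ∈ q := by
    rw [← Ideal.Quotient.eq_zero_iff_mem]
    simpa [hc] using hcb
  let C : Fin 3 → K := fun i => ((c i : F) : K)
  have hCi : ∀ i, IsIntegral ℤ (C i) := fun i => isIntegral_coe_coe (c i)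
  set w : V := C 0 • u 0 + C 1 • u 1 + C 2 • u 2 with hw
  have hwX : w ∈ X := hX.add_mem _ (hX.add_mem _ (hX.smul_mem _ _ (hu 0)) _
    (hX.smul_mem _ _ (hu 1))) _ (hX.smul_mem _ _ (hu 2))
  have hform : Q.form w w =
      ((c 0 ^ 2 + α * c 1 ^ 2 + β * c 2 ^ 2 : 𝓞 F) : F) * Q.form (u 0) (u 0)
      + C 1 ^ 2 * (Q.form (u 1) (u 1) - ((α : F) : K) * Q.form (u 0) (u 0))
      + C 2 ^ 2 * (Q.form (u 2) (u 2) - ((β : F) : K) * Q.form (u 0) (u 0))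
      + 2 * (C 0 * C 1 * Q.form (u 1) (u 0)) + 2 * (C 0 * C 2 * Q.form (u 2) (u 0))
      + 2 * (C 1 * C 2 * Q.form (u 2) (u 1)) := by
    rw [hw]
    simp only [map_add, map_smul, LinearMap.add_apply, LinearMap.smul_apply, smul_eq_mul, map_mul,
      map_pow, IntermediateField.coe_add, IntermediateField.coe_mul, IntermediateField.coe_pow,
      Q.symm (u 0) (u 1), Q.symm (u 0) (u 2), Q.symm (u 1) (u 2), C]
    ring
  have h2 : IsIntegral ℤ (2 : K) := by
    simpa using isIntegral_algebraMap (R := ℤ) (A := K) (x := (2 : ℤ))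
  have hwQ : w ∈ Q.carrier := by
    refine hQ _ (hX.mem_dual _ hwX) ?_
    rw [hform]
    exact (((((hqz 0 _ hcq).add (((hCi 1).pow 2).mul hα)).add (((hCi 2).pow 2).mul hβ)).add
      (h2.mul (((hCi 0).mul (hCi 1)).mul h01))).add (h2.mul (((hCi 0).mul (hCi 2)).mul h02))).add
      (h2.mul (((hCi 1).mul (hCi 2)).mul h12))
  have hint : ∀ i, IsIntegral ℤ (Q.form (u i) w) := fun i => hX.mem_dual _ (hu i) _ hwQ
  have hmem : ∀ i, IsIntegral ℤ (C i * Q.form (u i) (u i)) → c i ∈ q := fun i h => by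
    by_contra hci
    exact hz i (isIntegral_of_not_mem q hci (hqz i) h)
  refine hcb0 (funext fun i => ?_)
  rw [← hc, Pi.zero_apply, Ideal.Quotient.eq_zero_iff_mem]
  refine hmem i ?_
  have e0 := hint i
  simp only [hw, map_add, map_smul, smul_eq_mul] at e0
  fin_cases i
  · simp only [Fin.zero_eta, Q.symm (u 0) (u 1), Q.symm (u 0) (u 2)] at e0 ⊢
    have h := (e0.sub ((hCi 1).mul h01)).sub ((hCi 2).mul h02)
    ring_nf at h ⊢
    exact h
  · simp only [Fin.mk_one, Q.symm (u 1) (u 2)] at e0 ⊢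
    have h := (e0.sub ((hCi 0).mul h01)).sub ((hCi 2).mul h12)
    ring_nf at h ⊢
    exact h
  · simp only [Fin.reduceFinMk] at e0 ⊢
    have h := (e0.sub ((hCi 0).mul h02)).sub ((hCi 1).mul h12)
    ring_nf at h ⊢
    exact h

/-- Two vectors suffice to detect lattice membership among vectors annihilated by a maximal
ideal. -/
lemma IsTorsionSet.exists_detecting {Q : KLattice K V} (hQ : Q.IsMax) {q : Ideal (𝓞 F)}
    [hq : q.IsMaximal] (hq0 : q ≠ ⊥) {X : Set V} (hX : Q.IsTorsionSet q X) :
    ∃ u : Fin 2 → V, (∀ i, u i ∈ X) ∧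
      ∀ x ∈ X, (∀ i, IsIntegral ℤ (Q.form x (u i))) → x ∈ Q.carrier := by
  by_cases h1 : ∃ u ∈ X, u ∉ Q.carrier
  · obtain ⟨u, huX, hu⟩ := h1
    by_cases h2 : ∃ u' ∈ X, IsIntegral ℤ (Q.form u' u) ∧ u' ∉ Q.carrier
    · obtain ⟨u', huX', huu, hu'⟩ := h2
      refine ⟨![u, u'], fun i => by fin_cases i <;> simpa, fun x hx h => ?_⟩
      by_contra hxQ
      refine hX.false_of_three hQ hq0 ![u, u', x] (fun i => ?_) (fun i => ?_) huu (h 0) (h 1)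
      · fin_cases i <;> simpa
      · fin_cases i <;> simpa
    · push Not at h2
      refine ⟨![u, 0], fun i => ?_, fun x hx h => h2 x hx (h 0)⟩
      fin_cases i
      · simpa
      · simpa using hX.zero_mem
  · push Not at h1
    exact ⟨fun _ => 0, fun _ => hX.zero_mem, fun x hx _ => h1 x hx⟩

/-- A vector outside the lattice has a multiple outside the lattice annihilated by a maximal
ideal. -/
lemma exists_annihilator (Q : KLattice K V) {a : ℕ} (ha : a ≠ 0) {m : V} (hm : m ∉ Q.carrier)
    (ham : (a : K) • m ∈ Q.carrier) :
    ∃ (q : Ideal (𝓞 F)) (c : 𝓞 F), q.IsMaximal ∧ q ≠ ⊥ ∧ ((c : F) : K) • m ∉ Q.carrier ∧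
      ∀ r ∈ q, ((r : F) : K) • ((c : F) : K) • m ∈ Q.carrier := by
  let I : 𝓞 F → Ideal (𝓞 F) := fun c =>
    { carrier := {r | ((r : F) : K) • ((c : F) : K) • m ∈ Q.carrier}
      zero_mem' := by simp
      add_mem' := fun {r s} hr hs => by
        have h := Q.carrier.add_mem hr hs
        rw [← add_smul] at h
        simpa using h
      smul_mem' := fun b r hr => by
        have h := Q.coe_smul_mem_carrier hr b
        rw [smul_smul] at h
        simpa using h }
  have hI : ∀ {c r : 𝓞 F}, r ∈ I c ↔ ((r : F) : K) • ((c : F) : K) • m ∈ Q.carrier := Iff.rfl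
  let S : Set (Ideal (𝓞 F)) := {J | ∃ c : 𝓞 F, ((c : F) : K) • m ∉ Q.carrier ∧ I c = J}
  obtain ⟨J, ⟨c, hc, rfl⟩, hJmax⟩ := set_has_maximal_iff_noetherian.mpr
    (inferInstance : IsNoetherian (𝓞 F) (𝓞 F)) S ⟨I 1, 1, by simpa using hm, rfl⟩
  have haI : (a : 𝓞 F) ∈ I c := by
    rw [hI, smul_comm]
    simpa using Q.coe_smul_mem_carrier ham c
  have hbot : I c ≠ ⊥ := fun h => by
    rw [h, Ideal.mem_bot] at haI
    exact ha (by exact_mod_cast haI)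
  have hprime : (I c).IsPrime := by
    refine ⟨fun h => ?_, fun {r s} hrs => ?_⟩
    · have h1 : (1 : 𝓞 F) ∈ I c := h ▸ Submodule.mem_top
      rw [hI] at h1
      exact hc (by simpa using h1)
    · by_contra! hcon
      obtain ⟨hr, hs⟩ := hcon
      have h1 : I (r * c) ∈ S := ⟨r * c, fun h => hr ?_, rfl⟩
      · refine hJmax _ h1 (lt_of_le_of_ne (fun b hb => ?_) fun h => ?_)
        · rw [hI] at hb ⊢
          have := Q.coe_smul_mem_carrier hb r
          simpa [smul_smul, mul_comm, mul_left_comm, mul_assoc] using this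
        · refine hs ?_
          rw [h, hI]
          rw [hI] at hrs
          simpa [smul_smul, mul_comm, mul_left_comm, mul_assoc] using hrs
      · rw [hI]
        simpa [smul_smul] using h
  exact ⟨I c, c, hprime.isMaximal hbot, hbot, hc, fun r hr => hI.mp hr⟩

lemma exists_small_selection (Q : KLattice K V) (hQ : Q.IsMax) {a : ℕ} (ha : a ≠ 0)
    (S : Finset V) (hS : ∀ m ∈ S, m ∈ Q.dual) (haS : ∀ m ∈ S, (a : K) • m ∈ Q.carrier)
    (hSF : ∀ m ∈ S, ∀ m' ∈ S, Q.form m m' ∈ F) :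
    ∃ w : Fin 2 → V, (∀ i, ∀ x ∈ Q.carrier, Q.form (w i) x ∈ codifferent K) ∧
      ∀ m ∈ S, (∀ i, ∀ c : 𝓞 F, ∃ k : ℤ,
        Algebra.trace ℚ K (((c : F) : K) * Q.form (w i) m) = k) → m ∈ Q.carrier := by
  classical
  let M : AddSubgroup V := AddSubgroup.closure {x | ∃ c : 𝓞 F, ∃ m ∈ S, x = ((c : F) : K) • m}
  have hMmem : ∀ c : 𝓞 F, ∀ m ∈ S, ((c : F) : K) • m ∈ M := fun c m hm =>
    AddSubgroup.subset_closure ⟨c, m, hm, rfl⟩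
  have hMsmul : ∀ c : 𝓞 F, ∀ x ∈ M, ((c : F) : K) • x ∈ M := fun c x hx => by
    induction hx using AddSubgroup.closure_induction with
    | mem x hx =>
      obtain ⟨c', m, hm, rfl⟩ := hx
      rw [smul_smul, ← IntermediateField.coe_mul, ← map_mul]
      exact hMmem _ m hm
    | zero => simp
    | add x y _ _ hx hy => rw [smul_add]; exact M.add_mem hx hy
    | neg x _ hx => rw [smul_neg]; exact M.neg_mem hx
  have hMdual : ∀ x ∈ M, x ∈ Q.dual := fun x hx => by
    induction hx using AddSubgroup.closure_induction with
    | mem x hx =>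
      obtain ⟨c', m, hm, rfl⟩ := hx
      exact Q.coe_smul_mem_dual (hS m hm) c'
    | zero => exact Q.dual.zero_mem
    | add x y _ _ hx hy => exact Q.dual.add_mem hx hy
    | neg x _ hx => exact Q.dual.neg_mem hx
  have hMF1 : ∀ x ∈ M, ∀ m ∈ S, Q.form x m ∈ F := fun x hx m' hm' => by
    induction hx using AddSubgroup.closure_induction with
    | mem x hx =>
      obtain ⟨c', m, hm, rfl⟩ := hx
      rw [map_smul, LinearMap.smul_apply]
      exact F.mul_mem (c' : F).2 (hSF m hm m' hm')
    | zero => simp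
    | add x y _ _ hx hy => rw [map_add, LinearMap.add_apply]; exact F.add_mem hx hy
    | neg x _ hx => rw [map_neg, LinearMap.neg_apply]; exact F.neg_mem hx
  have hMF : ∀ x ∈ M, ∀ y ∈ M, Q.form x y ∈ F := fun x hx y hy => by
    induction hy using AddSubgroup.closure_induction with
    | mem y hy =>
      obtain ⟨c', m, hm, rfl⟩ := hy
      rw [map_smul]
      exact F.mul_mem (c' : F).2 (hMF1 x hx m hm)
    | zero => simp
    | add y z _ _ hy hz => rw [map_add]; exact F.add_mem hy hz
    | neg y _ hy => rw [map_neg]; exact F.neg_mem hy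
  let X : Ideal (𝓞 F) → Set V := fun q =>
    {x | x ∈ M ∧ ∀ c ∈ q, ((c : F) : K) • x ∈ Q.carrier}
  have hX : ∀ q, Q.IsTorsionSet q (X q) := fun q =>
    { zero_mem := ⟨M.zero_mem, fun c _ => by simp⟩
      add_mem := fun x hx y hy => ⟨M.add_mem hx.1 hy.1, fun c hc => by
        rw [smul_add]
        exact Q.carrier.add_mem (hx.2 c hc) (hy.2 c hc)⟩
      smul_mem := fun c x hx => ⟨hMsmul c x hx.1, fun c' hc' => by
        rw [smul_comm]
        exact Q.coe_smul_mem_carrier (hx.2 c' hc') c⟩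
      mem_dual := fun x hx => hMdual x hx.1
      form_mem := fun x hx y hy => hMF x hx.1 y hy.1
      smul_mem_carrier := fun c hc x hx => hx.2 c hc }
  have hdet : ∀ q : Ideal (𝓞 F), ∃ (γ : K) (u : Fin 2 → V), γ ∈ codifferent K ∧
      (∀ i, u i ∈ X q) ∧ (q.IsMaximal → q ≠ ⊥ →
        (∀ x ∈ X q, (∀ i, IsIntegral ℤ (Q.form x (u i))) → x ∈ Q.carrier) ∧
        ∀ z ∈ F, (∀ c ∈ q, IsIntegral ℤ (((c : F) : K) * z)) →
      (∀ c : 𝓞 F, ∃ m : ℤ, Algebra.trace ℚ K (((c : F) : K) * (γ * z)) = m) →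
        IsIntegral ℤ z) := fun q => by
    by_cases hq : q.IsMaximal ∧ q ≠ ⊥
    · have := hq.1
      obtain ⟨u, hu, hu'⟩ := (hX q).exists_detecting hQ hq.2
      obtain ⟨γ, hγ, hγ'⟩ := exists_mem_codifferent_detecting (K := K) q hq.2
      exact ⟨γ, u, hγ, hu, fun _ _ => ⟨hu', hγ'⟩⟩
    · exact ⟨0, fun _ => 0, Submodule.zero_mem _, fun _ => (hX q).zero_mem,
        fun h1 h2 => absurd ⟨h1, h2⟩ hq⟩
  choose γ u hγ hu hdet' using hdet
  have hann : ∀ m : V, ∃ (q : Ideal (𝓞 F)) (c : 𝓞 F), m ∈ S → m ∉ Q.carrier →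
      (q.IsMaximal ∧ q ≠ ⊥ ∧ ((c : F) : K) • m ∉ Q.carrier ∧
      ∀ r ∈ q, ((r : F) : K) • ((c : F) : K) • m ∈ Q.carrier) := fun m => by
    by_cases h : m ∈ S ∧ m ∉ Q.carrier
    · obtain ⟨q, c, h'⟩ := Q.exists_annihilator (F := F) ha h.2 (haS m h.1)
      exact ⟨q, c, fun _ _ => h'⟩
    · exact ⟨⊥, 0, fun h1 h2 => absurd ⟨h1, h2⟩ h⟩
  choose q c hqc using hann
  let T : Finset (Ideal (𝓞 F)) := (S.filter fun m => m ∉ Q.carrier).image q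
  have hform : ∀ i x, Q.form (∑ p ∈ T, γ p • u p i) x = ∑ p ∈ T, γ p * Q.form (u p i) x :=
    fun i x => by simp [map_sum, LinearMap.sum_apply]
  refine ⟨fun i => ∑ p ∈ T, γ p • u p i, fun i x hx => ?_, fun m hm hTr => ?_⟩
  · rw [hform]
    refine Submodule.sum_mem _ fun p _ => ?_
    obtain ⟨y, hy⟩ := isIntegral_iff_exists.mp ((hX p).mem_dual _ (hu p i) x hx)
    rw [← hy, mul_comm]
    exact (codifferent K).smul_mem y (hγ p)
  · by_contra hmQ
    obtain ⟨hqm, hq0, hcm, hq⟩ := hqc m hm hmQ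
    have hxX : ((c m : F) : K) • m ∈ X (q m) := ⟨hMmem _ m hm, hq⟩
    refine hcm ((hdet' _ hqm hq0).1 _ hxX fun i => ?_)
    refine (hdet' _ hqm hq0).2 _ ((hX _).form_mem _ hxX _ (hu _ i)) (fun r hr =>
      (hX _).isIntegral_mul hxX ((hX _).mem_dual _ (hu _ i)) hr) fun r => ?_
    have hqT : q m ∈ T := Finset.mem_image_of_mem _ (Finset.mem_filter.mpr ⟨hm, hmQ⟩)
    have hothers : ∀ p ∈ T.erase (q m), ∃ k : ℤ, Algebra.trace ℚ K (((r : F) : K) *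
        (γ p * Q.form (u p i) (((c m : F) : K) • m))) = k := fun p hp => by
      obtain ⟨hpne, hpT⟩ := Finset.mem_erase.mp hp
      obtain ⟨m', hm', rfl⟩ := Finset.mem_image.mp hpT
      obtain ⟨hm'S, hm'Q⟩ := Finset.mem_filter.mp hm'
      obtain ⟨hpm, -, -⟩ := hqc m' hm'S hm'Q
      obtain ⟨b, hb, e, he, hbe⟩ := Submodule.mem_sup.mp
        ((Ideal.eq_top_iff_one _).mp (hpm.coprime_of_ne hqm hpne))
      have hint : IsIntegral ℤ (Q.form (u (q m') i) (((c m : F) : K) • m)) := by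
        have h1 := (hX _).isIntegral_mul (hu (q m') i) ((hX _).mem_dual _ hxX) hb
        have h2 := (hX _).isIntegral_mul hxX ((hX _).mem_dual _ (hu (q m') i)) he
        rw [Q.symm] at h2
        have h3 := h1.add h2
        rwa [← add_mul, ← IntermediateField.coe_add, ← map_add, hbe, map_one,
          IntermediateField.coe_one, one_mul] at h3
      obtain ⟨y, hy⟩ := isIntegral_iff_exists.mp ((isIntegral_coe_coe (K := K) r).mul hint)
      obtain ⟨k, hk⟩ := mem_codifferent.mp (hγ (q m')) y
      refine ⟨k, ?_⟩
      rw [← hk, hy]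
      congr 1
      ring
    choose! k hk using hothers
    obtain ⟨k0, hk0⟩ := hTr i (r * c m)
    refine ⟨k0 - ∑ p ∈ T.erase (q m), k p, ?_⟩
    have hsum : ((r * c m : 𝓞 F) : F) * Q.form (∑ p ∈ T, γ p • u p i) m =
        ((r : F) : K) * (γ (q m) * Q.form (((c m : F) : K) • m) (u (q m) i)) +
        ∑ p ∈ T.erase (q m), ((r : F) : K) *
          (γ p * Q.form (u p i) (((c m : F) : K) • m)) := by
      rw [hform, ← Finset.add_sum_erase _ _ hqT, Q.symm _ (u (q m) i), mul_add, Finset.mul_sum]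
      simp only [map_mul, IntermediateField.coe_mul, map_smul, smul_eq_mul]
      congr 1
      · ring
      · exact Finset.sum_congr rfl fun p _ => by ring
    rw [hsum, map_add, map_sum, Finset.sum_congr rfl fun p hp => hk p hp] at hk0
    push_cast
    rw [← hk0]
    ring

end SmallTorsion

end KLattice

/-- A union bound: fewer than `T` conditions, each excluding at most one point on every line in its
own direction, do not cover the box of side `T`. -/
lemma exists_forall_not_of_lines {ι : Type} [Fintype ι] [DecidableEq ι] {T : ℕ}
    (hT : Fintype.card ι < T) (bad : ι → (ι → Fin T) → Prop)
    (h : ∀ j t s s', bad j (Function.update t j s) → bad j (Function.update t j s') → s = s') :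
    ∃ t, ∀ j, ¬ bad j t := by
  by_contra! hcon
  choose j hj using hcon
  have hinj : Function.Injective fun p : (ι → Fin T) × Fin T =>
      (j p.1, Function.update p.1 (j p.1) p.2) := by
    rintro ⟨t, s⟩ ⟨t', s'⟩ hp
    obtain ⟨h1, h2⟩ := Prod.mk.inj hp
    simp only at h1 h2
    rw [← h1] at h2
    have hs : s = s' := by simpa using congrFun h2 (j t)
    have ht : t' = Function.update t (j t) (t' (j t)) := by
      funext i
      by_cases hi : i = j t
      · subst hi; simp
      · have := congrFun h2 i
        simp only [Function.update_of_ne hi] at this ⊢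
        exact this.symm
    have hb : bad (j t) (Function.update t (j t) (t (j t))) := by simpa using hj t
    have hb' : bad (j t) (Function.update t (j t) (t' (j t))) := by
      rw [← ht, h1]
      exact hj t'
    have h3 := h _ _ _ _ hb hb'
    rw [← h3, Function.update_eq_self] at ht
    rw [ht, hs]
  have hcard := Fintype.card_le_of_injective _ hinj
  rw [Fintype.card_prod, Fintype.card_prod, Fintype.card_fin, mul_comm] at hcard
  have hpos : 0 < Fintype.card (ι → Fin T) := by
    rw [Fintype.card_fun, Fintype.card_fin]
    exact pow_pos (by omega) _
  exact absurd (Nat.le_of_mul_le_mul_right hcard hpos) (by omega)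

namespace KLattice

section LargeOrder

variable {K V : Type} [Field K] [NumberField K] [AddCommGroup V] [Module K V] [Module (𝓞 K) V]
  [IsScalarTower (𝓞 K) K V]

lemma IsFull.exists_nat_smul_mem {Q : KLattice K V} (hQ : Q.IsFull) (y : V) :
    ∃ N : ℕ, 0 < N ∧ (N : K) • y ∈ Q.carrier := by
  obtain ⟨c, hc, hcy⟩ := hQ y
  have hspan : Ideal.span {c} ≠ ⊥ := by simpa using hc
  refine ⟨Ideal.absNorm (Ideal.span {c}), Nat.pos_of_ne_zero ?_, ?_⟩
  · rwa [Ne, Ideal.absNorm_eq_zero_iff]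
  · obtain ⟨e, he⟩ := Ideal.mem_span_singleton.mp (Ideal.absNorm_mem (Ideal.span {c}))
    have h := Q.carrier.smul_mem e hcy
    rw [smul_smul, mul_comm, ← he, smul_eq] at h
    simpa using h

/-- A vector of large order modulo the lattice is moved uniformly by some integral functional. -/
lemma exists_large_functional (hK : TotallyReal K) [Module.Finite K V] {Q : KLattice K V}
    (hQ : Q.IsFull) {T : ℕ} {y : V}
    (hy : ∀ b : ℕ, 0 < b → b ≤ T → (b : K) • y ∉ Q.carrier) :
    ∃ w : V, (∀ x ∈ Q.carrier, Q.form w x ∈ codifferent K) ∧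
      ∀ s : ℕ, 0 < s → s < T → ∀ k : ℤ,
        1 / (2 * T : ℚ) ≤ |s * Algebra.trace ℚ K (Q.form w y) - k| := by
  classical
  have hex := hQ.exists_nat_smul_mem y
  set N := Nat.find hex with hN
  obtain ⟨hN0, hNy⟩ := Nat.find_spec hex
  rw [← hN] at hN0 hNy
  have hTN : T < N := by
    by_contra! h
    exact hy N hN0 h hNy
  let z : Q.carrier := ⟨(N : K) • y, hNy⟩
  let b := Module.Free.chooseBasis ℤ Q.carrier
  let I : Ideal ℤ := LinearMap.range (LinearMap.applyₗ z : (Q.carrier →ₗ[ℤ] ℤ) →ₗ[ℤ] ℤ) ⊔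
    Ideal.span {(N : ℤ)}
  have hI : (1 : ℤ) ∈ I := by
    obtain ⟨g, hg⟩ := IsPrincipalIdealRing.principal I
    have hdvd : ∀ t ∈ I, g ∣ t := fun t ht => by
      rw [hg] at ht
      exact Ideal.mem_span_singleton.mp ht
    obtain ⟨N', hN'⟩ := hdvd N (Submodule.mem_sup_right (Ideal.mem_span_singleton_self _))
    have hzi : ∀ i, ∃ e : ℤ, b.repr z i = g * e := fun i =>
      hdvd _ (Submodule.mem_sup_left ⟨b.coord i, rfl⟩)
    choose e he using hzi
    have hz : z = g • ∑ i, e i • b i := by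
      rw [Finset.smul_sum, ← b.sum_repr z]
      exact Finset.sum_congr rfl fun i _ => by rw [he, mul_smul]
    have hg0 : g ≠ 0 := by
      rintro rfl
      simp at hN'
      omega
    have hmem : (N' : K) • y ∈ Q.carrier := by
      have h1 : (N : K) • y = (g : ℤ) • ((∑ i, e i • b i : Q.carrier) : V) :=
        congrArg Subtype.val hz
      have h2 : (N' : K) • y = ((∑ i, e i • b i : Q.carrier) : V) := by
        have hgK : (g : K) ≠ 0 := by exact_mod_cast hg0
        refine smul_right_injective V hgK ?_
        simp only
        rw [smul_smul, Int.cast_smul_eq_zsmul, ← h1]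
        congr 1
        exact_mod_cast hN'.symm
      rw [h2]
      exact Subtype.mem _
    have hmem' : ((N'.natAbs : ℕ) : K) • y ∈ Q.carrier := by
      rcases Int.natAbs_eq N' with h | h
      · have h3 : ((N'.natAbs : ℕ) : K) = (N' : K) := by
          conv_rhs => rw [h]
          simp
        rwa [h3]
      · have h3 : ((N'.natAbs : ℕ) : K) = -(N' : K) := by
          conv_rhs => rw [h]
          simp
        rw [h3, neg_smul]
        exact Q.carrier.neg_mem hmem
    have hN'0 : 0 < N'.natAbs := Int.natAbs_pos.mpr fun h => by
      rw [h, mul_zero] at hN'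
      omega
    have hle : N ≤ N'.natAbs := Nat.find_min' hex ⟨hN'0, hmem'⟩
    have habs : N = g.natAbs * N'.natAbs := by
      rw [← Int.natAbs_mul, ← hN', Int.natAbs_natCast]
    have hg1 : g.natAbs = 1 := by
      have : 0 < g.natAbs := Int.natAbs_pos.mpr hg0
      nlinarith
    rw [hg]
    exact Ideal.mem_span_singleton.mpr (Int.isUnit_iff_natAbs_eq.mpr hg1).dvd
  obtain ⟨_, ⟨ψ, rfl⟩, l, hl, hψl⟩ := Submodule.mem_sup.mp hI
  obtain ⟨l, rfl⟩ := Ideal.mem_span_singleton.mp hl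
  obtain ⟨w, -, hw⟩ := exists_dual_vector hK Q ψ
  have hTr : (N : ℚ) * Algebra.trace ℚ K (Q.form w y) = 1 - N * l := by
    have h1 : Algebra.trace ℚ K (Q.form w z) = ψ z := hw z
    have h2 : Q.form w z = (N : ℚ) • Q.form w y := by
      rw [show (z : V) = (N : K) • y from rfl, map_smul, smul_eq_mul,
        Algebra.smul_def, map_natCast]
    rw [h2, map_smul, smul_eq_mul] at h1
    rw [h1]
    have h3 : (ψ z + N * l : ℤ) = 1 := hψl
    have h4 : ((ψ z + N * l : ℤ) : ℚ) = 1 := by exact_mod_cast h3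
    push_cast at h4
    linarith
  refine ⟨((N / T : ℕ) : K) • w, fun x hx => ?_, fun s hs hsT k => ?_⟩
  · refine form_mem_codifferent Q (y := ((N / T : ℕ) : K) • w) (fun v => ?_) ⟨x, hx⟩
    refine ⟨((N / T : ℕ) : ℤ) * ψ v, ?_⟩
    rw [map_smul, LinearMap.smul_apply, Nat.cast_smul_eq_nsmul, map_nsmul, hw,
      nsmul_eq_mul, Int.cast_mul, Int.cast_natCast]
  · set M := N / T with hM
    have hT0 : 0 < T := by omega
    have hM1 : M * T ≤ N := Nat.div_mul_le_self N T
    have hM2 : N < (M + 1) * T := by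
      rw [mul_comm]
      exact Nat.lt_mul_div_succ N hT0
    have hM0 : 0 < M := Nat.div_pos hTN.le hT0
    have hval : s * Algebra.trace ℚ K (Q.form ((M : K) • w) y) - k =
        ((s * M - N * (s * M * l + k) : ℤ) : ℚ) / N := by
      rw [map_smul, LinearMap.smul_apply, Nat.cast_smul_eq_nsmul, map_nsmul, nsmul_eq_mul,
        eq_div_iff (by exact_mod_cast hN0.ne')]
      push_cast
      linear_combination (s * M : ℚ) * hTr
    have hkey : (N : ℤ) ≤ |s * M - N * (s * M * l + k)| * (2 * T) := by
      set e : ℤ := s * M * l + k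
      have hM1' : (M : ℤ) * T ≤ N := by exact_mod_cast hM1
      have hM2' : (N : ℤ) < (M + 1) * T := by exact_mod_cast hM2
      have hM0' : (1 : ℤ) ≤ M := by exact_mod_cast hM0
      have hs' : (1 : ℤ) ≤ s := by exact_mod_cast hs
      have hsT' : (s : ℤ) + 1 ≤ T := by exact_mod_cast hsT
      have hN0' : (0 : ℤ) < N := by exact_mod_cast hN0
      have hT0' : (0 : ℤ) < T := by exact_mod_cast hT0
      rcases le_or_gt e 0 with he | he
      · have h1 : (M : ℤ) ≤ s * M - N * e := by nlinarith
        have h2 := h1.trans (le_abs_self _)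
        nlinarith
      · have h1 : (N : ℤ) - (T - 1) * M ≤ -(s * M - N * e) := by nlinarith
        have h2 := h1.trans (neg_le_abs _)
        have h3 : ((N : ℤ) - (T - 1) * M) * T ≥ N := by nlinarith
        nlinarith
    rw [hval, abs_div, Nat.abs_cast, div_le_div_iff₀ (by positivity) (by positivity), one_mul,
      ← Int.cast_abs]
    exact_mod_cast hkey

/-- A dual vector which is torsion modulo the lattice but outside it keeps large order after
multiplication by the torsion bound. -/
lemma IsMax.smul_notMem {Q : KLattice K V} (hQ : Q.IsMax) {m : V} (hm : m ∈ Q.dual) {T : ℕ}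
    (ham : ((T.factorial : ℕ) : K) • m ∉ Q.carrier) (b : ℕ) (hb : 0 < b) (hbT : b ≤ T) :
    (b : K) • ((T.factorial : ℕ) : K) • m ∉ Q.carrier := fun h => by
  have hnat : ∀ (c : ℕ) (x : V), (c : K) • x = (c : 𝓞 K) • x := fun c x => by
    rw [smul_eq]
    simp
  obtain ⟨e, he⟩ := Nat.dvd_factorial hb hbT
  have h1 : ((T.factorial : ℕ) : K) • ((T.factorial : ℕ) : K) • m ∈ Q.carrier := by
    have h2 := Q.carrier.smul_mem (e : 𝓞 K) h
    rw [← hnat, smul_smul (e : K), ← Nat.cast_mul, mul_comm, ← he] at h2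
    exact h2
  refine ham (hQ _ ?_ ?_)
  · rw [hnat]
    exact Q.dual.smul_mem _ hm
  · have h3 := hm _ h1
    rwa [map_smul, ← LinearMap.smul_apply, ← map_smul] at h3

lemma ball_card_le [Module.Finite K V] {Q : KLattice K V}
    (hQ : Q.IsTight) :
    ∃ S : Finset V, (∀ m, m ∈ S ↔ m ∈ Q.dual ∧ ∀ σ : K →+* ℝ, σ (Q.form m m) ≤ 2) ∧
      S.card ≤ 3 ^ (Module.finrank ℚ K * (Module.finrank ℚ K * Module.finrank K V)) := by
  classical
  let B : Set V := {m | m ∈ Q.dual ∧ ∀ σ : K →+* ℝ, σ (Q.form m m) ≤ 2}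
  let b := Module.finBasis ℤ Q.carrier
  let o := Module.finBasis ℤ (𝓞 K)
  have hint : ∀ (m : B) i, ∃ c : 𝓞 K, (c : K) = Q.form m (b i) := fun m i =>
    isIntegral_iff_exists.mp (m.2.1 _ (b i).2)
  choose c hc using hint
  let f : B → (Fin (Module.finrank ℤ (𝓞 K)) × Fin (Module.finrank ℤ Q.carrier) → ZMod 3) :=
    fun m p => ((o.repr (c m p.2) p.1 : ℤ) : ZMod 3)
  have hf : Function.Injective f := fun m m' h => by
    have hdvd : ∀ i, ∃ e : 𝓞 K, c m i - c m' i = 3 * e := fun i => by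
      have h1 : ∀ j, ∃ e : ℤ, o.repr (c m i) j - o.repr (c m' i) j = 3 * e := fun j => by
        have h2 := congrFun h (j, i)
        simp only [f] at h2
        rw [← sub_eq_zero, ← Int.cast_sub, ZMod.intCast_zmod_eq_zero_iff_dvd] at h2
        exact h2
      choose e he using h1
      refine ⟨∑ j, e j • o j, o.repr.injective (Finsupp.ext fun j => ?_)⟩
      have h3 : (3 : 𝓞 K) * ∑ j, e j • o j = (3 : ℤ) • ∑ j, e j • o j := by
        rw [zsmul_eq_mul]
        norm_num
      rw [h3, map_sub, Finsupp.sub_apply, he, map_smul, Finsupp.smul_apply, o.repr_sum_self,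
        smul_eq_mul]
    choose e he using hdvd
    have h3 : (3 : K) ≠ 0 := by norm_num
    have hmem : (3 : K)⁻¹ • (m.1 - m'.1) ∈ Q.dual := fun x hx => by
      have hspan : (⟨x, hx⟩ : Q.carrier) ∈ Submodule.span ℤ (Set.range b) := by
        rw [b.span_eq]
        trivial
      have key : ∀ y : Q.carrier, y ∈ Submodule.span ℤ (Set.range b) →
          IsIntegral ℤ (Q.form ((3 : K)⁻¹ • (m.1 - m'.1)) y) := fun y hy => by
        induction hy using Submodule.span_induction with
        | mem y hy =>
          obtain ⟨i, rfl⟩ := hy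
          have h4 : Q.form ((3 : K)⁻¹ • (m.1 - m'.1)) (b i) = e i := by
            have h5 : ((c m i : 𝓞 K) : K) - c m' i = 3 * e i :=
              (congrArg (fun t : 𝓞 K => (t : K)) (he i)).trans
                ((map_mul (algebraMap (𝓞 K) K) 3 (e i)).trans (by rw [map_ofNat]))
            rw [hc, hc] at h5
            rw [map_smul, LinearMap.smul_apply, map_sub, LinearMap.sub_apply, h5, smul_eq_mul]
            simp
          rw [h4]
          exact (e i).isIntegral_coe
        | zero => simpa using isIntegral_zero
        | add y z _ _ hy hz =>
          rw [Submodule.coe_add, map_add]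
          exact hy.add hz
        | smul a y _ hy =>
          have h6 : ((a • y : Q.carrier) : V) = a • (y : V) := rfl
          rw [h6, map_zsmul]
          exact hy.smul a
      exact key _ hspan
    have hzero := hQ _ hmem fun σ => by
      have h4 := Q.form_self_nonneg (m.1 + m'.1) σ
      have h5 := m.2.2 σ
      have h6 := m'.2.2 σ
      simp only [map_add, map_sub, map_smul, LinearMap.add_apply, LinearMap.sub_apply,
        LinearMap.smul_apply, smul_eq_mul, map_mul, map_inv₀, map_ofNat, Q.symm m'.1 m.1] at h4 ⊢
      linarith
    rw [smul_eq_zero, or_iff_right (inv_ne_zero h3), sub_eq_zero] at hzero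
    exact Subtype.ext hzero
  have hBfin : Finite B := Finite.of_injective f hf
  refine ⟨(Set.toFinite B).toFinset, fun m => by simp [B], ?_⟩
  have h1 := Nat.card_le_card_of_injective f hf
  rw [Nat.card_eq_fintype_card (α := _ → ZMod 3), Fintype.card_fun, Fintype.card_prod,
    Fintype.card_fin, Fintype.card_fin, ZMod.card] at h1
  rw [← Set.ncard_eq_toFinset_card B]
  refine h1.trans (Nat.pow_le_pow_right (by norm_num) ?_)
  rw [RingOfIntegers.rank]
  exact Nat.mul_le_mul_left _ Q.finrank_int_le

end LargeOrder

end KLattice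

/-- A family of vectors whose combinations can be made to avoid the integers uniformly on a small
set of vectors. -/
lemma exists_combination_avoiding {ι : Type} [Fintype ι] [DecidableEq ι] {T : ℕ}
    (hT : Fintype.card ι < T) (φ : ι → ℝ) (θ : ι → ι → ℝ)
    (hθ : ∀ j, ∀ s : ℕ, 0 < s → s < T → ∀ k : ℤ, 1 / (2 * T : ℝ) ≤ |s * θ j j - k|) :
    ∃ t : ι → ℕ, ∀ j, ∀ k : ℤ, 1 / (4 * T : ℝ) ≤ |φ j + ∑ i, t i * θ i j - k| := by
  have hT0 : (0 : ℝ) < T := by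
    have : 0 < T := by omega
    exact_mod_cast this
  suffices h : ∃ t : ι → Fin T, ∀ j,
      ¬ ∃ k : ℤ, |φ j + ∑ i, ((t i : ℕ) : ℝ) * θ i j - k| < 1 / (4 * T : ℝ) by
    obtain ⟨t, ht⟩ := h
    push Not at ht
    exact ⟨fun i => t i, ht⟩
  refine exists_forall_not_of_lines hT
    (fun j t => ∃ k : ℤ, |φ j + ∑ i, ((t i : ℕ) : ℝ) * θ i j - k| < 1 / (4 * T : ℝ)) ?_
  rintro j t s s' ⟨k, hk⟩ ⟨k', hk'⟩
  have hsum : ∀ s : Fin T, ∑ i, ((Function.update t j s i : ℕ) : ℝ) * θ i j =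
      s * θ j j + ∑ i ∈ Finset.univ.erase j, ((t i : ℕ) : ℝ) * θ i j := fun s => by
    rw [← Finset.add_sum_erase _ _ (Finset.mem_univ j), Function.update_self]
    congr 1
    refine Finset.sum_congr rfl fun i hi => ?_
    rw [Function.update_of_ne (Finset.ne_of_mem_erase hi)]
  rw [hsum] at hk hk'
  have hadd : 1 / (4 * T : ℝ) + 1 / (4 * T : ℝ) = 1 / (2 * T : ℝ) := by
    field_simp
    norm_num
  have hlt : ∀ (s s' : Fin T) (k k' : ℤ),
      |φ j + (s * θ j j + ∑ i ∈ Finset.univ.erase j, ((t i : ℕ) : ℝ) * θ i j) - k| <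
        1 / (4 * T : ℝ) →
      |φ j + (s' * θ j j + ∑ i ∈ Finset.univ.erase j, ((t i : ℕ) : ℝ) * θ i j) - k'| <
        1 / (4 * T : ℝ) → ¬ s < s' := fun s s' k k' hk hk' hss => by
    have h1 := hθ j (s' - s : ℕ) (Nat.sub_pos_of_lt hss)
      (lt_of_le_of_lt (Nat.sub_le _ _) s'.2) (k' - k)
    rw [Nat.cast_sub (le_of_lt hss)] at h1
    push_cast at h1
    have h2 := abs_sub_lt_iff.mp hk
    rw [abs_lt] at hk hk'
    refine absurd h1 (not_le.mpr (abs_lt.mpr ⟨?_, ?_⟩)) <;> rw [← hadd] <;> linarith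
  rcases lt_trichotomy s s' with h | h | h
  · exact absurd h (hlt s s' k k' hk hk')
  · exact h
  · exact absurd h (hlt s' s k' k hk' hk)

namespace KLattice

theorem exists_selection (d n : ℕ) (Y₀ : ℝ) (hY₀ : 1 ≤ Y₀) :
    ∃ ε > (0 : ℝ), ∃ Y : ℝ, ∀ (K V : Type) [Field K] [NumberField K] [AddCommGroup V] [Module K V]
      [Module (𝓞 K) V] [IsScalarTower (𝓞 K) K V] [Module.Finite K V] (F : IntermediateField ℚ K),
      TotallyReal K → Module.finrank ℚ K = d → Module.finrank K V ≤ n →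
      (∀ x : 𝓞 K, (∀ σ : K →+* ℝ, |σ x| ≤ Y) → (x : K) ∈ F) →
      (∃ s : Set (𝓞 F), Submodule.span ℤ s = ⊤ ∧
        ∀ c ∈ s, ∀ σ : K →+* ℝ, |σ ((c : F) : K)| ≤ Y₀) →
      ∀ Q : KLattice K V, Q.IsFull → Q.IsMax → Q.IsTight →
      ∃ w : Fin 2 → V, (∀ i, ∀ x ∈ Q.carrier, Q.form (w i) x ∈ codifferent K) ∧
        ∀ m ∈ Q.dual, (∀ σ : K →+* ℝ, σ (Q.form m m) ≤ 2) →
          (∀ i, ∀ c : 𝓞 K, (∀ σ : K →+* ℝ, |σ c| ≤ Y₀) →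
            ∃ k : ℤ, |((Algebra.trace ℚ K (c * Q.form (w i) m) : ℚ) : ℝ) - k| < ε) →
          m ∈ Q.carrier := by
  set T : ℕ := 3 ^ (d * (d * n)) + 1 with hT
  set a : ℕ := T.factorial with ha
  have ha0 : a ≠ 0 := Nat.factorial_ne_zero T
  have ha0' : (0 : ℝ) < a := by exact_mod_cast Nat.pos_of_ne_zero ha0
  refine ⟨1 / (4 * a), by positivity, a * 2, ?_⟩
  intro K V _ _ _ _ _ _ _ F hK hd hn hF hspan Q hQ hmax htight
  classical
  obtain ⟨S, hS, hScard⟩ := ball_card_le htight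
  have hST : S.card < T := by
    rw [hT, Nat.lt_succ_iff, ← hd]
    refine hScard.trans (Nat.pow_le_pow_right (by norm_num) ?_)
    exact Nat.mul_le_mul_left _ (Nat.mul_le_mul_left _ hn)
  have haK : (a : K) ≠ 0 := by exact_mod_cast ha0
  let S₁ := S.filter fun m => (a : K) • m ∈ Q.carrier
  let S₂ := S.filter fun m => (a : K) • m ∉ Q.carrier
  have hS₁ : ∀ m ∈ S₁, m ∈ S ∧ (a : K) • m ∈ Q.carrier := fun m hm => Finset.mem_filter.mp hm
  have hS₂ : ∀ m ∈ S₂, m ∈ S ∧ (a : K) • m ∉ Q.carrier := fun m hm => Finset.mem_filter.mp hm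
  obtain ⟨u, hu, hudet⟩ := exists_small_selection (F := F) Q hmax ha0 S₁
    (fun m hm => ((hS m).mp (hS₁ m hm).1).1) (fun m hm => (hS₁ m hm).2) fun m hm m' hm' => by
      obtain ⟨hmS, ham⟩ := hS₁ m hm
      have hm'S := (hS₁ m' hm').1
      obtain ⟨c, hc⟩ := isIntegral_iff_exists.mp (((hS m').mp hm'S).1 _ ham)
      rw [Q.symm, map_smul, LinearMap.smul_apply, smul_eq_mul] at hc
      have hcF : (c : K) ∈ F := hF c fun σ => by
        rw [hc, map_mul, map_natCast, abs_mul, Nat.abs_cast]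
        refine mul_le_mul_of_nonneg_left (abs_le_of_sq_le_sq ?_ (by norm_num)) ha0'.le
        have h1 := Q.sq_form_le m m' σ
        have h2 := ((hS m).mp hmS).2 σ
        have h3 := ((hS m').mp hm'S).2 σ
        have h4 := Q.form_self_nonneg m σ
        have h5 := Q.form_self_nonneg m' σ
        nlinarith
      rw [hc] at hcF
      have := F.mul_mem (F.inv_mem (F.algebraMap_mem (a : ℚ))) hcF
      rwa [map_natCast, inv_mul_cancel_left₀ haK] at this
  have hlarge : ∀ m : S₂, ∃ w : V, (∀ x ∈ Q.carrier, Q.form w x ∈ codifferent K) ∧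
      ∀ s : ℕ, 0 < s → s < T → ∀ k : ℤ,
        1 / (2 * T : ℚ) ≤ |s * Algebra.trace ℚ K (Q.form w ((a : K) • m.1)) - k| := fun m =>
    exists_large_functional hK hQ
      (hmax.smul_notMem ((hS m).mp (hS₂ m.1 m.2).1).1 (hS₂ m.1 m.2).2)
  choose W hW hWT using hlarge
  obtain ⟨t, ht⟩ := exists_combination_avoiding (ι := S₂) (T := T)
    (by rw [Fintype.card_coe]; exact (Finset.card_filter_le _ _).trans_lt hST)
    (fun m => ((Algebra.trace ℚ K (Q.form (u 0) m) : ℚ) : ℝ))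
    (fun i m => ((Algebra.trace ℚ K (Q.form (W i) ((a : K) • m.1)) : ℚ) : ℝ))
    fun j s hs hsT k => by
      have h := (Rat.cast_le (K := ℝ)).mpr (hWT j s hs hsT k)
      push_cast at h
      exact h
  let W' : V := ∑ i, (t i : K) • W i
  have hW' : ∀ x ∈ Q.carrier, Q.form W' x ∈ codifferent K := fun x hx => by
    have h1 : Q.form W' x = ∑ i, t i • Q.form (W i) x := by
      simp [W', LinearMap.sum_apply]
    rw [h1]
    exact Submodule.sum_mem _ fun i _ => Submodule.smul_of_tower_mem _ (t i) (hW i x hx)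
  refine ⟨fun i => u i + (a : K) • W', fun i x hx => ?_, fun m hm hm2 hdet => ?_⟩
  · rw [map_add, LinearMap.add_apply, map_smul, LinearMap.smul_apply, Nat.cast_smul_eq_nsmul]
    exact Submodule.add_mem _ (hu i x hx) (Submodule.smul_of_tower_mem _ a (hW' x hx))
  · have hmS : m ∈ S := (hS m).mpr ⟨hm, hm2⟩
    by_cases ham : (a : K) • m ∈ Q.carrier
    · refine hudet m (Finset.mem_filter.mpr ⟨hmS, ham⟩) fun i c => ?_
      obtain ⟨s, hs, hsY⟩ := hspan
      have hcs : c ∈ Submodule.span ℤ s := hs ▸ Submodule.mem_top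
      induction hcs using Submodule.span_induction with
      | mem c hc =>
        obtain ⟨y, hy⟩ := isIntegral_iff_exists.mp (isIntegral_coe_coe (K := K) c)
        obtain ⟨k, hk⟩ := hdet i y fun σ => by
          rw [hy]
          exact hsY c hc σ
        rw [← hy]
        obtain ⟨l, hl⟩ := mem_codifferent.mp (hu i _ ham) y
        obtain ⟨l', hl'⟩ := mem_codifferent.mp (hW' _ ham) y
        have hsplit : Algebra.trace ℚ K (y * Q.form (u i + (a : K) • W') m) =
            Algebra.trace ℚ K (y * Q.form (u i) m) + l' := by
          rw [← hl', ← map_add]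
          congr 1
          simp only [map_add, LinearMap.add_apply, map_smul, LinearMap.smul_apply, smul_eq_mul]
          ring
        have hl2 : a * Algebra.trace ℚ K (y * Q.form (u i) m) = l := by
          rw [← hl, ← nsmul_eq_mul, ← map_nsmul]
          congr 1
          rw [nsmul_eq_mul, map_smul, smul_eq_mul]
          ring
        refine ⟨k - l', ?_⟩
        rw [hsplit] at hk
        set τ := Algebra.trace ℚ K (y * Q.form (u i) m)
        have h1 : |((l + a * l' - a * k : ℤ) : ℝ)| < 1 := by
          have h2 : ((l + a * l' - a * k : ℤ) : ℝ) = a * (((τ + l' : ℚ) : ℝ) - k) := by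
            have h3 : (l : ℝ) = a * (τ : ℝ) := by exact_mod_cast hl2.symm
            push_cast
            rw [h3]
            ring
          rw [h2, abs_mul, Nat.abs_cast]
          calc (a : ℝ) * _ < a * (1 / (4 * a)) := mul_lt_mul_of_pos_left hk ha0'
            _ = 1 / 4 := by field_simp
            _ < 1 := by norm_num
        have h4 : l + a * l' - a * k = 0 := by
          rw [← Int.cast_abs] at h1
          exact Int.abs_lt_one_iff.mp (by exact_mod_cast h1)
        have h5 : (l : ℚ) + a * l' - a * k = 0 := by exact_mod_cast h4
        have haQ : (a : ℚ) ≠ 0 := by exact_mod_cast ha0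
        refine mul_left_cancel₀ haQ ?_
        rw [hl2]
        push_cast
        linarith
      | zero => exact ⟨0, by simp⟩
      | add c c' _ _ hc hc' =>
        obtain ⟨k, hk⟩ := hc
        obtain ⟨k', hk'⟩ := hc'
        refine ⟨k + k', ?_⟩
        rw [Int.cast_add, ← hk, ← hk', ← map_add]
        simp [add_mul]
      | smul b c _ hc =>
        obtain ⟨k, hk⟩ := hc
        refine ⟨b * k, ?_⟩
        rw [Int.cast_mul, ← hk, ← zsmul_eq_mul, ← map_zsmul]
        congr 1
        simp [mul_assoc]
    · exfalso
      have hmS₂ : m ∈ S₂ := Finset.mem_filter.mpr ⟨hmS, ham⟩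
      obtain ⟨k, hk⟩ := hdet 0 1 fun σ => by simpa using hY₀
      have h1 := ht ⟨m, hmS₂⟩ k
      have h2 : Algebra.trace ℚ K (((1 : 𝓞 K) : K) * Q.form (u 0 + (a : K) • W') m) =
          Algebra.trace ℚ K (Q.form (u 0) m) +
            ∑ i, t i * Algebra.trace ℚ K (Q.form (W i) ((a : K) • m)) := by
        have h3 : ((1 : 𝓞 K) : K) * Q.form (u 0 + (a : K) • W') m =
            Q.form (u 0) m + ∑ i, t i • Q.form (W i) ((a : K) • m) := by
          simp [W', LinearMap.sum_apply, Finset.mul_sum, mul_left_comm]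
        rw [h3, map_add, map_sum]
        exact congrArg _ (Finset.sum_congr rfl fun i _ => by rw [map_nsmul, nsmul_eq_mul])
      rw [h2] at hk
      push_cast at hk
      have h4 : 1 / (4 * a : ℝ) ≤ 1 / (4 * T : ℝ) := by
        have h5 : (T : ℝ) ≤ a := by exact_mod_cast Nat.self_le_factorial T
        have h6 : (0 : ℝ) < T := by
          rw [hT]
          positivity
        gcongr
      exact absurd (h1.trans_lt (hk.trans_le h4)) (lt_irrefl _)

end KLattice

section Detection

variable {K : Type} [Field K] [NumberField K]

lemma TotallyReal.eq_zero_of_trace_eq_zero (hK : TotallyReal K) {z : K}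
    (h : ∀ c : 𝓞 K, Algebra.trace ℚ K (c * z) = 0) : z = 0 := by
  obtain ⟨a, b, hb, rfl⟩ := IsFractionRing.div_surjective (A := 𝓞 K) z
  have hb0 : (b : K) ≠ 0 := by
    simpa using nonZeroDivisors.ne_zero hb
  have h1 := h (a * b)
  have h2 : ((a * b : 𝓞 K) : K) * ((a : K) / (b : K)) = (a : K) ^ 2 := by
    rw [show ((a * b : 𝓞 K) : K) = a * b from map_mul (algebraMap (𝓞 K) K) a b]
    field_simp
  rw [h2] at h1
  have h3 := hK.trace_eq ((a : K) ^ 2)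
  rw [h1, Rat.cast_zero] at h3
  obtain ⟨σ⟩ := hK.nonempty_emb
  have h4 := (Finset.sum_eq_zero_iff_of_nonneg
    (fun σ _ => by rw [map_pow]; positivity)).mp h3.symm σ (Finset.mem_univ _)
  rw [map_pow, pow_eq_zero_iff two_ne_zero, map_eq_zero] at h4
  change (a : K) / (b : K) = 0
  rw [h4, zero_div]

/-- A vector of a lattice `L` representing `M` induces a vector of the space of `M`. -/
lemma KLattice.exists_dual_of_represents (hK : TotallyReal K) {W : Type} [AddCommGroup W]
    [Module K W] [Module (𝓞 K) W] [IsScalarTower (𝓞 K) K W] (M : KLattice K W)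
    (L : OKLattice K) (φ : M.carrier →ₗ[𝓞 K] L.carrier)
    (hφ : ∀ x : M.carrier, ((L.form (φ x) (φ x) : 𝓞 K) : K) = M.form x x) (e : L.carrier) :
    ∃ μ : W, (∀ v : M.carrier, M.form μ v = (L.form (φ v) e : 𝓞 K)) ∧
      ∀ σ : K →+* ℝ, σ (M.form μ μ) ≤ σ (L.form e e : 𝓞 K) := by
  let f : M.carrier →ₗ[𝓞 K] 𝓞 K := (L.form.flip e) ∘ₗ φ
  have hf : ∀ v, f v = L.form (φ v) e := fun v => rfl
  obtain ⟨μ, ⟨N, hN, hNμ⟩, hμ⟩ := M.exists_dual_vector hK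
    ((Algebra.trace ℤ (𝓞 K)) ∘ₗ (f.restrictScalars ℤ))
  have hμ' : ∀ v : M.carrier, M.form μ v = (f v : 𝓞 K) := by
    intro v
    rw [← sub_eq_zero]
    refine hK.eq_zero_of_trace_eq_zero fun c => ?_
    have h1 := hμ (c • v)
    have h2 : M.form μ ((c • v : M.carrier) : W) = (c : K) * M.form μ v :=
      M.form_smul_right c μ v
    have h3 : ((((Algebra.trace ℤ (𝓞 K)) ∘ₗ (f.restrictScalars ℤ)) (c • v) : ℤ) : ℚ) =
        Algebra.trace ℚ K ((c : K) * (f v : 𝓞 K)) := by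
      rw [← map_mul (algebraMap (𝓞 K) K)]
      refine Eq.trans ?_ (Algebra.coe_trace_int (K := K) (c * f v))
      rw [← smul_eq_mul, ← map_smul f]
      rfl
    rw [h2, h3] at h1
    rw [mul_sub, map_sub, h1, sub_self]
  refine ⟨μ, hμ', fun σ => ?_⟩
  have hN' : (0 : ℝ) < (N : ℝ) ^ 2 := by positivity
  set v : M.carrier := ⟨N • μ, hNμ⟩ with hv
  have h1 : M.form μ v = (N : K) * M.form μ μ := by
    change M.form μ (N • μ) = _
    rw [map_zsmul, zsmul_eq_mul]
  have h2 : M.form v v = (N : K) ^ 2 * M.form μ μ := by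
    change M.form (N • μ) (N • μ) = _
    rw [map_zsmul, LinearMap.map_smul_of_tower, LinearMap.smul_apply, zsmul_eq_mul, zsmul_eq_mul]
    ring
  have h3 := L.sq_form_le (φ v) e σ
  have h4 := hμ' v
  rw [hf] at h4
  rw [← h4, h1, hφ v, h2] at h3
  simp only [map_mul, map_pow, map_intCast] at h3
  rcases (M.form_self_nonneg μ σ).eq_or_lt with h0 | h0
  · rw [← h0]
    exact L.form_self_nonneg e σ
  · have h5 : ((N : ℝ) ^ 2 * σ (M.form μ μ)) * σ (M.form μ μ) ≤
        ((N : ℝ) ^ 2 * σ (M.form μ μ)) * σ (L.form e e : 𝓞 K) := by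
      linarith
    exact le_of_mul_le_mul_left h5 (by positivity)

end Detection

section Augmentation

variable {K : Type} [Field K] [NumberField K]

lemma exists_small_binary_form {ε : ℚ} (hε : 0 < ε) (happ : ∀ x : K, ∃ z : K,
      (∀ g ∈ differentIdeal ℤ (𝓞 K), ∀ g' ∈ differentIdeal ℤ (𝓞 K),
        IsIntegral ℤ ((g : K) * g' * z)) ∧ ∀ σ : K →+* ℝ, |σ (x - z)| < ε)
    (q : Fin 2 → Fin 2 → K) (hq : ∀ i j, q i j = q j i) :
    ∃ S : (Fin 2 → K) →ₗ[K] (Fin 2 → K) →ₗ[K] K, (∀ x y, S x y = S y x) ∧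
      (∀ x, x ≠ 0 → ∀ σ : K →+* ℝ, 0 < σ (S x x)) ∧
      (∀ i, ∀ σ : K →+* ℝ, σ (S (Pi.single i 1) (Pi.single i 1)) ≤ 4 * ε) ∧
      ∀ g : Fin 2 → K, (∀ i, g i ∈ (differentLattice K).carrier) →
        ∀ h : Fin 2 → K, (∀ i, h i ∈ (differentLattice K).carrier) →
        IsIntegral ℤ (∑ i, ∑ j, g i * h j * q i j + S g h) := by
  obtain ⟨z₀, hz₀, hb₀⟩ := happ (q 0 0 + 3 * (ε : K))
  obtain ⟨z₁, hz₁, hb₁⟩ := happ (q 0 1)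
  obtain ⟨z₂, hz₂, hb₂⟩ := happ (q 1 1 + 3 * (ε : K))
  have key : ∀ x y, Matrix.toBilin' !![z₀ - q 0 0, z₁ - q 0 1; z₁ - q 0 1, z₂ - q 1 1] x y =
      x 0 * y 0 * (z₀ - q 0 0) + (x 0 * y 1 + x 1 * y 0) * (z₁ - q 0 1) +
        x 1 * y 1 * (z₂ - q 1 1) := fun x y => by
    simp only [Matrix.toBilin'_apply, Fin.sum_univ_two, Matrix.of_apply, Matrix.cons_val',
      Matrix.cons_val_zero, Matrix.cons_val_one, Matrix.cons_val_fin_one]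
    ring
  have hb₀' : ∀ σ : K →+* ℝ, 2 * ε < σ (z₀ - q 0 0) ∧ σ (z₀ - q 0 0) < 4 * ε := fun σ => by
    have h := abs_lt.mp (hb₀ σ)
    simp only [map_sub, map_add, map_mul, map_ofNat, map_ratCast] at h ⊢
    constructor <;> linarith
  have hb₂' : ∀ σ : K →+* ℝ, 2 * ε < σ (z₂ - q 1 1) ∧ σ (z₂ - q 1 1) < 4 * ε := fun σ => by
    have h := abs_lt.mp (hb₂ σ)
    simp only [map_sub, map_add, map_mul, map_ofNat, map_ratCast] at h ⊢
    constructor <;> linarith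
  have hb₁' : ∀ σ : K →+* ℝ, |σ (z₁ - q 0 1)| < ε := fun σ => by
    rw [map_sub, abs_sub_comm, ← map_sub]
    exact hb₁ σ
  have hεR : (0 : ℝ) < ε := by exact_mod_cast hε
  refine ⟨Matrix.toBilin' !![z₀ - q 0 0, z₁ - q 0 1; z₁ - q 0 1, z₂ - q 1 1],
    fun x y => ?_, fun x hx σ => ?_, fun i σ => ?_, fun g hg h hh => ?_⟩
  · rw [key, key]
    ring
  · rw [key]
    simp only [map_add, map_mul]
    have hne : 0 < σ (x 0) ^ 2 + σ (x 1) ^ 2 := by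
      by_contra hcon
      have h0 : σ (x 0) = 0 := by nlinarith [sq_nonneg (σ (x 0)), sq_nonneg (σ (x 1))]
      have h1 : σ (x 1) = 0 := by nlinarith [sq_nonneg (σ (x 0)), sq_nonneg (σ (x 1))]
      rw [map_eq_zero] at h0 h1
      refine hx (funext fun i => ?_)
      fin_cases i
      · exact h0
      · exact h1
    have h0 := (hb₀' σ).1
    have h1 := abs_lt.mp (hb₁' σ)
    have h2 := (hb₂' σ).1
    set a := σ (x 0)
    set b := σ (x 1)
    have e1 : 2 * ε * (a * a) ≤ σ (z₀ - q 0 0) * (a * a) :=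
      mul_le_mul_of_nonneg_right h0.le (mul_self_nonneg a)
    have e2 : 2 * ε * (b * b) ≤ σ (z₂ - q 1 1) * (b * b) :=
      mul_le_mul_of_nonneg_right h2.le (mul_self_nonneg b)
    have e3 : 0 ≤ (ε + σ (z₁ - q 0 1)) * (a + b) ^ 2 :=
      mul_nonneg (by linarith) (sq_nonneg _)
    have e4 : 0 ≤ (ε - σ (z₁ - q 0 1)) * (a - b) ^ 2 :=
      mul_nonneg (by linarith) (sq_nonneg _)
    have e5 : 0 < (ε : ℝ) * (a ^ 2 + b ^ 2) := mul_pos hεR hne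
    nlinarith
  · rw [key]
    fin_cases i
    · simpa using (hb₀' σ).2.le
    · simpa using (hb₂' σ).2.le
  · rw [key]
    have : ∑ i, ∑ j, g i * h j * q i j + (g 0 * h 0 * (z₀ - q 0 0) +
        (g 0 * h 1 + g 1 * h 0) * (z₁ - q 0 1) + g 1 * h 1 * (z₂ - q 1 1)) =
        g 0 * h 0 * z₀ + g 0 * h 1 * z₁ + g 1 * h 0 * z₁ + g 1 * h 1 * z₂ := by
      simp only [Fin.sum_univ_two, hq 1 0]
      ring
    rw [this]
    have hmul : ∀ z : K, (∀ g ∈ differentIdeal ℤ (𝓞 K), ∀ g' ∈ differentIdeal ℤ (𝓞 K),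
        IsIntegral ℤ ((g : K) * g' * z)) → ∀ i j, IsIntegral ℤ (g i * h j * z) := by
      intro z hz i j
      obtain ⟨a, ha, ha'⟩ := mem_differentLattice.mp (hg i)
      obtain ⟨b, hb, hb'⟩ := mem_differentLattice.mp (hh j)
      rw [← ha', ← hb']
      exact hz a ha b hb
    exact (((hmul _ hz₀ 0 0).add (hmul _ hz₁ 0 1)).add (hmul _ hz₁ 1 0)).add (hmul _ hz₂ 1 1)

namespace KLattice

variable {V : Type} [AddCommGroup V] [Module K V] [Module (𝓞 K) V] [IsScalarTower (𝓞 K) K V]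

/-- The map adding to a vector a combination of two given vectors. -/
def shift (w : Fin 2 → V) : V × (Fin 2 → K) →ₗ[K] V :=
  LinearMap.coprod LinearMap.id (Fintype.linearCombination K w)

lemma shift_apply (w : Fin 2 → V) (x : V × (Fin 2 → K)) :
    shift w x = x.1 + ∑ i, x.2 i • w i := by
  simp [shift, Fintype.linearCombination_apply]

/-- A lattice in a space with two more dimensions detecting the functionals `Q.form (w i)`. -/
def augment (Q : KLattice K V) (w : Fin 2 → V)
    (hw : ∀ i, ∀ x ∈ Q.carrier, Q.form (w i) x ∈ codifferent K)
    (S : (Fin 2 → K) →ₗ[K] (Fin 2 → K) →ₗ[K] K) (hS : ∀ x y, S x y = S y x)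
    (hpos : ∀ x, x ≠ 0 → ∀ σ : K →+* ℝ, 0 < σ (S x x))
    (hint : ∀ g : Fin 2 → K, (∀ i, g i ∈ (differentLattice K).carrier) →
        ∀ h : Fin 2 → K, (∀ i, h i ∈ (differentLattice K).carrier) →
        IsIntegral ℤ (∑ i, ∑ j, g i * h j * Q.form (w i) (w j) + S g h)) :
    KLattice K (V × (Fin 2 → K)) where
  form := Q.form.compl₁₂ (shift w) (shift w) +
    S.compl₁₂ (LinearMap.snd K V (Fin 2 → K)) (LinearMap.snd K V (Fin 2 → K))
  symm x y := congrArg₂ (· + ·) (Q.symm (shift w x) (shift w y)) (hS x.2 y.2)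
  posDef v hv σ := by
    change 0 < σ (Q.form (shift w v) (shift w v) + S v.2 v.2)
    rw [map_add]
    by_cases h : v.2 = 0
    · have h1 : shift w v ≠ 0 := by
        rw [shift_apply, h]
        simpa using fun h2 => hv (Prod.ext h2 h)
      rw [h, map_zero, map_zero, add_zero]
      exact Q.posDef _ h1 σ
    · exact add_pos_of_nonneg_of_pos (Q.form_self_nonneg _ σ) (hpos _ h σ)
  carrier := Q.carrier.prod (Submodule.pi Set.univ fun _ => (differentLattice K).carrier)
  fg := Q.fg.prod (Submodule.fg_pi fun _ => (differentLattice K).fg)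
  isIntegral x hx y hy := by
    change IsIntegral ℤ (Q.form (shift w x) (shift w y) + S x.2 y.2)
    have hx2 : ∀ i, x.2 i ∈ (differentLattice K).carrier := fun i => hx.2 i (Set.mem_univ i)
    have hy2 : ∀ i, y.2 i ∈ (differentLattice K).carrier := fun i => hy.2 i (Set.mem_univ i)
    have hmul : ∀ g ∈ (differentLattice K).carrier, ∀ z ∈ codifferent K,
        IsIntegral ℤ (g * z) := by
      rintro g hg z hz
      obtain ⟨a, ha, rfl⟩ := mem_differentLattice.mp hg
      rw [mul_comm]
      exact mem_codifferent_iff.mp hz a ha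
    have h1 : Q.form (shift w x) (shift w y) + S x.2 y.2 = Q.form x.1 y.1 +
        ∑ j, y.2 j * Q.form (w j) x.1 + ∑ i, x.2 i * Q.form (w i) y.1 +
        (∑ i, ∑ j, x.2 i * y.2 j * Q.form (w i) (w j) + S x.2 y.2) := by
      simp only [shift_apply, map_add, LinearMap.add_apply, map_smul,
        LinearMap.smul_apply, smul_eq_mul, Fin.sum_univ_two, Q.symm x.1]
      ring
    rw [h1]
    exact (((Q.isIntegral _ hx.1 _ hy.1).add
      (IsIntegral.sum _ fun j _ => hmul _ (hy2 j) _ (hw j _ hx.1))).add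
      (IsIntegral.sum _ fun i _ => hmul _ (hx2 i) _ (hw i _ hy.1))).add (hint _ hx2 _ hy2)

end KLattice

end Augmentation

section Blocking

/-- A tight maximal lattice can be represented by a universal lattice in such a way that every
irreducible vector of norm two is either in the image or orthogonal to it. -/
theorem KLattice.exists_representation_norm_two (d n : ℕ) {Y₀ : ℝ} (hY₀ : 1 ≤ Y₀) :
    ∃ Y Δ : ℝ, ∀ (K V : Type) [Field K] [NumberField K] [AddCommGroup V] [Module K V]
      [Module (𝓞 K) V] [IsScalarTower (𝓞 K) K V] [Module.Finite K V] (F : IntermediateField ℚ K),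
      TotallyReal K → Module.finrank ℚ K = d → Δ < |discr K| → Module.finrank K V ≤ n →
      (∀ x : 𝓞 K, (∀ σ : K →+* ℝ, |σ x| ≤ Y) → (x : K) ∈ F) →
      (∃ s : Set (𝓞 F), Submodule.span ℤ s = ⊤ ∧
        ∀ c ∈ s, ∀ σ : K →+* ℝ, |σ ((c : F) : K)| ≤ Y₀) →
      ∀ Q : KLattice K V, Q.IsFull → Q.IsMax → Q.IsTight →
      ∀ L : OKLattice K, L.IsUniversal (n + 4) →
      ∃ φ : Q.toOKLattice.carrier →ₗ[𝓞 K] L.carrier,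
        (∀ x, L.form (φ x) (φ x) = Q.toOKLattice.form x x) ∧
        ∀ e, L.form e e = 2 → (∀ x y, e = x + y → L.form x y = 0 → x = 0 ∨ y = 0) →
          (∃ x, φ x = e) ∨ ∀ x, L.form (φ x) e = 0 := by
  obtain ⟨ε₀, hε₀, Y, hY⟩ := KLattice.exists_selection d n Y₀ hY₀
  have hη : 0 < ε₀ / (d * Y₀ + 1) := by positivity
  obtain ⟨ε, hε, hεη⟩ := exists_rat_btwn (show (0 : ℝ) < (ε₀ / (d * Y₀ + 1)) ^ 2 / 8 by positivity)
  have hε' : (0 : ℚ) < ε := by exact_mod_cast hε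
  obtain ⟨Δ, hΔ⟩ := exists_different_approx d hε
  refine ⟨Y, Δ, fun K V _ _ _ _ _ _ _ F hK hd hdisc hV h3 h4 Q hfull hmax htight L hL => ?_⟩
  obtain ⟨w, hw, hsel⟩ := hY K V F hK hd hV h3 h4 Q hfull hmax htight
  obtain ⟨S, hSsymm, hSpos, hSle, hSint⟩ := exists_small_binary_form hε' (hΔ K hK hd hdisc)
    (fun i j => Q.form (w i) (w j)) fun i j => Q.symm _ _
  set M := Q.augment w hw S hSsymm hSpos hSint with hM
  have hMform : ∀ x y, M.form x y = Q.form (shift w x) (shift w y) + S x.2 y.2 := fun x y => rfl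
  have hMrank : M.toOKLattice.rank ≤ n + 4 := by
    refine M.rank_toOKLattice_le.trans ?_
    rw [Module.finrank_prod, Module.finrank_fin_fun]
    omega
  obtain ⟨ψ, hψ⟩ := hL.represents_of_rank_le M.toOKLattice hMrank
  have hmemM : ∀ x ∈ Q.carrier, ((x, 0) : V × (Fin 2 → K)) ∈ M.carrier := fun x hx =>
    ⟨hx, fun i _ => Submodule.zero_mem _⟩
  let ι : Q.toOKLattice.carrier →ₗ[𝓞 K] M.toOKLattice.carrier :=
    LinearMap.codRestrict M.carrier ((LinearMap.inl (𝓞 K) V (Fin 2 → K)) ∘ₗ Q.carrier.subtype)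
      fun x => hmemM x.1 x.2
  have hι : ∀ x y, M.toOKLattice.form (ι x) (ι y) = Q.toOKLattice.form x y := fun x y => by
    refine RingOfIntegers.ext ?_
    change Q.form (shift w (x.1, 0)) (shift w (y.1, 0)) + S 0 0 = Q.form x.1 y.1
    simp [shift_apply]
  refine ⟨ψ ∘ₗ ι, fun x => (hψ (ι x)).trans (hι x x), fun e he hirr => ?_⟩
  have hφ : ∀ x y, L.form ((ψ ∘ₗ ι) x) ((ψ ∘ₗ ι) y) = Q.toOKLattice.form x y := fun x y =>
    (OKLattice.form_map_of_form_self hψ (ι x) (ι y)).trans (hι x y)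
  obtain ⟨μ, hμ, hμle⟩ := M.exists_dual_of_represents hK L ψ
    (fun x => congrArg (fun t : 𝓞 K => (t : K)) (hψ x)) e
  set m := shift w μ with hm
  have he2 : ∀ σ : K →+* ℝ, σ ((L.form e e : 𝓞 K) : K) = 2 := fun σ => by
    rw [he]
    exact (congrArg σ (map_ofNat (algebraMap (𝓞 K) K) 2)).trans (map_ofNat σ 2)
  have hmx : ∀ x : Q.toOKLattice.carrier,
      Q.form m x.1 = ((L.form ((ψ ∘ₗ ι) x) e : 𝓞 K) : K) := fun x => by
    refine Eq.trans ?_ (hμ (ι x))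
    change Q.form m x.1 = Q.form (shift w μ) (shift w (x.1, 0)) + S μ.2 0
    simp [shift_apply, hm]
  have hmdual : m ∈ Q.dual := fun x hx => by
    rw [hmx ⟨x, hx⟩]
    exact RingOfIntegers.isIntegral_coe _
  have hSnonneg : ∀ x, ∀ σ : K →+* ℝ, 0 ≤ σ (S x x) := fun x σ => by
    rcases eq_or_ne x 0 with rfl | hx
    · simp
    · exact (hSpos x hx σ).le
  have hsum : ∀ σ : K →+* ℝ, σ (Q.form m m) + σ (S μ.2 μ.2) ≤ 2 := fun σ => by
    rw [← map_add, ← he2 σ]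
    exact hμle σ
  have hmle : ∀ σ : K →+* ℝ, σ (Q.form m m) ≤ 2 := fun σ => by
    linarith [hsum σ, hSnonneg μ.2 σ]
  have hcod : ∀ i, Q.form (w i) m + S μ.2 (Pi.single i 1) ∈ codifferent K := fun i => by
    refine mem_codifferent_iff.mpr fun g hg => ?_
    have hmem : ((0, Pi.single i (g : K)) : V × (Fin 2 → K)) ∈ M.carrier := by
      refine ⟨Submodule.zero_mem _, fun j _ => ?_⟩
      rcases eq_or_ne j i with rfl | hj
      · simpa using mem_differentLattice.mpr ⟨g, hg, rfl⟩
      · simp [hj]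
    have h1 : (Q.form (w i) m + S μ.2 (Pi.single i 1)) * (g : K) =
        ((L.form (ψ (⟨_, hmem⟩ : M.carrier)) e : 𝓞 K) : K) := by
      refine Eq.trans ?_ (hμ ⟨_, hmem⟩)
      change _ = Q.form m (shift w (0, Pi.single i (g : K))) + S μ.2 (Pi.single i (g : K))
      have h2 : (Pi.single i (g : K) : Fin 2 → K) = (g : K) • Pi.single i 1 := by
        rw [← Pi.single_smul, smul_eq_mul, mul_one]
      have h3 : shift w ((0 : V), Pi.single i (g : K)) = (g : K) • w i := by
        rw [shift_apply, zero_add, Finset.sum_eq_single i]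
        · simp
        · intro j _ hj
          simp [hj]
        · simp
      rw [h3, h2, map_smul, map_smul, Q.symm m, smul_eq_mul, smul_eq_mul]
      ring
    rw [h1]
    exact RingOfIntegers.isIntegral_coe _
  have hSsmall : ∀ i, ∀ σ : K →+* ℝ, |σ (S μ.2 (Pi.single i 1))| ≤ ε₀ / (d * Y₀ + 1) :=
    fun i σ => by
    refine abs_le_of_sq_le_sq ?_ hη.le
    have h1 := _root_.sq_form_le S hSsymm σ (fun v => hSnonneg v σ) μ.2 (Pi.single i 1)
    have h2 : σ (S μ.2 μ.2) ≤ 2 := by linarith [hsum σ, Q.form_self_nonneg m σ]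
    have h3 := mul_le_mul h2 (hSle i σ) (hSnonneg _ σ) zero_le_two
    linarith
  have hmmem : m ∈ Q.carrier := by
    refine hsel m hmdual hmle fun i c hc => ?_
    obtain ⟨k, hk⟩ := mem_codifferent.mp (hcod i) c
    rw [mul_comm] at hk
    refine ⟨k, ?_⟩
    have h1 : (c : K) * Q.form (w i) m = (c : K) * (Q.form (w i) m + S μ.2 (Pi.single i 1)) -
        (c : K) * S μ.2 (Pi.single i 1) := by ring
    rw [h1, map_sub, hk, Rat.cast_sub, Rat.cast_intCast, sub_sub_cancel_left, abs_neg,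
      hK.trace_eq]
    calc |∑ σ : K →+* ℝ, σ ((c : K) * S μ.2 (Pi.single i 1))|
        ≤ ∑ σ : K →+* ℝ, |σ ((c : K) * S μ.2 (Pi.single i 1))| := Finset.abs_sum_le_sum_abs _ _
      _ ≤ ∑ _σ : K →+* ℝ, Y₀ * (ε₀ / (d * Y₀ + 1)) := by
          refine Finset.sum_le_sum fun σ _ => ?_
          rw [map_mul, abs_mul]
          exact mul_le_mul (hc σ) (hSsmall i σ) (abs_nonneg _) (by linarith)
      _ = d * Y₀ * ε₀ / (d * Y₀ + 1) := by
          rw [Finset.sum_const, Finset.card_univ, hK.card_emb, hd, nsmul_eq_mul]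
          ring
      _ < ε₀ := by
          rw [div_lt_iff₀ (by positivity)]
          nlinarith
  set x₀ : Q.toOKLattice.carrier := ⟨m, hmmem⟩ with hx₀
  have horth : ∀ x, L.form ((ψ ∘ₗ ι) x) (e - (ψ ∘ₗ ι) x₀) = 0 := fun x => by
    rw [map_sub, hφ, sub_eq_zero]
    refine RingOfIntegers.ext ?_
    refine (hmx x).symm.trans ?_
    exact Q.symm _ _
  rcases hirr ((ψ ∘ₗ ι) x₀) (e - (ψ ∘ₗ ι) x₀) (by abel) (horth x₀) with h | h
  · right
    intro x
    have := horth x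
    rwa [h, sub_zero] at this
  · exact Or.inl ⟨x₀, (sub_eq_zero.mp h).symm⟩

end Blocking

section Relative

variable {K : Type} [Field K] [NumberField K] {F : IntermediateField ℚ K}

/-- The integers of `F` multiplying an element into the integers. -/
def integralAnnihilator (F : IntermediateField ℚ K) (z : K) : Ideal (𝓞 F) where
  carrier := {c | IsIntegral ℤ (((c : F) : K) * z)}
  zero_mem' := by simpa using isIntegral_zero
  add_mem' := fun {a b} ha hb => by
    have := IsIntegral.add ha hb
    rw [← add_mul] at this
    exact this
  smul_mem' := fun c a ha => by
    have := (isIntegral_coe_coe c).mul ha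
    rw [← mul_assoc] at this
    exact this

lemma mem_integralAnnihilator {z : K} {c : 𝓞 F} :
    c ∈ integralAnnihilator F z ↔ IsIntegral ℤ (((c : F) : K) * z) := Iff.rfl

/-- A non-integral element with an integral multiple has a multiple annihilated by a maximal
ideal modulo integers. -/
lemma exists_isMaximal_integralAnnihilator {z : K} (hz : ¬ IsIntegral ℤ z) {a : 𝓞 F} (ha0 : a ≠ 0)
    (ha : IsIntegral ℤ (((a : F) : K) * z)) :
    ∃ s : 𝓞 F, ¬ IsIntegral ℤ (((s : F) : K) * z) ∧
      (integralAnnihilator F (((s : F) : K) * z)).IsMaximal := by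
  obtain ⟨J, ⟨s, hs, rfl⟩, hJ⟩ := set_has_maximal_iff_noetherian.mpr
    (inferInstance : IsNoetherian (𝓞 F) (𝓞 F))
    {J : Ideal (𝓞 F) | ∃ s : 𝓞 F, ¬ IsIntegral ℤ (((s : F) : K) * z) ∧
      J = integralAnnihilator F (((s : F) : K) * z)}
    ⟨_, 1, by simpa using hz, rfl⟩
  refine ⟨s, hs, Ideal.IsPrime.isMaximal ⟨?_, ?_⟩ ?_⟩
  · rw [Ne, Ideal.eq_top_iff_one, mem_integralAnnihilator]
    simpa using hs
  · intro x y hxy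
    by_contra hcon
    rw [not_or] at hcon
    have h1 : ((((x * s : 𝓞 F)) : F) : K) * z = ((x : F) : K) * (((s : F) : K) * z) := by
      rw [← mul_assoc]
      rfl
    have h2 : integralAnnihilator F (((s : F) : K) * z) ≤
        integralAnnihilator F ((((x * s : 𝓞 F) : F) : K) * z) := fun c hc => by
      rw [mem_integralAnnihilator, h1]
      have := (isIntegral_coe_coe x).mul hc
      rwa [mul_left_comm] at this
    refine hJ _ ⟨x * s, by rw [h1]; exact hcon.1, rfl⟩ (lt_of_le_of_ne h2 fun h3 => hcon.2 ?_)
    rw [h3, mem_integralAnnihilator, h1, ← mul_assoc]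
    refine Eq.subst (motive := fun t : K => IsIntegral ℤ (t * (((s : F) : K) * z))) ?_ hxy
    exact (congrArg (fun t : 𝓞 F => ((t : F) : K)) (mul_comm x y))
  · refine fun h => ha0 ?_
    have : a ∈ integralAnnihilator F (((s : F) : K) * z) := by
      rw [mem_integralAnnihilator, mul_left_comm]
      exact (isIntegral_coe_coe s).mul ha
    rwa [h, Ideal.mem_bot] at this

lemma isIntegral_of_isIntegral_mul_sub {t : 𝓞 K} {a : 𝓞 F} (ha0 : a ≠ 0)
    (ht : ∀ q : Ideal (𝓞 F), q.IsMaximal → a ∈ q → ∀ c : 𝓞 F,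
      t - algebraMap (𝓞 F) (𝓞 K) c ∉ q.map (algebraMap (𝓞 F) (𝓞 K)))
    {z z' : K} (hzF : z ∈ F) (hzF' : z' ∈ F) (haz : IsIntegral ℤ (((a : F) : K) * z))
    (h : IsIntegral ℤ (z * t - z')) : IsIntegral ℤ z := by
  by_contra hz
  obtain ⟨s, hs, hmax⟩ := exists_isMaximal_integralAnnihilator hz ha0 haz
  set q := integralAnnihilator F (((s : F) : K) * z) with hq
  have haq : a ∈ q := by
    rw [mem_integralAnnihilator, mul_left_comm]
    exact (isIntegral_coe_coe s).mul haz
  have hq0 : q ≠ ⊥ := fun h => ha0 (by rwa [h, Ideal.mem_bot] at haq)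
  have hF : ((s : F) : K) * z ∈ F := F.mul_mem (s : F).2 hzF
  have hF' : ((s : F) : K) * z' ∈ F := F.mul_mem (s : F).2 hzF'
  have hst : IsIntegral ℤ (((s : F) : K) * z * t - ((s : F) : K) * z') := by
    have := (isIntegral_coe_coe s).mul h
    rwa [mul_sub, ← mul_assoc] at this
  obtain ⟨c, hc⟩ := exists_isIntegral_sub_mul q hq0 hF hF' hs (fun c hc => hc) fun c hc => by
    have h1 := ((mem_integralAnnihilator.mp hc).mul t.isIntegral_coe).sub
      ((isIntegral_coe_coe c).mul hst)
    have h2 : ((c : F) : K) * (((s : F) : K) * z) * t -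
        ((c : F) : K) * (((s : F) : K) * z * t - ((s : F) : K) * z') =
        ((c : F) : K) * (((s : F) : K) * z') := by ring
    rwa [h2] at h1
  obtain ⟨x, hx, y, hy, hxy⟩ := exists_add_mul_eq_one q hq0 hF hs fun c hc => hc
  obtain ⟨u, hu⟩ := isIntegral_iff_exists.mp (hst.add hc)
  refine ht q hmax haq c ?_
  have key : t - algebraMap (𝓞 F) (𝓞 K) c = (t - algebraMap (𝓞 F) (𝓞 K) c) *
      algebraMap (𝓞 F) (𝓞 K) x + u * algebraMap (𝓞 F) (𝓞 K) y := by
    refine RingOfIntegers.ext ?_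
    change (t : K) - ((c : F) : K) = ((t : K) - ((c : F) : K)) * ((x : F) : K) +
      (u : K) * ((y : F) : K)
    rw [hu]
    linear_combination ((t : K) - ((c : F) : K)) * hxy
  rw [key]
  exact Ideal.add_mem _ (Ideal.mul_mem_left _ _ (Ideal.mem_map_of_mem _ hx))
    (Ideal.mul_mem_left _ _ (Ideal.mem_map_of_mem _ hy))

lemma exists_sub_notMem_map (hF : F ≠ ⊤) (q : Ideal (𝓞 F)) (hq : q.IsMaximal) :
    ∃ t : 𝓞 K, ∀ c : 𝓞 F,
      t - algebraMap (𝓞 F) (𝓞 K) c ∉ q.map (algebraMap (𝓞 F) (𝓞 K)) := by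
  by_contra! hcon
  let N : Submodule (𝓞 F) (𝓞 K) := LinearMap.range (Algebra.linearMap (𝓞 F) (𝓞 K))
  obtain ⟨r, hr, hr'⟩ := Submodule.exists_sub_one_mem_and_smul_eq_zero_of_fg_of_le_smul q
    (⊤ : Submodule (𝓞 F) (𝓞 K ⧸ N)) Module.Finite.fg_top (by
      rintro x -
      obtain ⟨t, rfl⟩ := Submodule.Quotient.mk_surjective N x
      obtain ⟨c, hc⟩ := hcon t
      have h1 : Submodule.Quotient.mk (p := N) t =
          N.mkQ (t - algebraMap (𝓞 F) (𝓞 K) c) := by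
        rw [map_sub, Submodule.mkQ_apply, Submodule.mkQ_apply,
          (Submodule.Quotient.mk_eq_zero N (x := algebraMap (𝓞 F) (𝓞 K) c)).mpr ⟨c, rfl⟩, sub_zero]
      rw [h1]
      have h2 : t - algebraMap (𝓞 F) (𝓞 K) c ∈ q • (⊤ : Submodule (𝓞 F) (𝓞 K)) := by
        rw [Ideal.smul_top_eq_map]
        exact hc
      have h3 := Submodule.mem_map_of_mem (f := N.mkQ) h2
      rw [Submodule.map_smul''] at h3
      exact (Submodule.smul_mono le_rfl le_top) h3)
  have hr0 : r ≠ 0 := by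
    rintro rfl
    rw [zero_sub, neg_mem_iff] at hr
    exact hq.ne_top ((Ideal.eq_top_iff_one q).mpr hr)
  refine hF (eq_top_iff.mpr fun x _ => ?_)
  have hint : ∀ y : 𝓞 K, (y : K) ∈ F := fun y => by
    have h1 := hr' (Submodule.Quotient.mk y) Submodule.mem_top
    rw [← Submodule.Quotient.mk_smul, Submodule.Quotient.mk_eq_zero] at h1
    obtain ⟨c, hc⟩ := h1
    have h2 : ((c : F) : K) = ((r : F) : K) * (y : K) := by
      refine (congrArg (fun t : 𝓞 K => (t : K)) hc).trans ?_
      rw [Algebra.smul_def]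
      rfl
    have h3 : ((r : F) : K) ≠ 0 := by
      simpa using hr0
    have h4 : (y : K) = ((r : F) : K)⁻¹ * ((c : F) : K) := by
      rw [h2, inv_mul_cancel_left₀ h3]
    rw [h4]
    exact F.mul_mem (F.inv_mem (r : F).2) (c : F).2
  obtain ⟨a, b, -, rfl⟩ := IsFractionRing.div_surjective (A := 𝓞 K) x
  exact F.div_mem (hint a) (hint b)

/-- An element of `K` which is independent of `1` over `F` modulo every prime dividing `a`. -/
lemma exists_forall_isIntegral_of_isIntegral_mul_sub (hF : F ≠ ⊤) {a : 𝓞 F} (ha0 : a ≠ 0) :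
    ∃ t : 𝓞 K, ∀ z ∈ F, ∀ z' ∈ F, IsIntegral ℤ (((a : F) : K) * z) →
      IsIntegral ℤ (z * t - z') → IsIntegral ℤ z := by
  have hfin := Ideal.finite_factors (I := Ideal.span {a}) (by simpa using ha0)
  have := hfin.to_subtype
  choose s hs using fun q : {v : IsDedekindDomain.HeightOneSpectrum (𝓞 F) |
    v.asIdeal ∣ Ideal.span {a}} => exists_sub_notMem_map hF q.1.asIdeal q.1.isMaximal
  obtain ⟨t, ht⟩ := Ideal.exists_forall_sub_mem_ideal
    (I := fun q : {v : IsDedekindDomain.HeightOneSpectrum (𝓞 F) | v.asIdeal ∣ Ideal.span {a}} =>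
      q.1.asIdeal.map (algebraMap (𝓞 F) (𝓞 K))) (fun p q hpq => by
      have h1 : IsCoprime p.1.asIdeal q.1.asIdeal := by
        rw [Ideal.isCoprime_iff_sup_eq]
        refine Ideal.IsMaximal.coprime_of_ne p.1.isMaximal q.1.isMaximal fun h => hpq ?_
        exact Subtype.ext (IsDedekindDomain.HeightOneSpectrum.ext h)
      change IsCoprime (Ideal.map _ _) (Ideal.map _ _)
      rw [Ideal.isCoprime_iff_sup_eq] at h1 ⊢
      rw [← Ideal.map_sup, h1, Ideal.map_top]) s
  refine ⟨t, fun z hz z' hz' => isIntegral_of_isIntegral_mul_sub ha0 (fun q hq haq c hc => ?_)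
    hz hz'⟩
  have hq0 : q ≠ ⊥ := fun h => ha0 (by rwa [h, Ideal.mem_bot] at haq)
  let v : {v : IsDedekindDomain.HeightOneSpectrum (𝓞 F) | v.asIdeal ∣ Ideal.span {a}} :=
    ⟨⟨q, hq.isPrime, hq0⟩, Ideal.dvd_span_singleton.mpr haq⟩
  refine hs v c ?_
  have := Ideal.sub_mem _ hc (ht v)
  rwa [sub_sub_sub_cancel_left] at this

end Relative

section Parameters

lemma Int.exists_sq_dvd_sq_add {q a m : ℤ} (hq : Prime q) (h2 : ¬ q ∣ 2) (ha : ¬ q ∣ a)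
    (h : q ∣ a ^ 2 + m) : ∃ b, q ^ 2 ∣ b ^ 2 + m := by
  obtain ⟨s, hs⟩ := h
  obtain ⟨u, w, huw⟩ := hq.coprime_iff_not_dvd.mpr fun h : q ∣ 2 * a => (hq.dvd_or_dvd h).elim h2 ha
  refine ⟨a - q * (s * w), s * u + s ^ 2 * w ^ 2, ?_⟩
  linear_combination hs - q * s * huw

lemma Int.exists_sq_dvd_add_sq_add_sq {q : ℕ} (hq : q.Prime) (h2 : 2 < q) {r : ℤ}
    (hr : ¬ (q : ℤ) ∣ r) : ∃ b c : ℤ, (q : ℤ) ^ 2 ∣ r + b ^ 2 + c ^ 2 := by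
  have := Fact.mk hq
  have hq' : Prime (q : ℤ) := Nat.prime_iff_prime_int.mp hq
  have h2' : ¬ (q : ℤ) ∣ 2 := fun h => by
    have := Int.le_of_dvd two_pos h
    omega
  obtain ⟨x, y, hxy⟩ := ZMod.sq_add_sq q (-r : ZMod q)
  obtain ⟨a, rfl⟩ := ZMod.intCast_surjective x
  obtain ⟨b, rfl⟩ := ZMod.intCast_surjective y
  have h : (q : ℤ) ∣ r + a ^ 2 + b ^ 2 := by
    rw [← ZMod.intCast_zmod_eq_zero_iff_dvd]
    push_cast
    linear_combination hxy
  by_cases ha : (q : ℤ) ∣ a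
  · have hb : ¬ (q : ℤ) ∣ b := fun hb => hr (by
      have h3 := (h.sub (dvd_pow ha two_ne_zero)).sub (dvd_pow hb two_ne_zero)
      rwa [show r + a ^ 2 + b ^ 2 - a ^ 2 - b ^ 2 = r by ring] at h3)
    obtain ⟨c, hc⟩ := exists_sq_dvd_sq_add (m := r + a ^ 2) hq' h2' hb (by rwa [add_comm])
    exact ⟨a, c, by rwa [add_comm] at hc⟩
  · obtain ⟨c, hc⟩ := exists_sq_dvd_sq_add (m := r + b ^ 2) hq' h2' ha
      (by rwa [show a ^ 2 + (r + b ^ 2) = r + a ^ 2 + b ^ 2 by ring])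
    exact ⟨c, b, by rwa [show r + c ^ 2 + b ^ 2 = c ^ 2 + (r + b ^ 2) by ring]⟩

open Polynomial in
lemma exists_nat_forall_not_dvd {R : Type} [CommRing R] {q : ℕ} (hq : q.Prime) (h6 : 6 < q)
    (hqR : ¬ IsUnit (q : R)) (t : R) {b c : ℤ} (hbc : ¬ ((q : ℤ) ∣ b ∧ (q : ℤ) ∣ c)) :
    ∃ m : ℕ, ¬ (q : R) ∣ 1 + (t + m) ^ 2 ∧ ¬ (q : R) ∣ (1 - (t + m) ^ 2) * b - 2 * (t + m) * c ∧
      ¬ (q : R) ∣ 2 * (t + m) * b + (1 - (t + m) ^ 2) * c := by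
  obtain ⟨P, hP, hqP⟩ := Ideal.exists_le_maximal (Ideal.span {(q : R)})
    (by rwa [Ne, Ideal.span_singleton_eq_top])
  let _ := Ideal.Quotient.field P
  have hq0 : ((q : ℤ) : R ⧸ P) = 0 := by
    rw [Int.cast_natCast, ← map_natCast (Ideal.Quotient.mk P), Ideal.Quotient.eq_zero_iff_mem]
    exact hqP (Ideal.mem_span_singleton_self _)
  have hq' : Prime (q : ℤ) := Nat.prime_iff_prime_int.mp hq
  have hint : ∀ a : ℤ, (a : R ⧸ P) = 0 → (q : ℤ) ∣ a := fun a ha => by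
    by_contra hcon
    obtain ⟨u, w, huw⟩ := hq'.coprime_iff_not_dvd.mpr hcon
    have h1 := congrArg (fun z : ℤ => (z : R ⧸ P)) huw
    simp only [Int.cast_add, Int.cast_mul, ha, hq0, mul_zero, add_zero, Int.cast_one] at h1
    exact zero_ne_one h1
  have hdvd : ∀ x : R, (q : R) ∣ x → Ideal.Quotient.mk P x = 0 := fun x hx => by
    rw [Ideal.Quotient.eq_zero_iff_mem]
    exact hqP (Ideal.mem_span_singleton.mpr hx)
  have h2 : (2 : R ⧸ P) ≠ 0 := fun h => by
    have := Int.le_of_dvd two_pos (hint 2 (by exact_mod_cast h))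
    omega
  by_contra! hcon
  let p₁ : (R ⧸ P)[X] := 1 + X ^ 2
  let p₂ : (R ⧸ P)[X] := (1 - X ^ 2) * C (b : R ⧸ P) - 2 * X * C (c : R ⧸ P)
  let p₃ : (R ⧸ P)[X] := 2 * X * C (b : R ⧸ P) + (1 - X ^ 2) * C (c : R ⧸ P)
  have hp₁ : p₁.natDegree ≤ 2 := by
    simp only [p₁]
    compute_degree
  have hp₂ : p₂.natDegree ≤ 2 := by
    simp only [p₂]
    compute_degree
  have hp₃ : p₃.natDegree ≤ 2 := by
    simp only [p₃]
    compute_degree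
  have hzero : p₁ * p₂ * p₃ = 0 := by
    refine Polynomial.eq_zero_of_natDegree_lt_card_of_eval_eq_zero _
      (f := fun m : Fin 7 => Ideal.Quotient.mk P (t + (m : ℕ))) (fun m m' h => ?_) (fun m => ?_) ?_
    · have h3 : ((((m : ℕ) : ℤ) - ((m' : ℕ) : ℤ) : ℤ) : R ⧸ P) = 0 := by
        simp only [map_add, map_natCast, add_right_inj] at h
        push_cast
        rw [h, sub_self]
      have h4 := Int.eq_zero_of_abs_lt_dvd (hint _ h3) (by rw [abs_lt]; omega)
      exact Fin.ext (by omega)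
    · rw [eval_mul, eval_mul]
      by_cases h₁ : (q : R) ∣ 1 + (t + (m : ℕ)) ^ 2
      · have : p₁.eval (Ideal.Quotient.mk P (t + (m : ℕ))) = 0 := by
          refine Eq.trans ?_ (hdvd _ h₁)
          simp [p₁]
        rw [this, zero_mul, zero_mul]
      · by_cases h₂ : (q : R) ∣ (1 - (t + (m : ℕ)) ^ 2) * b - 2 * (t + (m : ℕ)) * c
        · have : p₂.eval (Ideal.Quotient.mk P (t + (m : ℕ))) = 0 := by
            refine Eq.trans ?_ (hdvd _ h₂)
            simp [p₂, (map_ofNat (Ideal.Quotient.mk P) 2).symm]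
          rw [this, mul_zero, zero_mul]
        · have : p₃.eval (Ideal.Quotient.mk P (t + (m : ℕ))) = 0 := by
            refine Eq.trans ?_ (hdvd _ (hcon m h₁ h₂))
            simp [p₃, (map_ofNat (Ideal.Quotient.mk P) 2).symm]
          rw [this, mul_zero]
    · rw [Fintype.card_fin]
      have := (natDegree_mul_le (p := p₁ * p₂) (q := p₃)).trans
        (add_le_add_left (natDegree_mul_le (p := p₁) (q := p₂)) _)
      omega
  rcases mul_eq_zero.mp hzero with h | h
  · rcases mul_eq_zero.mp h with h | h
    · have h3 := congrArg (fun p => coeff p 2) h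
      simp [p₁, coeff_one] at h3
    · have h3 := congrArg (fun p => eval 0 p) h
      have h4 := congrArg (fun p => eval 1 p) h
      simp [p₂] at h3 h4
      exact hbc ⟨hint b h3, hint c (h4.resolve_left h2)⟩
  · have h3 := congrArg (fun p => eval 0 p) h
    have h4 := congrArg (fun p => eval 1 p) h
    simp [p₃] at h3 h4
    exact hbc ⟨hint b (h4.resolve_left h2), hint c h3⟩

end Parameters

section Neighbour

variable {K : Type} [Field K] [NumberField K] {ι : Type} [Fintype ι]

/-- The neighbour of the standard lattice in the direction of `v` at `q`. -/
def neighbourLattice (v : ι → 𝓞 K) {q : ℕ} (hq : q ≠ 0)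
    (hv : IsIntegral ℤ ((∑ a, (v a : K) * v a) / (q : K) ^ 2)) : KLattice K (ι → K) where
  form := dotProductBilin K K
  symm x y := dotProduct_comm x y
  posDef x hx σ := by
    change 0 < σ (∑ a, x a * x a)
    rw [map_sum]
    obtain ⟨a, ha⟩ := Function.ne_iff.mp hx
    refine Finset.sum_pos' (fun a _ => ?_) ⟨a, Finset.mem_univ a, ?_⟩
    · rw [map_mul]
      exact mul_self_nonneg _
    · rw [map_mul]
      exact mul_self_pos.mpr (by simpa using ha)
  carrier :=
    { carrier := {x | (∃ c : 𝓞 K, ∀ a, IsIntegral ℤ (x a - c / q * v a)) ∧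
        IsIntegral ℤ ((∑ a, x a * v a) / q)}
      zero_mem' := ⟨⟨0, fun a => by simpa using isIntegral_zero⟩, by simpa using isIntegral_zero⟩
      add_mem' := by
        rintro x y ⟨⟨c, hc⟩, hx⟩ ⟨⟨c', hc'⟩, hy⟩
        refine ⟨⟨c + c', fun a => ?_⟩, ?_⟩
        · have h := (hc a).add (hc' a)
          have h2 : ((c + c' : 𝓞 K) : K) = c + c' := rfl
          rw [h2]
          simp only [Pi.add_apply]
          ring_nf at h ⊢
          exact h
        · have h := hx.add hy
          rw [← add_div, ← Finset.sum_add_distrib] at h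
          simpa only [Pi.add_apply, add_mul] using h
      smul_mem' := by
        rintro e x ⟨⟨c, hc⟩, hx⟩
        refine ⟨⟨e * c, fun a => ?_⟩, ?_⟩
        · have h := e.isIntegral_coe.mul (hc a)
          have h2 : ((e * c : 𝓞 K) : K) = e * c := rfl
          have h3 : (e • x) a = (e : K) * x a := by rw [Pi.smul_apply, Algebra.smul_def]
          rw [h2, h3]
          ring_nf at h ⊢
          exact h
        · have h := e.isIntegral_coe.mul hx
          rw [← mul_div_assoc, Finset.mul_sum] at h
          simp only [Pi.smul_apply, Algebra.smul_def, mul_assoc]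
          exact h }
  fg := by
    classical
    have hqK : (q : K) ≠ 0 := Nat.cast_ne_zero.mpr hq
    let N : Submodule (𝓞 K) (ι → K) := Submodule.pi Set.univ fun _ =>
      Submodule.span (𝓞 K) {(q : K)⁻¹}
    have hN : N.FG := Submodule.fg_pi fun _ => Submodule.fg_span_singleton _
    refine hN.of_le ?_
    rintro x ⟨⟨c, hc⟩, -⟩ a -
    have h := ((isIntegral_natCast (R := ℤ) q).mul (hc a)).add
      (c.isIntegral_coe.mul (v a).isIntegral_coe)
    obtain ⟨y, hy⟩ := isIntegral_iff_exists.mp h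
    change x a ∈ Submodule.span (𝓞 K) {(q : K)⁻¹}
    refine Submodule.mem_span_singleton.mpr ⟨y, ?_⟩
    rw [Algebra.smul_def]
    refine (congrArg (· * (q : K)⁻¹) hy).trans ?_
    field_simp
    ring
  isIntegral := by
    rintro x ⟨⟨c, hc⟩, hx⟩ y ⟨⟨c', hc'⟩, hy⟩
    have hqK : (q : K) ≠ 0 := Nat.cast_ne_zero.mpr hq
    have h1 : IsIntegral ℤ (∑ a, (x a - c / q * v a) * (y a - c' / q * v a)) :=
      IsIntegral.sum _ fun a _ => (hc a).mul (hc' a)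
    have h2 := c.isIntegral_coe.mul hy
    have h3 := c'.isIntegral_coe.mul hx
    have h4 := (c.isIntegral_coe.mul c'.isIntegral_coe).mul hv
    have h5 := ((h1.add h2).add h3).sub h4
    refine Eq.subst (motive := fun z : K => IsIntegral ℤ z) ?_ h5
    change _ = ∑ a, x a * y a
    simp only [Finset.sum_div, Finset.mul_sum]
    rw [← Finset.sum_add_distrib, ← Finset.sum_add_distrib, ← Finset.sum_sub_distrib]
    refine Finset.sum_congr rfl fun a _ => ?_
    field_simp
    ring

variable {v : ι → 𝓞 K} {q : ℕ} (hq : q ≠ 0)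
    (hv : IsIntegral ℤ ((∑ a, (v a : K) * v a) / (q : K) ^ 2))

lemma neighbourLattice_form (x y : ι → K) :
    (neighbourLattice v hq hv).form x y = ∑ a, x a * y a := rfl

lemma single_mem_neighbourLattice [DecidableEq ι] (a : ι) :
    Pi.single a (q : K) ∈ (neighbourLattice v hq hv).carrier := by
  refine ⟨⟨0, fun b => ?_⟩, ?_⟩
  · rw [show ((0 : 𝓞 K) : K) = 0 from rfl, zero_div, zero_mul, sub_zero]
    rcases eq_or_ne b a with rfl | h
    · simpa using isIntegral_natCast (R := ℤ) q
    · simpa [h] using isIntegral_zero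
  · have hqK : (q : K) ≠ 0 := Nat.cast_ne_zero.mpr hq
    rw [Finset.sum_eq_single a]
    · simpa [hqK] using (v a).isIntegral_coe
    · intro b _ hb
      simp [hb]
    · simp

lemma isIntegral_mul_of_mem_neighbourLattice {x : ι → K}
    (hx : x ∈ (neighbourLattice v hq hv).carrier) (a : ι) : IsIntegral ℤ ((q : K) * x a) := by
  obtain ⟨⟨c, hc⟩, -⟩ := hx
  have hqK : (q : K) ≠ 0 := Nat.cast_ne_zero.mpr hq
  have h := ((isIntegral_natCast (R := ℤ) q).mul (hc a)).add
    (c.isIntegral_coe.mul (v a).isIntegral_coe)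
  refine Eq.subst (motive := fun z : K => IsIntegral ℤ z) ?_ h
  field_simp
  ring

lemma smul_eq_sum_single_neighbourLattice [DecidableEq ι]
    (x : (neighbourLattice v hq hv).carrier) {m : 𝓞 K} {y : ι → 𝓞 K}
    (h : ∀ a, (m : K) * x.1 a = y a * q) :
    m • x = ∑ a, y a • (⟨_, single_mem_neighbourLattice hq hv a⟩ :
      (neighbourLattice v hq hv).carrier) := by
  refine Subtype.ext (funext fun b => ?_)
  have h2 : ((m • x : (neighbourLattice v hq hv).carrier) : ι → K) b = m * x.1 b := by
    rw [Submodule.coe_smul, Pi.smul_apply, Algebra.smul_def]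
  rw [h2, Submodule.coe_sum, Finset.sum_apply, Finset.sum_eq_single b, h]
  · change _ = y b • (Pi.single b (q : K) : ι → K) b
    rw [Pi.single_eq_same, Algebra.smul_def]
  · intro a _ ha
    change y a • (Pi.single a (q : K) : ι → K) b = 0
    rw [Pi.single_eq_of_ne ha.symm, smul_zero]
  · simp

/-- The neighbour lattice is unimodular. -/
lemma exists_form_eq_neighbourLattice {u : ι → 𝓞 K} {s : 𝓞 K}
    (hu : ∑ a, u a * v a = 1 + q * s)
    (f : (neighbourLattice v hq hv).carrier →ₗ[𝓞 K] 𝓞 K) :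
    ∃ z ∈ (neighbourLattice v hq hv).carrier, ∀ x : (neighbourLattice v hq hv).carrier,
      (neighbourLattice v hq hv).form z x = (f x : 𝓞 K) := by
  classical
  have hqK : (q : K) ≠ 0 := Nat.cast_ne_zero.mpr hq
  let e : ι → (neighbourLattice v hq hv).carrier := fun a =>
    ⟨_, single_mem_neighbourLattice hq hv a⟩
  let z : ι → K := fun a => (f (e a) : K) / q
  have hz : ∀ x : (neighbourLattice v hq hv).carrier,
      (neighbourLattice v hq hv).form z x = (f x : 𝓞 K) := fun x => by
    choose y hy using fun a => isIntegral_iff_exists.mp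
      (isIntegral_mul_of_mem_neighbourLattice hq hv x.2 a)
    have h1 : ((q : 𝓞 K) ^ 2) • x = ∑ a, y a • e a :=
      smul_eq_sum_single_neighbourLattice hq hv x fun a => by
        rw [hy]
        simp only [map_pow, map_natCast]
        ring
    have h3 := congrArg (fun t => ((f t : 𝓞 K) : K)) h1
    simp only [map_smul, map_sum, smul_eq_mul, map_mul, map_pow, map_natCast, hy] at h3
    refine mul_left_cancel₀ (pow_ne_zero 2 hqK) (Eq.trans ?_ h3.symm)
    rw [neighbourLattice_form, Finset.mul_sum]
    refine Finset.sum_congr rfl fun a _ => ?_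
    simp only [z]
    field_simp
  refine ⟨z, ?_, hz⟩
  have hint : ∀ x ∈ (neighbourLattice v hq hv).carrier, IsIntegral ℤ (∑ a, z a * x a) :=
    fun x hx => by
    have := hz ⟨x, hx⟩
    rw [neighbourLattice_form] at this
    rw [this]
    exact RingOfIntegers.isIntegral_coe _
  refine ⟨⟨∑ a, f (e a) * u a, fun a => ?_⟩, ?_⟩
  · have h1 := hint (Pi.single a 1 - (v a : K) • fun b => (u b : K)) (by
      refine ⟨⟨0, fun b => ?_⟩, ?_⟩
      · rw [show ((0 : 𝓞 K) : K) = 0 from rfl, zero_div, zero_mul, sub_zero]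
        refine IsIntegral.sub ?_ ((v a).isIntegral_coe.mul (u b).isIntegral_coe)
        rcases eq_or_ne b a with rfl | h
        · simpa using isIntegral_one
        · simpa [h] using isIntegral_zero
      · have h2 : (∑ b, (u b : K) * v b) = 1 + q * s := by
          have := congrArg (fun t : 𝓞 K => (t : K)) hu
          simpa only [map_sum, map_mul, map_add, map_one, map_natCast] using this
        have h3 : (∑ b, (Pi.single a 1 - (v a : K) • fun b => (u b : K) : ι → K) b * v b) =
            - (q * (s * v a)) := by
          simp only [Pi.sub_apply, Pi.smul_apply, smul_eq_mul, sub_mul, Finset.sum_sub_distrib,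
            mul_assoc, ← Finset.mul_sum, h2]
          simp [Pi.single_apply]
          ring
        rw [h3, neg_div, mul_div_cancel_left₀ _ hqK]
        exact (s.isIntegral_coe.mul (v a).isIntegral_coe).neg)
    refine Eq.subst (motive := fun z : K => IsIntegral ℤ z) ?_ h1
    have h4 : ((∑ a, f (e a) * u a : 𝓞 K) : K) = ∑ a, (f (e a) : K) * u a := by
      simp only [map_sum, map_mul]
    rw [h4]
    simp only [Pi.sub_apply, Pi.smul_apply, smul_eq_mul, mul_sub, Finset.sum_sub_distrib, z,
      Finset.sum_div, Finset.sum_mul]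
    congr 1
    · simp [Pi.single_apply]
    · refine Finset.sum_congr rfl fun b _ => ?_
      ring
  · have h1 := hint (fun a => (v a : K) / q) (by
      refine ⟨⟨1, fun a => ?_⟩, ?_⟩
      · have : (v a : K) / q - ((1 : 𝓞 K) : K) / q * v a = 0 := by
          rw [show ((1 : 𝓞 K) : K) = 1 from rfl]
          ring
        rw [this]
        exact isIntegral_zero
      · refine Eq.subst (motive := fun z : K => IsIntegral ℤ z) ?_ hv
        rw [Finset.sum_div, Finset.sum_div]
        refine Finset.sum_congr rfl fun a _ => ?_
        field_simp)
    rw [Finset.sum_div]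
    simpa only [mul_div_assoc] using h1

end Neighbour

section NeighbourVector

variable {K : Type} [Field K]

/-- A vector divisible by `1 + t ^ 2` up to rotation of its last two coordinates. -/
def neighbourVector (n : ℕ) (t : 𝓞 K) (b c : ℤ) : Fin (n + 2) ⊕ Fin 2 → 𝓞 K :=
  Sum.elim (fun _ => 1 + t ^ 2)
    ![(1 - t ^ 2) * b - 2 * t * c, 2 * t * b + (1 - t ^ 2) * c]

variable {n q : ℕ} {t : 𝓞 K} {b c : ℤ}

lemma neighbourVector_mul_self :
    ∑ a, neighbourVector n t b c a * neighbourVector n t b c a =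
      (1 + t ^ 2) ^ 2 * ((n + 2 + b ^ 2 + c ^ 2 : ℤ) : 𝓞 K) := by
  simp [neighbourVector, Fin.sum_univ_two]
  ring

lemma isIntegral_neighbourVector_mul_self (hq : q ≠ 0) [CharZero K]
    (h : (q : ℤ) ^ 2 ∣ n + 2 + b ^ 2 + c ^ 2) :
    IsIntegral ℤ ((∑ a, (neighbourVector n t b c a : K) * neighbourVector n t b c a) /
      (q : K) ^ 2) := by
  obtain ⟨k, hk⟩ := h
  have h1 := congrArg (fun x : 𝓞 K => (x : K)) (neighbourVector_mul_self (t := t) (b := b)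
    (c := c) (n := n))
  rw [hk] at h1
  simp only [map_sum, map_mul, Int.cast_mul, Int.cast_pow, Int.cast_natCast, map_pow,
    map_natCast, map_intCast] at h1
  have hqK : (q : K) ≠ 0 := Nat.cast_ne_zero.mpr hq
  rw [h1]
  refine Eq.subst (motive := fun z : K => IsIntegral ℤ z) ?_
    ((1 + t ^ 2) ^ 2 * (k : 𝓞 K)).isIntegral_coe
  simp only [map_mul, map_pow, map_intCast]
  field_simp

lemma exists_sum_mul_neighbourVector (h : IsCoprime (q : ℤ) (2 * (b ^ 2 + c ^ 2))) :
    ∃ (u : Fin (n + 2) ⊕ Fin 2 → 𝓞 K) (s : 𝓞 K),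
      ∑ a, u a * neighbourVector n t b c a = 1 + q * s := by
  obtain ⟨s, k, hsk⟩ := h
  refine ⟨Sum.elim (Pi.single 0 (k * (b ^ 2 + c ^ 2) : 𝓞 K)) ![(k * b : 𝓞 K), (k * c : 𝓞 K)],
    -s, ?_⟩
  have h1 := congrArg (fun x : ℤ => (x : 𝓞 K)) hsk
  push_cast at h1
  simp [neighbourVector, Fin.sum_univ_two, Pi.single_apply]
  linear_combination h1

variable [NumberField K] (hq : q ≠ 0)
  (hv : IsIntegral ℤ ((∑ a, (neighbourVector n t b c a : K) * neighbourVector n t b c a) /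
      (q : K) ^ 2))

lemma isIntegral_of_mem_neighbourLattice (h : IsCoprime (q : ℤ) (2 * (b ^ 2 + c ^ 2)))
    {F : IntermediateField ℚ K}
    (ht : ∀ z ∈ F, ∀ z' ∈ F, IsIntegral ℤ (q * z) → IsIntegral ℤ (z * t - z') → IsIntegral ℤ z)
    {x : Fin (n + 2) ⊕ Fin 2 → K}
    (hx : x ∈ (neighbourLattice (neighbourVector n t b c) hq hv).carrier) (hxF : ∀ a, x a ∈ F)
    (a : Fin (n + 2) ⊕ Fin 2) : IsIntegral ℤ (x a) := by
  obtain ⟨e, he⟩ := hx.1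
  have hq' : (q : K) ≠ 0 := Nat.cast_ne_zero.mpr hq
  have hb : (b : K) ∈ F := intCast_mem F b
  have hc : (c : K) ∈ F := intCast_mem F c
  have hb' : IsIntegral ℤ (b : K) := isIntegral_intCast b
  have hc' : IsIntegral ℤ (c : K) := isIntegral_intCast c
  have hqx := isIntegral_mul_of_mem_neighbourLattice hq hv hx
  have h0 := he (Sum.inl 0)
  have h1 := he (Sum.inr 0)
  have h2 := he (Sum.inr 1)
  simp only [neighbourVector, Sum.elim_inl, Sum.elim_inr, Matrix.cons_val_zero,
    Matrix.cons_val_one, map_add, map_sub, map_mul, map_pow, map_one, map_intCast,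
    map_ofNat] at h0 h1 h2
  have hz : IsIntegral ℤ (((b : K) ^ 2 + c ^ 2) * x (Sum.inl 0) + b * x (Sum.inr 0) +
      c * x (Sum.inr 1)) := by
    refine ht _ ?_ (-c * x (Sum.inr 0) + b * x (Sum.inr 1)) ?_ ?_ ?_
    · exact add_mem (add_mem (mul_mem (add_mem (pow_mem hb 2) (pow_mem hc 2)) (hxF _))
        (mul_mem hb (hxF _))) (mul_mem hc (hxF _))
    · exact add_mem (mul_mem (neg_mem hc) (hxF _)) (mul_mem hb (hxF _))
    · refine Eq.subst (motive := fun z : K => IsIntegral ℤ z) ?_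
        (((((hb'.pow 2).add (hc'.pow 2)).mul (hqx (Sum.inl 0))).add
          (hb'.mul (hqx (Sum.inr 0)))).add (hc'.mul (hqx (Sum.inr 1))))
      ring
    · refine Eq.subst (motive := fun z : K => IsIntegral ℤ z) ?_
        ((t.isIntegral_coe.mul (((((hb'.pow 2).add (hc'.pow 2)).mul h0).add (hb'.mul h1)).add
          (hc'.mul h2))).sub ((hc'.neg.mul h1).add (hb'.mul h2)))
      ring
  have hz2 := hz.sub (((((hb'.pow 2).add (hc'.pow 2)).mul h0).add (hb'.mul h1)).add
          (hc'.mul h2))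
  obtain ⟨s, k, hsk⟩ := h
  have hsk' := congrArg (fun x : ℤ => (x : K)) hsk
  push_cast at hsk'
  have hk : IsIntegral ℤ (k : K) := isIntegral_intCast k
  have hs : IsIntegral ℤ (s : K) := isIntegral_intCast s
  have heq : IsIntegral ℤ ((e : K) / q) := by
    refine Eq.subst (motive := fun z : K => IsIntegral ℤ z) ?_
      ((hk.mul hz2).add (hs.mul e.isIntegral_coe))
    field_simp
    linear_combination (e : K) * hsk'
  refine Eq.subst (motive := fun z : K => IsIntegral ℤ z) ?_
    ((he a).add (heq.mul (neighbourVector n t b c a).isIntegral_coe))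
  ring

lemma form_ne_one_of_isIntegral (hK : TotallyReal K)
    (hdvd : ∀ a, ¬ (q : 𝓞 K) ∣ neighbourVector n t b c a) {x : Fin (n + 2) ⊕ Fin 2 → K}
    (hx : x ∈ (neighbourLattice (neighbourVector n t b c) hq hv).carrier)
    (hxi : ∀ a, IsIntegral ℤ (x a)) :
    (neighbourLattice (neighbourVector n t b c) hq hv).form x x ≠ 1 := by
  classical
  intro h1
  rw [neighbourLattice_form] at h1
  have hq' : (q : K) ≠ 0 := Nat.cast_ne_zero.mpr hq
  choose y hy using fun a => isIntegral_iff_exists.mp (hxi a)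
  have hsum : ∀ σ : K →+* ℝ, ∑ a, σ (x a) * σ (x a) = 1 := fun σ => by
    simpa using congrArg σ h1
  obtain ⟨a, ha⟩ : ∃ a, x a ≠ 0 := by
    by_contra! h
    simp [h] at h1
  have hle : ∀ σ : K →+* ℝ, ∀ s : Finset (Fin (n + 2) ⊕ Fin 2),
      ∑ b ∈ s, σ (x b) * σ (x b) ≤ 1 := fun σ s => by
    rw [← hsum σ]
    exact Finset.sum_le_sum_of_subset_of_nonneg (Finset.subset_univ s)
      fun b _ _ => mul_self_nonneg _
  have h2 : y a * y a = 1 := by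
    refine (eq_zero_or_one hK (x := y a * y a) (fun σ => ?_) fun σ => ?_).resolve_left fun h => ?_
    · simp only [map_mul]
      exact mul_self_nonneg _
    · simp only [map_mul, hy]
      simpa using hle σ {a}
    · rw [mul_self_eq_zero] at h
      rw [← hy, h] at ha
      exact ha rfl
  have h3 : ∀ b ≠ a, x b = 0 := fun b hb => by
    obtain ⟨σ⟩ := TotallyReal.nonempty_emb hK
    have h4 := hle σ {a, b}
    rw [Finset.sum_pair hb.symm] at h4
    have h5 := congrArg (fun z : 𝓞 K => σ (z : K)) h2
    simp only [map_mul, hy, map_one] at h5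
    have h6 : σ (x b) * σ (x b) = 0 := le_antisymm (by linarith) (mul_self_nonneg _)
    simpa using h6
  have h4 := hx.2
  rw [Finset.sum_eq_single a (fun b _ hb => by rw [h3 b hb, zero_mul]) (by simp)] at h4
  obtain ⟨z, hz⟩ := isIntegral_iff_exists.mp h4
  refine hdvd a ⟨y a * z, RingOfIntegers.ext ?_⟩
  have h5 := congrArg (fun z : 𝓞 K => (z : K)) h2
  simp only [map_mul, hy, map_one] at h5
  simp only [map_mul, map_natCast, hz, hy]
  field_simp
  linear_combination -(neighbourVector n t b c a : K) * h5

end NeighbourVector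

/-- A unimodular lattice without vectors of norm one, containing a root system of type `A` and a
frame of orthogonal vectors which generates the vectors of small norm up to a factor `q`. -/
structure RootBlock (K : Type) [Field K] (n q : ℕ) (X : ℝ) : Type 1 where
  lattice : OKLattice K
  rank_le : lattice.rank ≤ n + 4
  exists_form_eq : ∀ f : lattice.carrier →ₗ[𝓞 K] 𝓞 K, ∃ z, ∀ x, lattice.form z x = f x
  form_ne_one : ∀ x, lattice.form x x ≠ 1
  root : Fin (n + 1) → lattice.carrier
  form_root : ∀ i, lattice.form (root i) (root i) = 2
  form_root_succ : ∀ i : Fin n, lattice.form (root i.castSucc) (root i.succ) ≠ 0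
  linearIndependent_root : LinearIndependent (𝓞 K) root
  frame : Fin (n + 2) ⊕ Fin 2 → lattice.carrier
  form_frame : ∀ a b, lattice.form (frame a) (frame b) = if a = b then (q : 𝓞 K) ^ 2 else 0
  exists_sq_smul_eq : ∀ x, ∃ y : Fin (n + 2) ⊕ Fin 2 → 𝓞 K,
    (q : 𝓞 K) ^ 2 • x = ∑ a, y a • frame a
  exists_smul_eq : ∀ x, (∀ σ : K →+* ℝ, σ (lattice.form x x : 𝓞 K) ≤ X) →
    ∃ y : Fin (n + 2) ⊕ Fin 2 → 𝓞 K, (q : 𝓞 K) • x = ∑ a, y a • frame a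

section Existence

variable {K : Type} [Field K] [NumberField K]

lemma not_isUnit_natCast_ringOfIntegers {q : ℕ} (hq : q.Prime) : ¬ IsUnit (q : 𝓞 K) := fun h => by
  rw [← map_natCast (algebraMap ℤ (𝓞 K)), isUnit_map_iff, Int.isUnit_iff_natAbs_eq] at h
  exact hq.one_lt.ne' h

section Root

variable {n q : ℕ} {t : 𝓞 K} {b c : ℤ} (hq : q ≠ 0)
  (hv : IsIntegral ℤ ((∑ a, (neighbourVector n t b c a : K) * neighbourVector n t b c a) /
      (q : K) ^ 2))

lemma root_mem_neighbourLattice (i : Fin (n + 1)) :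
    Pi.single (Sum.inl i.castSucc) 1 - Pi.single (Sum.inl i.succ) 1 ∈
      (neighbourLattice (neighbourVector n t b c) hq hv).carrier := by
  refine ⟨⟨0, fun a => ?_⟩, ?_⟩
  · rw [show ((0 : 𝓞 K) : K) = 0 from rfl, zero_div, zero_mul, sub_zero]
    refine IsIntegral.sub ?_ ?_ <;>
    · rw [Pi.single_apply]
      split_ifs
      exacts [isIntegral_one, isIntegral_zero]
  · simpa [sub_mul, Pi.single_apply, neighbourVector] using isIntegral_zero

lemma linearIndependent_root_neighbourLattice :
    LinearIndependent (𝓞 K) fun i : Fin (n + 1) =>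
      (⟨_, root_mem_neighbourLattice hq hv i⟩ :
        (neighbourLattice (neighbourVector n t b c) hq hv).carrier) := by
  refine LinearIndependent.of_comp
    (neighbourLattice (neighbourVector n t b c) hq hv).carrier.subtype ?_
  have h : LinearIndependent K fun i : Fin (n + 1) =>
      (Pi.single (Sum.inl i.castSucc) 1 - Pi.single (Sum.inl i.succ) 1 :
        Fin (n + 2) ⊕ Fin 2 → K) := by
    refine LinearIndependent.of_pairwise_dual_eq_zero_one _
      (fun j => ∑ k ∈ Finset.Iic j.castSucc, LinearMap.proj (Sum.inl k)) (fun j i hij => ?_)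
      fun j => ?_
    · simp only [LinearMap.sum_apply, LinearMap.proj_apply, Pi.sub_apply, Pi.single_apply,
        Sum.inl.injEq, Finset.sum_sub_distrib, Finset.sum_ite_eq', Finset.mem_Iic]
      have h1 : i.succ ≤ j.castSucc ↔ i.castSucc ≤ j.castSucc := by
        have : (i : ℕ) ≠ j := fun h => hij (Fin.ext h.symm)
        simp only [Fin.le_def, Fin.val_succ, Fin.val_castSucc]
        omega
      simp [h1]
    · simp only [LinearMap.sum_apply, LinearMap.proj_apply, Pi.sub_apply, Pi.single_apply,
        Sum.inl.injEq, Finset.sum_sub_distrib, Finset.sum_ite_eq', Finset.mem_Iic]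
      have h1 : ¬ j.succ ≤ j.castSucc := by
        simp only [Fin.le_def, Fin.val_succ, Fin.val_castSucc]
        omega
      simp [h1]
  exact h.restrict_scalars' (𝓞 K)

end Root

lemma exists_isCoprime_neighbourVector (n : ℕ) {q : ℕ} (hq : q.Prime) (h6 : 6 < q)
    (hqn : ¬ q ∣ n + 2) : ∃ b c : ℤ, (q : ℤ) ^ 2 ∣ n + 2 + b ^ 2 + c ^ 2 ∧
      IsCoprime (q : ℤ) (2 * (b ^ 2 + c ^ 2)) ∧ ¬ ((q : ℤ) ∣ b ∧ (q : ℤ) ∣ c) := by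
  have hq' : Prime (q : ℤ) := Nat.prime_iff_prime_int.mp hq
  have hr : ¬ (q : ℤ) ∣ n + 2 := by exact_mod_cast hqn
  obtain ⟨b, c, h⟩ := Int.exists_sq_dvd_add_sq_add_sq hq (by omega) hr
  have h1 : ¬ (q : ℤ) ∣ b ^ 2 + c ^ 2 := fun h1 => hr <| by
    have h2 := dvd_sub ((dvd_pow_self (q : ℤ) two_ne_zero).trans h) h1
    ring_nf at h2 ⊢
    exact h2
  refine ⟨b, c, h, hq'.coprime_iff_not_dvd.mpr fun h2 => (hq'.dvd_or_dvd h2).elim (fun h3 => ?_) h1,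
    fun h2 => h1 (dvd_add (h2.1.pow two_ne_zero) (h2.2.pow two_ne_zero))⟩
  have := Int.le_of_dvd two_pos h3
  omega

lemma nonempty_rootBlock (n : ℕ) {q : ℕ} (hq : q.Prime) (h6 : 6 < q) (hqn : ¬ q ∣ n + 2)
    {X : ℝ} (hX : 1 ≤ X) (hK : TotallyReal K) {F : IntermediateField ℚ K} (hF : F ≠ ⊤)
    (h : ∀ x : 𝓞 K, (∀ σ : K →+* ℝ, |σ x| ≤ q * (X + 1)) → (x : K) ∈ F) :
    Nonempty (RootBlock K n q X) := by
  classical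
  obtain ⟨b, c, hbc, hcop, hbc'⟩ := exists_isCoprime_neighbourVector n hq h6 hqn
  have hq0 : q ≠ 0 := hq.ne_zero
  have hqK : (q : K) ≠ 0 := Nat.cast_ne_zero.mpr hq0
  obtain ⟨t₀, ht₀⟩ := exists_forall_isIntegral_of_isIntegral_mul_sub hF
    (a := (q : 𝓞 F)) (Nat.cast_ne_zero.mpr hq0)
  obtain ⟨m, hm⟩ := exists_nat_forall_not_dvd hq h6 (not_isUnit_natCast_ringOfIntegers hq) t₀ hbc'
  set t : 𝓞 K := t₀ + m with ht_def
  have ht : ∀ z ∈ F, ∀ z' ∈ F, IsIntegral ℤ (q * z) → IsIntegral ℤ (z * t - z') →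
      IsIntegral ℤ z := fun z hz z' hz' h1 h2 => by
    refine ht₀ z hz (z' - m * z) (sub_mem hz' (mul_mem (natCast_mem F m) hz)) (by simpa using h1) ?_
    refine Eq.subst (motive := fun z : K => IsIntegral ℤ z) ?_ h2
    simp only [ht_def, map_add, map_natCast]
    ring
  have hdvd : ∀ a, ¬ (q : 𝓞 K) ∣ neighbourVector n t b c a := by
    rintro (a | a)
    · exact hm.1
    · fin_cases a
      exacts [hm.2.1, hm.2.2]
  have hv := isIntegral_neighbourVector_mul_self (K := K) (t := t) hq0 hbc
  obtain ⟨u, s, hu⟩ := exists_sum_mul_neighbourVector (n := n) (t := t) hcop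
  set Q := neighbourLattice (neighbourVector n t b c) hq0 hv with hQ
  have hint : ∀ x ∈ Q.carrier, (∀ σ : K →+* ℝ, σ (Q.form x x) ≤ X) → ∀ a, IsIntegral ℤ (x a) :=
    fun x hx hσ => by
    refine isIntegral_of_mem_neighbourLattice hq0 hv hcop ht hx fun a => ?_
    obtain ⟨y, hy⟩ := isIntegral_iff_exists.mp
      (isIntegral_mul_of_mem_neighbourLattice hq0 hv hx a)
    have h1 : (y : K) ∈ F := h y fun σ => by
      rw [hy, map_mul, map_natCast, abs_mul, Nat.abs_cast]
      refine mul_le_mul_of_nonneg_left ?_ (Nat.cast_nonneg q)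
      have h2 := hσ σ
      rw [hQ, neighbourLattice_form, map_sum] at h2
      have h3 := (Finset.single_le_sum (f := fun a => σ (x a * x a)) (fun b _ => by
        simp only [map_mul]
        exact mul_self_nonneg _) (Finset.mem_univ a)).trans h2
      simp only [map_mul] at h3
      refine abs_le_of_sq_le_sq ?_ (by linarith)
      nlinarith
    rw [hy] at h1
    have h2 := mul_mem (inv_mem (natCast_mem F q)) h1
    rwa [inv_mul_cancel_left₀ hqK] at h2
  exact ⟨{
    lattice := Q.toOKLattice
    rank_le := Q.rank_toOKLattice_le.trans (by simp)
    exists_form_eq := fun f => by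
      obtain ⟨z, hz, h1⟩ := exists_form_eq_neighbourLattice hq0 hv hu f
      exact ⟨⟨z, hz⟩, fun x => RingOfIntegers.ext (h1 x)⟩
    form_ne_one := fun x h1 => by
      have h2 : Q.form x.1 x.1 = 1 := congrArg (fun z : 𝓞 K => (z : K)) h1
      refine form_ne_one_of_isIntegral hq0 hv hK hdvd x.2 (hint x.1 x.2 fun σ => ?_) h2
      rw [h2, map_one]
      exact hX
    root := fun i => ⟨_, root_mem_neighbourLattice hq0 hv i⟩
    form_root := fun i => RingOfIntegers.ext (by
      refine (neighbourLattice_form hq0 hv _ _).trans ?_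
      have : i.castSucc ≠ i.succ := i.castSucc_lt_succ.ne
      simp [Pi.single_apply, mul_sub, this, this.symm]
      norm_num
      exact (map_ofNat (algebraMap (𝓞 K) K) 2).symm)
    form_root_succ := fun i h1 => by
      have h2 := (neighbourLattice_form hq0 hv _ _).symm.trans
        (congrArg (fun z : 𝓞 K => (z : K)) h1)
      have h3 : i.castSucc.castSucc ≠ i.succ.castSucc := by simp [Fin.ext_iff]
      have h4 : i.castSucc.castSucc ≠ i.succ.succ := by
        simp only [ne_eq, Fin.ext_iff, Fin.val_castSucc, Fin.val_succ]
        omega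
      have h6 : i.castSucc.succ ≠ i.castSucc.castSucc := by simp [Fin.ext_iff]
      have h7 : i.succ ≠ i.castSucc := by simp [Fin.ext_iff]
      simp [Pi.single_apply, mul_sub, h4.symm, h6, h7] at h2
    linearIndependent_root := linearIndependent_root_neighbourLattice hq0 hv
    frame := fun a => ⟨_, single_mem_neighbourLattice hq0 hv a⟩
    form_frame := fun a a' => RingOfIntegers.ext (by
      refine (neighbourLattice_form hq0 hv _ _).trans ?_
      rw [apply_ite (fun z : 𝓞 K => (z : K))]
      simp only [map_pow, map_natCast, map_zero]
      rcases eq_or_ne a a' with rfl | h1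
      · simp [Pi.single_apply, sq]
      · simp [Pi.single_apply, h1, h1.symm])
    exists_sq_smul_eq := fun x => by
      choose y hy using fun a => isIntegral_iff_exists.mp
        (isIntegral_mul_of_mem_neighbourLattice hq0 hv x.2 a)
      refine ⟨y, smul_eq_sum_single_neighbourLattice hq0 hv x fun a => ?_⟩
      rw [hy]
      simp only [map_pow, map_natCast]
      ring
    exists_smul_eq := fun x hx => by
      choose y hy using fun a => isIntegral_iff_exists.mp (hint x.1 x.2 hx a)
      refine ⟨y, smul_eq_sum_single_neighbourLattice hq0 hv x fun a => ?_⟩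
      rw [hy]
      simp only [map_natCast]
      ring }⟩

end Existence

namespace OKLattice

variable {K : Type} [Field K]

section Orthogonal

lemma form_add_self_of_form_eq_zero (L : OKLattice K) {x y : L.carrier} (h : L.form x y = 0) :
    L.form (x + y) (x + y) = L.form x x + L.form y y := by
  have h' : L.form y x = 0 := by rw [L.symm, h]
  simp [h, h']

variable {L : OKLattice K} {P P' : L.carrier →ₗ[𝓞 K] L.carrier}

lemma form_idempotent_sub (hP : ∀ x, P (P x) = P x) (hP' : ∀ x y, L.form (P x) y = L.form x (P y))
    (x : L.carrier) : L.form (P x) (x - P x) = 0 := by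
  rw [hP', map_sub, hP, sub_self, map_zero]

lemma form_idempotent_le (hP : ∀ x, P (P x) = P x)
    (hP' : ∀ x y, L.form (P x) y = L.form x (P y)) (x : L.carrier) (σ : K →+* ℝ) :
    σ (L.form (P x) (P x) : 𝓞 K) ≤ σ (L.form x x : 𝓞 K) := by
  have h := form_add_self_of_form_eq_zero L (form_idempotent_sub hP hP' x)
  rw [add_sub_cancel] at h
  rw [h]
  simp only [map_add]
  exact le_add_of_nonneg_right (L.form_self_nonneg _ σ)

lemma exists_trace_form [NumberField K] (hK : TotallyReal K) (L : OKLattice K) (x : L.carrier) :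
    ∃ m : ℕ, (m : ℝ) = ∑ σ : K →+* ℝ, σ (L.form x x : 𝓞 K) := by
  have h := trace_int_eq hK (L.form x x)
  have h0 : 0 ≤ ∑ σ : K →+* ℝ, σ (L.form x x : 𝓞 K) :=
    Finset.sum_nonneg fun σ _ => L.form_self_nonneg x σ
  rw [← h] at h0 ⊢
  obtain ⟨m, hm⟩ := Int.eq_ofNat_of_zero_le (a := Algebra.trace ℤ (𝓞 K) (L.form x x))
    (by exact_mod_cast h0)
  exact ⟨m, by rw [hm]; simp⟩

/-- Orthogonal idempotents of a positive definite lattice commute. -/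
lemma idempotent_comm [NumberField K] (hK : TotallyReal K)
    (hP : ∀ x, P (P x) = P x) (hPs : ∀ x y, L.form (P x) y = L.form x (P y))
    (hP' : ∀ x, P' (P' x) = P' x) (hPs' : ∀ x y, L.form (P' x) y = L.form x (P' y))
    (x : L.carrier) : P (P' x) = P' (P x) := by
  choose m hm using exists_trace_form hK L
  obtain ⟨σ₀⟩ := hK.nonempty_emb
  have hlt : ∀ y z, L.form y z = 0 → y ≠ 0 → z ≠ 0 → m y < m (y + z) ∧ m z < m (y + z) := by
    intro y z hyz hy hz
    have h1 : (m (y + z) : ℝ) = m y + m z := by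
      rw [hm, hm, hm, form_add_self_of_form_eq_zero L hyz, ← Finset.sum_add_distrib]
      exact Finset.sum_congr rfl fun σ _ => by simp only [map_add]
    have hpos : ∀ y, y ≠ 0 → 0 < m y := fun y hy => by
      have : (0 : ℝ) < m y := by
        rw [hm]
        exact Finset.sum_pos (fun σ _ => L.posDef y hy σ) ⟨σ₀, Finset.mem_univ _⟩
      exact_mod_cast this
    have h2 : m (y + z) = m y + m z := by exact_mod_cast h1
    have := hpos y hy
    have := hpos z hz
    omega
  induction hk : m x using Nat.strong_induction_on generalizing x with
  | _ k ih =>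
    subst hk
    have split : ∀ y z, x = y + z → L.form y z = 0 → y ≠ 0 → z ≠ 0 → P (P' x) = P' (P x) := by
      rintro y z rfl hyz hy hz
      have h1 := ih _ (hlt y z hyz hy hz).1 y rfl
      have h2 := ih _ (hlt y z hyz hy hz).2 z rfl
      simp only [map_add, h1, h2]
    by_cases h1 : P x = 0
    · by_cases h2 : P' x = 0
      · rw [h1, h2, map_zero, map_zero]
      by_cases h3 : x - P' x = 0
      · rw [← sub_eq_zero.mp h3, h1, map_zero]
      exact split (P' x) (x - P' x) (by abel) (form_idempotent_sub hP' hPs' x) h2 h3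
    by_cases h2 : x - P x = 0
    · have h3 := (sub_eq_zero.mp h2).symm
      by_cases h4 : P' x = 0
      · rw [h3, h4, map_zero]
      by_cases h5 : x - P' x = 0
      · rw [← sub_eq_zero.mp h5, h3, ← sub_eq_zero.mp h5]
      exact split (P' x) (x - P' x) (by abel) (form_idempotent_sub hP' hPs' x) h4 h5
    exact split (P x) (x - P x) (by abel) (form_idempotent_sub hP hPs x) h1 h2

end Orthogonal

section Projection

lemma ext_of_form_eq (L : OKLattice K) (σ : K →+* ℝ) {x y : L.carrier}
    (h : ∀ z, L.form x z = L.form y z) : x = y :=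
  sub_eq_zero.mp (L.eq_zero_of_form_self σ (by
    simp only [map_sub, LinearMap.sub_apply, h, sub_self]))

lemma exists_projection (σ : K →+* ℝ) {L E : OKLattice K} (τ : E.carrier →ₗ[𝓞 K] L.carrier)
    (hE : ∀ f : E.carrier →ₗ[𝓞 K] 𝓞 K, ∃ z, ∀ x, E.form z x = f x) :
    ∃ π : L.carrier →ₗ[𝓞 K] E.carrier, ∀ x y, E.form (π x) y = L.form x (τ y) := by
  choose π hπ using fun x => hE (L.form x ∘ₗ τ)
  simp only [LinearMap.comp_apply] at hπ
  exact ⟨{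
    toFun := π
    map_add' := fun x y => E.ext_of_form_eq σ fun z => by simp [hπ]
    map_smul' := fun c x => E.ext_of_form_eq σ fun z => by simp [hπ] }, hπ⟩

variable {L E : OKLattice K} {τ : E.carrier →ₗ[𝓞 K] L.carrier}
  {π : L.carrier →ₗ[𝓞 K] E.carrier}

lemma projection_apply (hτ : ∀ x y, L.form (τ x) (τ y) = E.form x y)
    (hπ : ∀ x y, E.form (π x) y = L.form x (τ y))
    (σ : K →+* ℝ) (x : E.carrier) : π (τ x) = x :=
  E.ext_of_form_eq σ fun z => by rw [hπ, hτ]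

lemma projection_idempotent (hτ : ∀ x y, L.form (τ x) (τ y) = E.form x y)
    (hπ : ∀ x y, E.form (π x) y = L.form x (τ y))
    (σ : K →+* ℝ) (x : L.carrier) :
    (τ ∘ₗ π) ((τ ∘ₗ π) x) = (τ ∘ₗ π) x := by
  simp only [LinearMap.comp_apply, projection_apply hτ hπ σ]

lemma projection_selfAdjoint (hπ : ∀ x y, E.form (π x) y = L.form x (τ y))
    (x y : L.carrier) :
    L.form ((τ ∘ₗ π) x) y = L.form x ((τ ∘ₗ π) y) := by
  simp only [LinearMap.comp_apply]
  rw [L.symm, ← hπ, ← hπ, E.symm]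

lemma form_projection_le (hτ : ∀ x y, L.form (τ x) (τ y) = E.form x y)
    (hπ : ∀ x y, E.form (π x) y = L.form x (τ y))
    (σ : K →+* ℝ) (x : L.carrier) (σ' : K →+* ℝ) :
    σ' (E.form (π x) (π x) : 𝓞 K) ≤ σ' (L.form x x : 𝓞 K) := by
  rw [← hτ]
  exact form_idempotent_le (projection_idempotent hτ hπ σ) (projection_selfAdjoint hπ) x σ'

/-- Vectors of norm two of a unimodular sublattice without vectors of norm one are
indecomposable. -/
lemma eq_zero_or_eq_zero_of_form_eq_two [NumberField K] (hK : TotallyReal K)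
    (hτ : ∀ x y, L.form (τ x) (τ y) = E.form x y)
    (hπ : ∀ x y, E.form (π x) y = L.form x (τ y))
    (h1 : ∀ x, E.form x x ≠ 1) {ρ : E.carrier} (hρ : E.form ρ ρ = 2) {x y : L.carrier}
    (hxy : τ ρ = x + y) (h0 : L.form x y = 0) : x = 0 ∨ y = 0 := by
  by_contra! h
  obtain ⟨σ₀⟩ := hK.nonempty_emb
  have h2 := form_add_self_of_form_eq_zero L h0
  rw [← hxy, hτ, hρ] at h2
  have hx1 : L.form x x = 1 := eq_one_of_pos_of_lt_two hK (L.posDef x h.1) fun σ => by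
    have h3 := congrArg (fun z : 𝓞 K => σ (z : K)) h2
    simp only [map_add, map_ofNat] at h3
    linarith [show (0 : ℝ) < σ (L.form y y : 𝓞 K) from L.posDef y h.2 σ]
  have hu : E.form (π x) ρ = 1 := by rw [hπ, hxy, map_add, hx1, h0, add_zero]
  have hle := form_projection_le hτ hπ σ₀ x
  rw [hx1] at hle
  refine h1 (π x) ((eq_zero_or_one hK (E.form_self_nonneg (π x)) fun σ => ?_).resolve_left
    fun h3 => ?_)
  · simpa only [map_one] using hle σ
  · rw [E.eq_zero_of_form_self σ₀ h3, map_zero, LinearMap.zero_apply] at hu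
    exact zero_ne_one hu

end Projection

end OKLattice

namespace RootBlock

variable {K : Type} [Field K] [NumberField K] {n q q' : ℕ} {X : ℝ} {L : OKLattice K}
  {B : RootBlock K n q X} {B' : RootBlock K n q' X}
  {τ : B.lattice.carrier →ₗ[𝓞 K] L.carrier} {τ' : B'.lattice.carrier →ₗ[𝓞 K] L.carrier}
  {π : L.carrier →ₗ[𝓞 K] B.lattice.carrier} {π' : L.carrier →ₗ[𝓞 K] B'.lattice.carrier}

lemma exists_smul_eq_of_fixed (hK : TotallyReal K) (hqq : q.Coprime q') (hX : (q' : ℝ) ^ 2 ≤ X)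
    (hτ : ∀ x y, L.form (τ x) (τ y) = B.lattice.form x y)
    (hπ : ∀ x y, B.lattice.form (π x) y = L.form x (τ y))
    (hτ' : ∀ x y, L.form (τ' x) (τ' y) = B'.lattice.form x y)
    {z : L.carrier} (hz : τ (π z) = z) (hz' : τ' (π' z) = z) :
    ∃ y : Fin (n + 2) ⊕ Fin 2 → 𝓞 K, (q : 𝓞 K) • z = ∑ a, y a • τ (B.frame a) := by
  obtain ⟨σ₀⟩ := hK.nonempty_emb
  obtain ⟨d, hd⟩ := B.exists_sq_smul_eq (π z)
  obtain ⟨d', hd'⟩ := B'.exists_sq_smul_eq (π' z)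
  choose e he using fun b => B.exists_smul_eq (π (τ' (B'.frame b))) fun σ => by
    refine (OKLattice.form_projection_le hτ hπ σ₀ _ σ).trans ?_
    rw [hτ', B'.form_frame, if_pos rfl]
    simpa only [map_pow, map_natCast] using hX
  let S : Submodule (𝓞 K) L.carrier := Submodule.span (𝓞 K) (Set.range fun a => τ (B.frame a))
  have hS : ∀ y : Fin (n + 2) ⊕ Fin 2 → 𝓞 K, τ (∑ a, y a • B.frame a) ∈ S := fun y => by
    rw [map_sum]
    refine sum_mem fun a _ => ?_
    rw [map_smul]
    exact S.smul_mem _ (Submodule.subset_span ⟨a, rfl⟩)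
  have h1 : (q : 𝓞 K) ^ 2 • z ∈ S := by
    have := hS d
    rwa [← hd, map_smul, hz] at this
  have h2 : (q : 𝓞 K) • (q' : 𝓞 K) ^ 2 • z ∈ S := by
    have h3 : (q' : 𝓞 K) ^ 2 • z = ∑ b, d' b • τ (π (τ' (B'.frame b))) := by
      conv_lhs => rw [← hz, ← hz']
      rw [← map_smul, ← map_smul, ← map_smul, hd']
      simp only [map_sum, map_smul]
    rw [h3, Finset.smul_sum]
    refine sum_mem fun b _ => ?_
    rw [smul_comm, ← map_smul, he]
    exact S.smul_mem _ (hS _)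
  have hcop : IsCoprime ((q : 𝓞 K) ^ 2) ((q' : 𝓞 K) ^ 2) := by
    have := (Nat.isCoprime_iff_coprime.mpr hqq).map (algebraMap ℤ (𝓞 K))
    simp only [map_natCast] at this
    exact this.pow
  obtain ⟨u, w, huw⟩ := hcop
  have h3 : (q : 𝓞 K) • z ∈ S := by
    have h4 := add_mem (S.smul_mem (u * q) h1) (S.smul_mem w h2)
    convert h4 using 1
    rw [smul_smul, smul_smul, smul_smul, ← add_smul]
    congr 1
    linear_combination -(q : 𝓞 K) * huw
  obtain ⟨y, hy⟩ := (Submodule.mem_span_range_iff_exists_fun (𝓞 K)).mp h3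
  exact ⟨y, hy.symm⟩

/-- Two blocks with coprime parameters in a common lattice share no vector. -/
lemma eq_zero_of_fixed (hK : TotallyReal K) (hq : q ≠ 0) (hqq : q.Coprime q')
    (hX : (q' : ℝ) ^ 2 ≤ X)
    (hτ : ∀ x y, L.form (τ x) (τ y) = B.lattice.form x y)
    (hπ : ∀ x y, B.lattice.form (π x) y = L.form x (τ y))
    (hτ' : ∀ x y, L.form (τ' x) (τ' y) = B'.lattice.form x y)
    (hπ' : ∀ x y, B'.lattice.form (π' x) y = L.form x (τ' y))
    {z : L.carrier} (hz : τ (π z) = z) (hz' : τ' (π' z) = z) : z = 0 := by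
  classical
  obtain ⟨σ₀⟩ := hK.nonempty_emb
  have hq0 : (q : 𝓞 K) ≠ 0 := Nat.cast_ne_zero.mpr hq
  have hcomm : ∀ x, τ (π (τ' (π' x))) = τ' (π' (τ (π x))) :=
    OKLattice.idempotent_comm hK (OKLattice.projection_idempotent hτ hπ σ₀)
      (OKLattice.projection_selfAdjoint hπ) (OKLattice.projection_idempotent hτ' hπ' σ₀)
      (OKLattice.projection_selfAdjoint hπ')
  have hid := OKLattice.projection_apply hτ hπ σ₀
  have hid' := OKLattice.projection_apply hτ' hπ' σ₀
  have hself : ∀ x y, L.form (τ (π x)) y = L.form x (τ (π y)) :=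
    OKLattice.projection_selfAdjoint hπ
  have hself' : ∀ x y, L.form (τ' (π' x)) y = L.form x (τ' (π' y)) :=
    OKLattice.projection_selfAdjoint hπ'
  have key : ∀ a, τ' (π' (τ (B.frame a))) = 0 := fun a => by
    have hdvd : ∀ w, ∃ c, L.form (τ' (π' (τ (B.frame a)))) w = q * c := fun w => by
      obtain ⟨y, hy⟩ := exists_smul_eq_of_fixed hK hqq hX hτ hπ hτ'
        (z := τ (π (τ' (π' w)))) (by rw [hid]) (by rw [hcomm, hid'])
      refine ⟨y a, mul_left_cancel₀ hq0 ?_⟩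
      have h1 := congrArg (L.form (τ (B.frame a))) hy
      simp only [map_smul, map_sum, hτ, B.form_frame, smul_eq_mul, mul_ite, mul_zero,
        Finset.sum_ite_eq, Finset.mem_univ, if_true] at h1
      rw [hself', ← hid (B.frame a), hself, hτ, h1]
      ring
    choose c hc using hdvd
    obtain ⟨η, hη⟩ := B.exists_form_eq
      { toFun := fun x => c (τ x)
        map_add' := fun x y => mul_left_cancel₀ hq0 (by
          rw [← hc, mul_add, ← hc, ← hc, map_add, map_add])
        map_smul' := fun r x => mul_left_cancel₀ hq0 (by
          rw [← hc, RingHom.id_apply, smul_eq_mul, mul_left_comm, ← hc, map_smul, map_smul,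
            smul_eq_mul]) }
    have h1 : π (τ' (π' (τ (B.frame a)))) = (q : 𝓞 K) • η := B.lattice.ext_of_form_eq σ₀ fun x => by
      rw [hπ, hc, map_smul, LinearMap.smul_apply, hη, smul_eq_mul]
      rfl
    have h2 : B.lattice.form η η = 0 := by
      refine (eq_zero_or_one hK (B.lattice.form_self_nonneg η) fun σ => ?_).resolve_right
        (B.form_ne_one η)
      have h3 := (OKLattice.form_projection_le hτ hπ σ₀ (τ' (π' (τ (B.frame a)))) σ).trans
        (OKLattice.form_idempotent_le (OKLattice.projection_idempotent hτ' hπ' σ₀)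
          (OKLattice.projection_selfAdjoint hπ') (τ (B.frame a)) σ)
      rw [h1, hτ, B.form_frame, if_pos rfl] at h3
      simp only [map_smul, LinearMap.smul_apply, smul_eq_mul, map_mul, map_pow, map_natCast] at h3
      have hq1 : (0 : ℝ) < q := Nat.cast_pos.mpr (Nat.pos_of_ne_zero hq)
      have h4 : (q : ℝ) ^ 2 * σ (B.lattice.form η η : 𝓞 K) ≤ (q : ℝ) ^ 2 * 1 := by linarith
      exact le_of_mul_le_mul_left h4 (by positivity)
    have h3 := congrArg τ h1
    rwa [hcomm, hid, B.lattice.eq_zero_of_form_self σ₀ h2, smul_zero, map_zero] at h3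
  obtain ⟨d, hd⟩ := B.exists_sq_smul_eq (π z)
  have h1 := congrArg (fun x => τ' (π' (τ x))) hd
  simp only [map_smul, map_sum, key, smul_zero, Finset.sum_const_zero, hz, hz'] at h1
  exact (smul_eq_zero.mp h1).resolve_left (pow_ne_zero 2 hq0)

lemma form_root_eq_zero (hK : TotallyReal K) (hq : q ≠ 0) (hqq : q.Coprime q')
    (hX : (q' : ℝ) ^ 2 ≤ X)
    (hτ : ∀ x y, L.form (τ x) (τ y) = B.lattice.form x y)
    (hτ' : ∀ x y, L.form (τ' x) (τ' y) = B'.lattice.form x y) (i j : Fin (n + 1)) :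
    L.form (τ (B.root i)) (τ' (B'.root j)) = 0 := by
  obtain ⟨σ₀⟩ := hK.nonempty_emb
  obtain ⟨π, hπ⟩ := OKLattice.exists_projection σ₀ τ B.exists_form_eq
  obtain ⟨π', hπ'⟩ := OKLattice.exists_projection σ₀ τ' B'.exists_form_eq
  have hid' := OKLattice.projection_apply hτ' hπ' σ₀
  rcases OKLattice.eq_zero_or_eq_zero_of_form_eq_two hK hτ' hπ' B'.form_ne_one (B'.form_root j)
    (x := τ (π (τ' (B'.root j)))) (y := τ' (B'.root j) - τ (π (τ' (B'.root j)))) (by abel)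
    (OKLattice.form_idempotent_sub (OKLattice.projection_idempotent hτ hπ σ₀)
      (OKLattice.projection_selfAdjoint hπ) _) with h | h
  · rw [L.symm, ← hπ, OKLattice.eq_zero_of_form_self _ σ₀
      (x := π (τ' (B'.root j))) (by rw [← hτ, h, map_zero]), map_zero, LinearMap.zero_apply]
  · rw [eq_zero_of_fixed hK hq hqq hX hτ hπ hτ' hπ' (sub_eq_zero.mp h).symm (by rw [hid']),
      map_zero]

end RootBlock

namespace OKLattice

variable {K : Type} [Field K]

lemma linearIndependent_uncurry {J I : Type} [Fintype J] [Fintype I] (σ : K →+* ℝ)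
    (L : OKLattice K) {v : J → I → L.carrier} (hv : ∀ j, LinearIndependent (𝓞 K) (v j))
    (h : ∀ j j', j ≠ j' → ∀ i i', L.form (v j i) (v j' i') = 0) :
    LinearIndependent (𝓞 K) fun a : J × I => v a.1 a.2 := by
  rw [Fintype.linearIndependent_iff]
  intro g hg a
  rw [Fintype.sum_prod_type] at hg
  refine Fintype.linearIndependent_iff.mp (hv a.1) (fun i => g (a.1, i)) ?_ a.2
  refine L.eq_zero_of_form_self σ ?_
  have h1 := congrArg (L.form (∑ i, g (a.1, i) • v a.1 i)) hg
  rw [map_zero, map_sum, Finset.sum_eq_single a.1] at h1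
  · exact h1
  · intro j _ hj
    simp [h _ _ hj.symm]
  · simp

variable [NumberField K]

/-- The orthogonal complement of a family of vectors. -/
def orthogonal (L : OKLattice K) {ι : Type} (v : ι → L.carrier) : OKLattice K where
  carrier := LinearMap.ker (LinearMap.pi fun i => L.form (v i))
  torsionFree := ⟨fun h =>
    (eq_zero_or_eq_zero_of_smul_eq_zero (congrArg Subtype.val h)).imp_right Subtype.ext⟩
  form := L.form.compl₁₂ (Submodule.subtype _) (Submodule.subtype _)
  symm x y := L.symm x.1 y.1
  posDef x hx σ := L.posDef x.1 (fun h => hx (Subtype.ext h)) σ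

lemma represents_orthogonal {L E : OKLattice K} {ι : Type} {v : ι → L.carrier}
    (φ : E.carrier →ₗ[𝓞 K] L.carrier) (hφ : ∀ x, L.form (φ x) (φ x) = E.form x x)
    (h : ∀ x i, L.form (v i) (φ x) = 0) : (L.orthogonal v).Represents E :=
  ⟨φ.codRestrict (LinearMap.ker (LinearMap.pi fun i => L.form (v i))) fun x =>
    LinearMap.mem_ker.mpr (funext (h x)), hφ⟩

lemma rank_orthogonal_add_card_le {ι : Type} [Fintype ι] (σ : K →+* ℝ) (L : OKLattice K)
    {v : ι → L.carrier} (hv : LinearIndependent (𝓞 K) v) :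
    (L.orthogonal v).rank + Fintype.card ι ≤ L.rank := by
  rw [rank_eq_finrank, rank_eq_finrank]
  let f : L.carrier →ₗ[𝓞 K] ι → 𝓞 K := LinearMap.pi fun i => L.form (v i)
  let g : (ι → 𝓞 K) →ₗ[𝓞 K] L.carrier := Fintype.linearCombination (𝓞 K) v
  have hg : Function.Injective (f.rangeRestrict ∘ₗ g) := by
    rw [← LinearMap.ker_eq_bot, LinearMap.ker_eq_bot']
    intro c hc
    have h1 : ∀ i, L.form (v i) (g c) = 0 := fun i =>
      congrFun (congrArg Subtype.val hc : f (g c) = 0) i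
    have h2 : g c = 0 := by
      refine L.eq_zero_of_form_self σ ?_
      have h3 : L.form (∑ i, c i • v i) (g c) = 0 := by
        simp only [map_sum, map_smul, LinearMap.sum_apply, LinearMap.smul_apply, h1, smul_zero,
          Finset.sum_const_zero]
      exact h3
    exact funext (Fintype.linearIndependent_iff.mp hv c h2)
  have h2 := LinearMap.finrank_le_finrank_of_injective hg
  rw [Module.finrank_fintype_fun_eq_card] at h2
  have h3 := finrank_range_add_finrank_ker_of_isDomain f
  change Module.finrank (𝓞 K) (LinearMap.ker f) + _ ≤ _
  omega

/-- A sublattice of rank at most `n` which contains each member of a connected chain of `n + 1`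
independent vectors or is orthogonal to it, is orthogonal to all of them. -/
lemma form_eq_zero_of_chain {L E : OKLattice K} {n : ℕ} {v : Fin (n + 1) → L.carrier}
    (hv : LinearIndependent (𝓞 K) v) (hsucc : ∀ i : Fin n, L.form (v i.castSucc) (v i.succ) ≠ 0)
    {φ : E.carrier →ₗ[𝓞 K] L.carrier} (hE : E.rank ≤ n)
    (h : ∀ i, (∃ x, φ x = v i) ∨ ∀ x, L.form (φ x) (v i) = 0) (x : E.carrier) (i : Fin (n + 1)) :
    L.form (v i) (φ x) = 0 := by
  have hiff : ∀ i : Fin n, (∃ x, φ x = v i.castSucc) ↔ ∃ x, φ x = v i.succ := fun i => by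
    constructor
    · rintro ⟨x, hx⟩
      exact (h i.succ).resolve_right fun h1 => hsucc i (by rw [← hx, h1])
    · rintro ⟨x, hx⟩
      exact (h i.castSucc).resolve_right fun h1 => hsucc i (by rw [L.symm, ← hx, h1])
  have hall : ∀ i, (∃ x, φ x = v i) ↔ ∃ x, φ x = v 0 := fun i => by
    induction i using Fin.induction with
    | zero => rfl
    | succ i ih => exact (hiff i).symm.trans ih
  refine (L.symm _ _).trans ((h i).resolve_left (fun h1 => ?_) x)
  choose w hw using fun j => (hall j).mpr ((hall i).mp h1)
  have hw' : LinearIndependent (𝓞 K) w := LinearIndependent.of_comp φ (by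
    have : ⇑φ ∘ w = v := funext hw
    rwa [this])
  have := hw'.fintype_card_le_finrank
  rw [Fintype.card_fin, ← rank_eq_finrank] at this
  omega

end OKLattice

section Growth

theorem add_le_minUnivRank (d n : ℕ) (C : ℝ) {Y₀ : ℝ} (hY₀ : 1 ≤ Y₀) :
    ∃ Y Δ : ℝ, ∀ (K : Type) [Field K] [NumberField K] (F : IntermediateField ℚ K),
      TotallyReal K → Module.finrank ℚ K = d → Δ < |discr K| → F ≠ ⊤ →
      (∀ x : 𝓞 K, (∀ σ : K →+* ℝ, |σ x| ≤ Y) → (x : K) ∈ F) →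
      (∃ s : Set (𝓞 F), Submodule.span ℤ s = ⊤ ∧
        ∀ c ∈ s, ∀ σ : K →+* ℝ, |σ ((c : F) : K)| ≤ Y₀) →
      (minUnivRank K n : ℝ) + C ≤ minUnivRank K (n + 4) := by
  obtain ⟨Y₁, Δ, h19⟩ := KLattice.exists_representation_norm_two d n hY₀
  obtain ⟨g, hg⟩ := exists_lattice_representing_sum_sq n d
  obtain ⟨k, hk⟩ := exists_nat_ge (g + C)
  let q : Fin k → ℕ := fun j => Nat.nth Nat.Prime (j + n + 7)
  have hq : ∀ j, (q j).Prime := fun j => Nat.prime_nth_prime _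
  have hqle : ∀ j, j + n + 9 ≤ q j := fun j => Nat.add_two_le_nth_prime _
  have hqinj : ∀ i j, i ≠ j → (q i).Coprime (q j) := fun i j hij =>
    (Nat.coprime_primes (hq i) (hq j)).mpr fun h => hij <| by
      have := Nat.nth_injective Nat.infinite_setOfPred_prime h
      exact Fin.ext (by omega)
  let X : ℝ := ∑ j, (q j : ℝ) ^ 2 + 1
  have hX : ∀ j, (q j : ℝ) ^ 2 ≤ X := fun j => (Finset.single_le_sum
    (f := fun j => (q j : ℝ) ^ 2) (fun _ _ => sq_nonneg _) (Finset.mem_univ j)).trans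
      (by linarith)
  have hX1 : 1 ≤ X := le_add_of_nonneg_left (Finset.sum_nonneg fun _ _ => sq_nonneg _)
  refine ⟨max Y₁ (X * (X + 1)), Δ, fun K _ _ F hK hd hdisc hF h3 h4 => ?_⟩
  obtain ⟨σ₀⟩ := hK.nonempty_emb
  have hB : ∀ j, Nonempty (RootBlock K n (q j) X) := fun j => by
    have hlt : n + 2 < q j := by have := hqle j; omega
    refine nonempty_rootBlock n (hq j) (by have := hqle j; omega)
      (fun h => by have := Nat.le_of_dvd (by omega) h; omega) hX1 hK hF fun x hx => h3 x fun σ => ?_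
    refine (hx σ).trans (le_max_of_le_right (mul_le_mul_of_nonneg_right ?_ (by linarith)))
    have h1 : (1 : ℝ) ≤ q j := by exact_mod_cast (hq j).one_le
    have := hX j
    nlinarith
  let B : ∀ j, RootBlock K n (q j) X := fun j => (hB j).some
  obtain ⟨L, hL, hLr⟩ := exists_isUniversal_rank_eq hK (n + 4)
  choose τ hτ using fun j => hL.represents_of_rank_le (B j).lattice (B j).rank_le
  replace hτ := fun j => OKLattice.form_map_of_form_self (hτ j)
  let v : Fin k → Fin (n + 1) → L.carrier := fun j i => τ j ((B j).root i)
  have hv : ∀ j, LinearIndependent (𝓞 K) (v j) := fun j =>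
    (B j).linearIndependent_root.map' (τ j) (LinearMap.ker_eq_bot'.mpr fun x hx =>
      (B j).lattice.eq_zero_of_form_self σ₀ (by rw [← hτ, hx, map_zero]))
  have hv' := L.linearIndependent_uncurry σ₀ hv fun j j' hj i i' =>
    RootBlock.form_root_eq_zero hK (hq j).ne_zero (hqinj j j' hj) (hX j') (hτ j) (hτ j') i i'
  obtain ⟨H, hHr, hH⟩ := hg K hd
  have huniv := OKLattice.isUniversal_prod_of_tight hK
    (L₀ := L.orthogonal fun a : Fin k × Fin (n + 1) => v a.1 a.2) hH
    fun m hm Q hfull hmax htight => by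
      obtain ⟨φ, hφ, hroot⟩ := h19 K (Fin m → K) F hK hd hdisc (by simpa using hm)
        (fun x hx => h3 x fun σ => (hx σ).trans (le_max_left _ _)) h4 Q hfull hmax htight L hL
      refine OKLattice.represents_orthogonal φ hφ fun x a => ?_
      refine OKLattice.form_eq_zero_of_chain (hv a.1) (fun i => ?_)
        (Q.rank_toOKLattice_le.trans (by simpa using hm)) (fun i => ?_) x a.2
      · rw [hτ]
        exact (B a.1).form_root_succ i
      · obtain ⟨π, hπ⟩ := OKLattice.exists_projection σ₀ (τ a.1) (B a.1).exists_form_eq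
        refine hroot _ (by rw [hτ, (B a.1).form_root]) fun y z hyz h0 => ?_
        exact OKLattice.eq_zero_or_eq_zero_of_form_eq_two hK (hτ a.1) hπ (B a.1).form_ne_one
          ((B a.1).form_root i) hyz h0
  have h1 := minUnivRank_le huniv
  have h2 := L.rank_orthogonal_add_card_le σ₀ hv'
  rw [OKLattice.rank_prod, hHr] at h1
  rw [hLr, Fintype.card_prod, Fintype.card_fin, Fintype.card_fin] at h2
  have h5 : minUnivRank K n + k ≤ g + minUnivRank K (n + 4) := by
    have : k ≤ k * (n + 1) := Nat.le_mul_of_pos_right k n.succ_pos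
    omega
  have h6 : (minUnivRank K n : ℝ) + k ≤ g + minUnivRank K (n + 4) := by exact_mod_cast h5
  linarith

end Growth

section Finiteness

open Polynomial in
/-- The algebraic integers with bounded conjugates in the totally real subfields of `ℝ` of degree
`d` form a finite set. -/
lemma finite_house_le_of_finrank_eq (d : ℕ) (Y : ℝ) :
    {x : ℝ | ∃ (K : Subfield ℝ) (_ : NumberField K), TotallyReal K ∧ Module.finrank ℚ K = d ∧
      ∃ y : 𝓞 K, (∀ σ : K →+* ℝ, |σ (y : K)| ≤ Y) ∧ ((y : K) : ℝ) = x}.Finite := by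
  let N := ⌈max Y 1 ^ d * (d.choose (d / 2) : ℝ)⌉₊
  refine (bUnion_roots_finite (algebraMap ℤ ℝ) d (Set.finite_Icc (-N : ℤ) N)).subset ?_
  rintro _ ⟨K, _, hK, rfl, y, hy, rfl⟩
  have hint : IsIntegral ℤ (y : K) := y.isIntegral_coe
  have hbdd : ∀ φ : K →+* ℂ, ‖φ (y : K)‖ ≤ Y := fun φ => by
    rw [← hK.ofReal_toReal φ]
    simpa using hy (hK.toReal φ)
  have hmin := minpoly.isIntegrallyClosed_eq_field_fractions' ℚ hint
  simp_rw [Set.mem_iUnion]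
  refine ⟨minpoly ℤ (y : K), ⟨?_, fun i => ?_⟩, ?_⟩
  · rw [← (minpoly.monic hint).natDegree_map (algebraMap ℤ ℚ), ← hmin]
    exact minpoly.natDegree_le _
  · rw [Set.mem_Icc, ← abs_le, ← @Int.cast_le ℝ]
    refine (Eq.trans_le ?_ <| Embeddings.coeff_bdd_of_norm_le hbdd i).trans (Nat.le_ceil _)
    rw [hmin, coeff_map, eq_intCast, Int.norm_cast_rat, Int.norm_eq_abs, Int.cast_abs]
  · simp only [Finset.mem_coe, Multiset.mem_toFinset]
    refine (mem_roots_map_of_injective (RingHom.injective_int (algebraMap ℤ ℝ))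
      (minpoly.ne_zero hint)).mpr ?_
    rw [← aeval_def]
    have := aeval_algHom_apply K.subtype.toIntAlgHom (y : K) (minpoly ℤ (y : K))
    rw [minpoly.aeval, map_zero] at this
    exact this

/-- The **Hermite theorem** for subfields of `ℝ`. -/
lemma finite_abs_discr_le (Δ : ℝ) :
    {K : Subfield ℝ | ∃ _ : NumberField K, ((|discr K| : ℤ) : ℝ) ≤ Δ}.Finite := by
  refine ((finite_of_discr_bdd ℝ ⌈Δ⌉₊).image fun F => F.1.toSubfield).subset ?_
  rintro K ⟨hK, h⟩
  let E : IntermediateField ℚ ℝ := { K with algebraMap_mem' := fun q => by simp }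
  have : FiniteDimensional ℚ E := hK.to_finiteDimensional
  refine ⟨⟨E, this⟩, ?_, rfl⟩
  have : |discr K| ≤ (⌈Δ⌉₊ : ℤ) := by
    have := h.trans (Nat.le_ceil Δ)
    exact_mod_cast this
  exact this

/-- A family of totally real subfields of `ℝ` of degree `d` is finite if for each fixed field `F`,
its members containing `F` as the field of their integers with bounded conjugates have bounded
discriminants. -/
lemma finite_of_forall_abs_discr_le {S : Set (Subfield ℝ)} {d : ℕ}
    (hS : ∀ K ∈ S, FiniteDimensional ℚ K ∧ TotallyReal K ∧ Module.finrank ℚ K = d)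
    (h : ∀ F : IntermediateField ℚ ℝ, FiniteDimensional ℚ F → ∃ Y Δ : ℝ, ∀ K ∈ S,
      ∀ [NumberField K], F.toSubfield < K →
        (∀ x : 𝓞 K, (∀ σ : K →+* ℝ, |σ (x : K)| ≤ Y) → ((x : K) : ℝ) ∈ F) →
          ((|discr K| : ℤ) : ℝ) ≤ Δ) : S.Finite := by
  have hnf : ∀ K ∈ S, NumberField K := fun K hK =>
    { to_charZero := inferInstance, to_finiteDimensional := (hS K hK).1 }
  have key : ∀ (k : ℕ) (F : IntermediateField ℚ ℝ), FiniteDimensional ℚ F →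
      d < Module.finrank ℚ F + k → {K ∈ S | F.toSubfield ≤ K}.Finite := by
    intro k
    induction k with
    | zero =>
      refine fun F _ hF => Set.finite_empty.subset ?_
      rintro K ⟨hKS, hFK⟩
      obtain ⟨_, -, hd⟩ := hS K hKS
      let f : F →ₗ[ℚ] K := (Subfield.inclusion hFK).toRatAlgHom.toLinearMap
      have := LinearMap.finrank_le_finrank_of_injective (f := f)
        (Subfield.inclusion hFK).injective
      omega
    | succ k ih =>
      intro F hfin hF
      obtain ⟨Y, Δ, hYΔ⟩ := h F hfin
      have h1 : ∀ x : ℝ, {K ∈ S | F.toSubfield ≤ K ∧ x ∈ K ∧ x ∉ F}.Finite := fun x => by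
        rcases Set.eq_empty_or_nonempty {K ∈ S | F.toSubfield ≤ K ∧ x ∈ K ∧ x ∉ F} with h0 | h0
        · rw [h0]
          exact Set.finite_empty
        obtain ⟨K₀, hK₀, -, hx₀, hx⟩ := h0
        have := (hS K₀ hK₀).1
        have hxint : IsIntegral ℚ x :=
          (Algebra.IsIntegral.isIntegral (⟨x, hx₀⟩ : K₀)).map K₀.subtype.toRatAlgHom
        have := IntermediateField.adjoin.finiteDimensional hxint
        let F' := F ⊔ IntermediateField.adjoin ℚ {x}
        have hfin' : FiniteDimensional ℚ F' := IntermediateField.finiteDimensional_sup _ _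
        have hxF' : x ∈ F' := (le_sup_right : _ ≤ F') (IntermediateField.mem_adjoin_simple_self ℚ x)
        have hlt : Module.finrank ℚ F < Module.finrank ℚ F' := by
          by_contra hle
          refine hx ?_
          rw [IntermediateField.eq_of_le_of_finrank_le (le_sup_left : F ≤ F') (not_lt.mp hle)]
          exact hxF'
        refine (ih F' hfin' (by omega)).subset ?_
        rintro K ⟨hKS, hFK, hxK, -⟩
        refine ⟨hKS, ?_⟩
        let E : IntermediateField ℚ ℝ := { K with algebraMap_mem' := fun q => by simp }
        have : F' ≤ E := sup_le hFK
          (IntermediateField.adjoin_le_iff.mpr (Set.singleton_subset_iff.mpr hxK))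
        exact this
      refine ((((finite_house_le_of_finrank_eq d Y).biUnion fun x _ => h1 x).union
        (Set.finite_singleton F.toSubfield)).union (finite_abs_discr_le Δ)).subset ?_
      rintro K ⟨hKS, hFK⟩
      have := hnf K hKS
      by_cases h2 : ∀ x : 𝓞 K, (∀ σ : K →+* ℝ, |σ (x : K)| ≤ Y) → ((x : K) : ℝ) ∈ F
      · rcases eq_or_lt_of_le hFK with h3 | h3
        · exact Or.inl (Or.inr h3.symm)
        · exact Or.inr ⟨this, hYΔ K hKS h3 h2⟩
      · push Not at h2
        obtain ⟨x, hx, hxF⟩ := h2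
        refine Or.inl (Or.inl (Set.mem_biUnion (x := ((x : K) : ℝ)) ?_ ⟨hKS, hFK, (x : K).2, hxF⟩))
        exact ⟨K, this, (hS K hKS).2.1, (hS K hKS).2.2, x, hx, rfl⟩
  refine (key (d + 1) ⊥ inferInstance (by omega)).subset fun K hK => ⟨hK, ?_⟩
  let E : IntermediateField ℚ ℝ := { K with algebraMap_mem' := fun q => by simp }
  exact (bot_le : ⊥ ≤ E)

/-- The integers of a subfield of `ℝ` of finite degree are generated by elements whose conjugates
are bounded in all extensions. -/
lemma exists_span_eq_top_of_finiteDimensional (F : IntermediateField ℚ ℝ)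
    [FiniteDimensional ℚ F] :
    ∃ Y₀ : ℝ, 1 ≤ Y₀ ∧ ∀ K : Subfield ℝ, F.toSubfield ≤ K →
      ∃ s : Set (𝓞 (F.comap K.subtype.toRatAlgHom)), Submodule.span ℤ s = ⊤ ∧
        ∀ c ∈ s, ∀ σ : K →+* ℝ, |σ ((c : F.comap K.subtype.toRatAlgHom) : K)| ≤ Y₀ := by
  have : NumberField F := { to_charZero := inferInstance, to_finiteDimensional := inferInstance }
  obtain ⟨T, hT⟩ := (Module.Finite.fg_top : (⊤ : Submodule ℤ (𝓞 F)).FG)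
  let Y₀ : ℝ := 1 + ∑ t ∈ T, ∑ ρ : F →+* ℂ, ‖ρ (t : F)‖
  refine ⟨Y₀, le_add_of_nonneg_right (Finset.sum_nonneg fun _ _ => Finset.sum_nonneg fun _ _ =>
    norm_nonneg _), fun K hFK => ?_⟩
  let E := F.comap K.subtype.toRatAlgHom
  let e : F ≃+* E :=
    { toFun := fun x => ⟨⟨x, hFK x.2⟩, x.2⟩
      invFun := fun x => ⟨((x : K) : ℝ), x.2⟩
      left_inv := fun _ => rfl
      right_inv := fun _ => rfl
      map_mul' := fun _ _ => rfl
      map_add' := fun _ _ => rfl }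
  let f : 𝓞 F ≃+* 𝓞 E := RingOfIntegers.mapRingEquiv e
  refine ⟨f '' T, ?_, ?_⟩
  · have := congrArg (Submodule.map f.toAddMonoidHom.toIntLinearMap) hT
    rw [Submodule.map_span, Submodule.map_top, LinearMap.range_eq_top.mpr f.surjective] at this
    exact this
  · rintro _ ⟨t, ht, rfl⟩ σ
    let ρ : F →+* ℂ := ((Complex.ofRealHom.comp σ).comp (algebraMap E K)).comp e.toRingHom
    have h1 : ‖ρ (t : F)‖ = |σ ((f t : E) : K)| :=
      (Complex.norm_real _).trans (Real.norm_eq_abs _)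
    rw [← h1]
    refine ((Finset.single_le_sum (f := fun ρ : F →+* ℂ => ‖ρ (t : F)‖)
      (fun _ _ => norm_nonneg _) (Finset.mem_univ ρ)).trans
      (Finset.single_le_sum (f := fun t : 𝓞 F => ∑ ρ : F →+* ℂ, ‖ρ (t : F)‖)
        (fun _ _ => Finset.sum_nonneg fun _ _ => norm_nonneg _) ht)).trans
        (le_add_of_nonneg_left zero_le_one)

end Finiteness

theorem stmt6 (C : ℝ) (hC : 0 < C) (d : ℕ) (hd : 1 ≤ d) (n : ℕ) (hn : 0 < n)
    (hne : Even n) :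
    {K : Subfield ℝ |
      FiniteDimensional ℚ K ∧ TotallyReal K ∧ Module.finrank ℚ K = d ∧
        (minUnivRank K (n + 4) : ℝ) < (minUnivRank K n : ℝ) + C}.Finite := by
  refine finite_of_forall_abs_discr_le (fun K hK => ⟨hK.1, hK.2.1, hK.2.2.1⟩) fun F _ => ?_
  obtain ⟨Y₀, hY₀, hspan⟩ := exists_span_eq_top_of_finiteDimensional F
  obtain ⟨Y, Δ, h⟩ := add_le_minUnivRank d n C hY₀
  refine ⟨Y, Δ, fun K hK _ hlt hY => ?_⟩
  by_contra hdisc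
  refine hK.2.2.2.not_ge (h K (F.comap K.subtype.toRatAlgHom) hK.2.1 hK.2.2.1
    (not_le.mp hdisc) (fun htop => hlt.not_ge fun x hx => ?_) hY (hspan K hlt.le))
  have : (⟨x, hx⟩ : K) ∈ F.comap K.subtype.toRatAlgHom := htop ▸ IntermediateField.mem_top
  exact this
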